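/- Let G be a finite connected subcubic simple graph on n vertices and m edges with girth at least five such that G contains no induced subdivision of any member of the family 𝓕 and G is not isomorphic to any member of F_{3,3} ∪ F_{4,4}. Then φ(G) ≤ (2m − n + 2)/7. -/

import Mathlib

open SimpleGraph

/-- The minimum size of a feedback vertex set of `G`. -/
noncomputable def phi {V : Type} (G : SimpleGraph V) : ℕ :=
  sInf {n : ℕ | ∃ S : Finset V, S.card = n ∧ (G.induce ((S : Set V)ᶜ)).IsAcyclic}

/-- The graph obtained from `H` by subdividing the edge `uv` once: delete the edge `uv`
and add a new vertex (`none`) adjacent exactly to `u` and `v`. -/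
def subdivideEdge {V : Type} (H : SimpleGraph V) (u v : V) : SimpleGraph (Option V) :=
  SimpleGraph.fromRel (fun x y =>
    (∃ p q : V, x = some p ∧ y = some q ∧ H.Adj p q ∧ s(p, q) ≠ s(u, v)) ∨
    (x = none ∧ (y = some u ∨ y = some v)))

/-- `a` has degree exactly two in `H`. -/
def HasDegreeTwo {V : Type} (H : SimpleGraph V) (a : V) : Prop :=
  ∃ x y : V, x ≠ y ∧ H.Adj a x ∧ H.Adj a y ∧ ∀ z : V, H.Adj a z → z = x ∨ z = y

/-- The operation `∘` applied with two distinct edges `u₁v₁`, `u₂v₂` and a degree-two vertex `a`: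
subdivide both edges (new vertices `inr 0`, `inr 1`), then add a new vertex `inr 2` adjacent to
`a` and the two subdivision vertices. -/
def circOpTwo {V : Type} (H : SimpleGraph V) (u₁ v₁ u₂ v₂ a : V) : SimpleGraph (V ⊕ Fin 3) :=
  SimpleGraph.fromRel (fun x y =>
    (∃ p q : V, x = Sum.inl p ∧ y = Sum.inl q ∧ H.Adj p q ∧
      s(p, q) ≠ s(u₁, v₁) ∧ s(p, q) ≠ s(u₂, v₂)) ∨
    (x = Sum.inr 0 ∧ (y = Sum.inl u₁ ∨ y = Sum.inl v₁)) ∨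
    (x = Sum.inr 1 ∧ (y = Sum.inl u₂ ∨ y = Sum.inl v₂)) ∨
    (x = Sum.inr 2 ∧ (y = Sum.inl a ∨ y = Sum.inr 0 ∨ y = Sum.inr 1)))

/-- The operation `∘` applied with `e₁ = e₂ = uv` and a degree-two vertex `a`: subdivide the
edge `uv` twice (replacing it by the path `u, inr 0, inr 1, v`), then add a new vertex `inr 2`
adjacent to `a` and the two subdivision vertices. -/
def circOpOne {V : Type} (H : SimpleGraph V) (u v a : V) : SimpleGraph (V ⊕ Fin 3) :=
  SimpleGraph.fromRel (fun x y =>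
    (∃ p q : V, x = Sum.inl p ∧ y = Sum.inl q ∧ H.Adj p q ∧ s(p, q) ≠ s(u, v)) ∨
    (x = Sum.inr 0 ∧ (y = Sum.inl u ∨ y = Sum.inr 1)) ∨
    (x = Sum.inr 1 ∧ y = Sum.inl v) ∨
    (x = Sum.inr 2 ∧ (y = Sum.inl a ∨ y = Sum.inr 0 ∨ y = Sum.inr 1)))

/-- `G` is obtained from `H` by one application of the operation `∘` at the degree-two
vertex `a`, using two (not necessarily distinct) edges of `H`. -/
def IsCircOp {V : Type} (H : SimpleGraph V) (a : V) (G : SimpleGraph (V ⊕ Fin 3)) : Prop :=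
  (∃ u₁ v₁ u₂ v₂ : V, H.Adj u₁ v₁ ∧ H.Adj u₂ v₂ ∧ s(u₁, v₁) ≠ s(u₂, v₂) ∧
      G = circOpTwo H u₁ v₁ u₂ v₂ a) ∨
  (∃ u v : V, H.Adj u v ∧ G = circOpOne H u v a)

/-- Membership (up to isomorphism) in the family `F_{i,j}`. -/
inductive IsInF : ∀ (i j : ℕ) {V : Type}, SimpleGraph V → Prop
  | cycle (i : ℕ) (hi : 3 ≤ i) : IsInF i 0 (SimpleGraph.cycleGraph i)
  | k4 : IsInF 1 1 (⊤ : SimpleGraph (Fin 4))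
  | subdiv {i j : ℕ} {V : Type} {H : SimpleGraph V} {u v : V}
      (huv : H.Adj u v) (hH : IsInF i j H) : IsInF (i + 1) j (subdivideEdge H u v)
  | op {i j : ℕ} {V : Type} {H : SimpleGraph V} {a : V} {G : SimpleGraph (V ⊕ Fin 3)}
      (ha : HasDegreeTwo H a) (hG : IsCircOp H a G) (hH : IsInF i j H) : IsInF i (j + 1) G
  | iso {i j : ℕ} {V W : Type} {H : SimpleGraph V} {G : SimpleGraph W}
      (e : Nonempty (G ≃g H)) (hH : IsInF i j H) : IsInF i j G

/-- `G` is a graph obtained from `H` by repeatedly (possibly zero times) subdividing edges. -/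
inductive IsSubdivisionOf : ∀ {V : Type}, SimpleGraph V → ∀ {W : Type}, SimpleGraph W → Prop
  | refl {V : Type} (G : SimpleGraph V) : IsSubdivisionOf G G
  | step {V W : Type} {H : SimpleGraph V} {G : SimpleGraph W} {u v : W}
      (huv : G.Adj u v) (h : IsSubdivisionOf H G) : IsSubdivisionOf H (subdivideEdge G u v)

/-- `G` contains an induced subdivision of `H`: some induced subgraph of `G` is isomorphic
to a graph obtained from `H` by repeatedly subdividing edges. -/
def ContainsInducedSubdivision {V W : Type} (G : SimpleGraph V) (H : SimpleGraph W) : Prop :=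
  ∃ (s : Set V) (U : Type) (K : SimpleGraph U),
    IsSubdivisionOf H K ∧ Nonempty (G.induce s ≃g K)

/-- The family `𝓕`: members of `F_{4,2} ∪ F_{4,3}` of girth at least five, together with
members `H` of `F_{3,2} ∪ F_{3,3}` having an edge `e` such that `H − e` has girth at least
five. -/
def InFamilyF {W : Type} (H : SimpleGraph W) : Prop :=
  ((IsInF 4 2 H ∨ IsInF 4 3 H) ∧ 5 ≤ H.girth) ∨
  ((IsInF 3 2 H ∨ IsInF 3 3 H) ∧ ∃ e ∈ H.edgeSet, 5 ≤ (H.deleteEdges {e}).girth)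

/-- `G` contains two vertex-disjoint cycles, each of length less than five. -/
def HasTwoDisjointShortCycles {V : Type} (G : SimpleGraph V) : Prop :=
  ∃ (u v : V) (c₁ : G.Walk u u) (c₂ : G.Walk v v), c₁.IsCycle ∧ c₂.IsCycle ∧
    c₁.length < 5 ∧ c₂.length < 5 ∧ ∀ x : V, x ∈ c₁.support → x ∉ c₂.support

set_option linter.unusedSectionVars false
set_option linter.unusedVariables false
set_option linter.unusedSimpArgs false


section LinAlg
variable {K M : Type} [Field K] [AddCommGroup M] [Module K M] [FiniteDimensional K M]

def radW (B : LinearMap.BilinForm K M) (W : Submodule K M) : Submodule K M where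
  carrier := {f | f ∈ W ∧ ∀ g ∈ W, B f g = 0}
  add_mem' := by
    rintro a b ⟨ha, ha'⟩ ⟨hb, hb'⟩
    exact ⟨W.add_mem ha hb, fun g hg => by simp [ha' g hg, hb' g hg]⟩
  zero_mem' := ⟨W.zero_mem, by simp⟩
  smul_mem' := by
    rintro c a ⟨ha, ha'⟩
    exact ⟨W.smul_mem c ha, fun g hg => by simp [ha' g hg]⟩

theorem mem_radW {B : LinearMap.BilinForm K M} {W : Submodule K M} {f : M} :
    f ∈ radW B W ↔ f ∈ W ∧ ∀ g ∈ W, B f g = 0 := Iff.rfl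

theorem finrank_inf_ker (W : Submodule K M) (φ : M →ₗ[K] K) (w : M) (hw : w ∈ W) (hφ : φ w ≠ 0) :
    Module.finrank K (W ⊓ LinearMap.ker φ : Submodule K M) + 1 = Module.finrank K W := by
  have h1 := LinearMap.finrank_range_add_finrank_ker (φ.comp W.subtype)
  have h2 : LinearMap.range (φ.comp W.subtype) = ⊤ := by
    rw [LinearMap.range_eq_top]
    intro c
    refine ⟨(c / φ w) • ⟨w, hw⟩, ?_⟩
    simp [hφ]
  rw [h2] at h1
  have h3 : Submodule.map W.subtype (LinearMap.ker (φ.comp W.subtype)) = W ⊓ LinearMap.ker φ := by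
    ext x
    simp only [Submodule.mem_map, LinearMap.mem_ker, Submodule.mem_inf]
    constructor
    · rintro ⟨y, hy, rfl⟩
      exact ⟨y.2, hy⟩
    · rintro ⟨hx, hx'⟩
      exact ⟨⟨x, hx⟩, hx', rfl⟩
  have h4 := (Submodule.equivMapOfInjective W.subtype W.injective_subtype
    (LinearMap.ker (φ.comp W.subtype))).finrank_eq
  rw [h3] at h4
  simp only [finrank_top, Module.finrank_self] at h1
  omega

theorem split_finrank (B : LinearMap.BilinForm K M) (hB : ∀ f, B f f = 0) (hB' : ∀ f g, B f g = - B g f)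
    (W : Submodule K M) (f g : M) (hf : f ∈ W) (hg : g ∈ W) (h : B f g ≠ 0) :
    Module.finrank K (W ⊓ LinearMap.ker (B f) ⊓ LinearMap.ker (B g) : Submodule K M) + 2
      = Module.finrank K W ∧
    radW B (W ⊓ LinearMap.ker (B f) ⊓ LinearMap.ker (B g)) = radW B W := by
  constructor
  · have h1 := finrank_inf_ker W (B f) g hg h
    have h2 := finrank_inf_ker (W ⊓ LinearMap.ker (B f)) (B g) f ⟨hf, hB f⟩
      (by rw [hB']; simpa using h)
    omega
  · ext x
    simp only [mem_radW, Submodule.mem_inf, LinearMap.mem_ker]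
    constructor
    · rintro ⟨⟨⟨hx, hfx⟩, hgx⟩, hx'⟩
      refine ⟨hx, fun w hw => ?_⟩
      have hgf : B g f = - B f g := hB' g f
      have key := hx' (w - (B f w / B f g) • g + (B g w / B f g) • f) ⟨⟨?_, ?_⟩, ?_⟩
      · have e1 : B x f = 0 := by rw [hB', hfx, neg_zero]
        have e2 : B x g = 0 := by rw [hB', hgx, neg_zero]
        simpa [e1, e2] using key
      · exact W.add_mem (W.sub_mem hw (W.smul_mem _ hg)) (W.smul_mem _ hf)
      · simp [hB, h]
      · simp [hB, hgf, h]
    · rintro ⟨hx, hx'⟩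
      refine ⟨⟨⟨hx, ?_⟩, ?_⟩, fun w hw => hx' w hw.1.1⟩
      · rw [hB', hx' f hf, neg_zero]
      · rw [hB', hx' g hg, neg_zero]

theorem even_finrank_add (B : LinearMap.BilinForm K M) (hB : ∀ f, B f f = 0)
    (hB' : ∀ f g, B f g = - B g f) (n : ℕ) :
    ∀ (W : Submodule K M), Module.finrank K W = n →
      Even (Module.finrank K W + Module.finrank K (radW B W)) := by
  induction n using Nat.strong_induction_on with
  | _ n ih =>
    intro W hW
    by_cases hz : ∀ f ∈ W, ∀ g ∈ W, B f g = 0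
    · have : radW B W = W := by
        ext x
        exact ⟨fun h => h.1, fun h => ⟨h, hz x h⟩⟩
      rw [this]
      exact ⟨_, rfl⟩
    · push Not at hz
      obtain ⟨f, hf, g, hg, h⟩ := hz
      obtain ⟨h1, h2⟩ := split_finrank B hB hB' W f g hf hg h
      have := ih (Module.finrank K (W ⊓ LinearMap.ker (B f) ⊓ LinearMap.ker (B g) : Submodule K M))
        (by omega) _ rfl
      rw [h2] at this
      rw [← h1]
      rw [Nat.even_iff] at this ⊢
      omega

end LinAlg


section Cyc
variable {V : Type} [Fintype V] [DecidableEq V] {K : Type} [Field K]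

def cyc (K : Type) [Field K] (H : SimpleGraph V) : Submodule K (V → V → K) where
  carrier := {f | (∀ u v, f u v = - f v u) ∧ (∀ u v, ¬ H.Adj u v → f u v = 0) ∧
    ∀ u, ∑ v, f u v = 0}
  add_mem' := by
    rintro a b ⟨h1, h2, h3⟩ ⟨k1, k2, k3⟩
    refine ⟨fun u v => ?_, fun u v h => ?_, fun u => ?_⟩
    · simp only [Pi.add_apply]; rw [h1, k1]; ring
    · simp [h2 u v h, k2 u v h]
    · simp [Finset.sum_add_distrib, h3, k3]
  zero_mem' := by simp
  smul_mem' := by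
    rintro c a ⟨h1, h2, h3⟩
    refine ⟨fun u v => ?_, fun u v h => ?_, fun u => ?_⟩
    · simp only [Pi.smul_apply, smul_eq_mul]; rw [h1]; ring
    · simp [h2 u v h]
    · simp [← Finset.mul_sum, h3]

theorem mem_cyc {H : SimpleGraph V} {f : V → V → K} : f ∈ cyc K H ↔
    (∀ u v, f u v = - f v u) ∧ (∀ u v, ¬ H.Adj u v → f u v = 0) ∧
    ∀ u, ∑ v, f u v = 0 := Iff.rfl

theorem cyc_mono {H H' : SimpleGraph V} (h : H ≤ H') : cyc K H ≤ cyc K H' := by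
  intro f hf
  exact ⟨hf.1, fun u v huv => hf.2.1 u v (fun h' => huv (h h')), hf.2.2⟩

/-- flow across a cut vanishes -/
theorem cyc_cut {H : SimpleGraph V} {f : V → V → K} (hf : f ∈ cyc K H) [CharZero K] (S : Finset V) :
    ∑ x ∈ S, ∑ y ∈ Sᶜ, f x y = 0 := by
  obtain ⟨h1, h2, h3⟩ := hf
  have e1 : ∑ x ∈ S, ∑ y ∈ S, f x y = 0 := by
    have : ∑ x ∈ S, ∑ y ∈ S, f x y = - ∑ x ∈ S, ∑ y ∈ S, f x y := by
      conv_lhs => rw [Finset.sum_comm]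
      rw [← Finset.sum_neg_distrib]
      refine Finset.sum_congr rfl fun x _ => ?_
      rw [← Finset.sum_neg_distrib]
      exact Finset.sum_congr rfl fun y _ => h1 _ _
    exact self_eq_neg.mp this
  have e2 : ∑ x ∈ S, (∑ y ∈ S, f x y + ∑ y ∈ Sᶜ, f x y) = 0 := by
    refine Finset.sum_eq_zero fun x _ => ?_
    rw [Finset.sum_add_sum_compl, h3]
  rw [Finset.sum_add_distrib, e1, zero_add] at e2
  exact e2

theorem cyc_bridge [CharZero K] {H : SimpleGraph V} {f : V → V → K} (hf : f ∈ cyc K H) {u v : V}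
    (hb : H.IsBridge s(u, v)) : f u v = 0 := by
  classical
  rw [isBridge_iff] at hb
  have := cyc_cut hf (Finset.univ.filter fun w => (H.deleteEdges {s(u, v)}).Reachable u w)
  rw [Finset.sum_eq_single u, Finset.sum_eq_single v] at this
  · exact this
  · intro y hy hyv
    apply hf.2.1
    intro hadj
    simp only [Finset.mem_compl, Finset.mem_filter, Finset.mem_univ, true_and] at hy
    apply hy
    apply Adj.reachable
    rw [deleteEdges_adj]
    refine ⟨hadj, ?_⟩
    simp only [Set.mem_singleton_iff, Sym2.eq_iff, true_and, not_or, not_and]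
    exact ⟨hyv, fun h1 h2 => H.ne_of_adj hadj h2.symm⟩
  · intro h
    exact (h (by simpa using hb)).elim
  · intro x hx hxu
    refine Finset.sum_eq_zero fun y hy => hf.2.1 _ _ fun hadj => ?_
    simp only [Finset.mem_compl, Finset.mem_filter, Finset.mem_univ, true_and] at hy hx
    apply hy
    refine hx.trans (Adj.reachable ?_)
    rw [deleteEdges_adj]
    refine ⟨hadj, ?_⟩
    simp only [Set.mem_singleton_iff, Sym2.eq_iff, not_or, not_and]
    refine ⟨fun h => (hxu h).elim, fun h => ?_⟩
    subst h
    exact (hb hx).elim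
  · intro h
    exact (h (by simp)).elim

theorem cyc_acyclic [CharZero K] {H : SimpleGraph V} (hH : H.IsAcyclic) : cyc K H = ⊥ := by
  rw [eq_bot_iff]
  intro f hf
  rw [Submodule.mem_bot]
  ext u v
  by_cases h : H.Adj u v
  · exact cyc_bridge hf (isAcyclic_iff_forall_adj_isBridge.mp hH h)
  · exact hf.2.1 u v h

theorem walk_flow {H : SimpleGraph V} {x y : V} (w : H.Walk x y) : ∃ f : V → V → K,
    (∀ u v, f u v = - f v u) ∧ (∀ u v, ¬ H.Adj u v → f u v = 0) ∧
    ∀ u, ∑ v, f u v = (if u = x then 1 else 0) - (if u = y then 1 else 0) := by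
  induction w with
  | nil => exact ⟨0, by simp, by simp, by simp⟩
  | @cons a b c hab w ih =>
    obtain ⟨f, h1, h2, h3⟩ := ih
    refine ⟨fun u v => f u v + ((if u = a ∧ v = b then 1 else 0) - (if u = b ∧ v = a then 1 else 0)),
      fun u v => ?_, fun u v h => ?_, fun u => ?_⟩
    · simp only []
      rw [h1 u v]
      simp only [and_comm]
      ring
    · simp only []
      rw [h2 u v h, if_neg, if_neg]
      · simp
      · rintro ⟨rfl, rfl⟩; exact h hab.symm
      · rintro ⟨rfl, rfl⟩; exact h hab
    · simp only []
      rw [Finset.sum_add_distrib, h3, Finset.sum_sub_distrib]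
      have e : ∀ p q : V, ∑ v, (if u = p ∧ v = q then (1:K) else 0) = if u = p then 1 else 0 := by
        intro p q
        by_cases hp : u = p <;> simp [hp]
      rw [e, e]
      ring

theorem exists_cyc_of_not_acyclic {H : SimpleGraph V} (h : ¬ H.IsAcyclic) : cyc K H ≠ ⊥ := by
  rw [isAcyclic_iff_forall_adj_isBridge] at h
  push Not at h
  obtain ⟨u, v, huv, hb⟩ := h
  rw [isBridge_iff, not_not] at hb
  obtain ⟨w⟩ := hb.symm
  obtain ⟨f, h1, h2, h3⟩ := walk_flow (K := K) w
  have hne := H.ne_of_adj huv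
  intro hbot
  have hmem : (fun a b => f a b + ((if a = u ∧ b = v then 1 else 0) - (if a = v ∧ b = u then 1 else 0)))
      ∈ cyc K H := by
    refine ⟨fun a b => ?_, fun a b hab => ?_, fun a => ?_⟩
    · simp only []
      rw [h1 a b]
      simp only [and_comm]
      ring
    · simp only []
      rw [h2 a b (fun h => hab (deleteEdges_le _ h)), if_neg, if_neg]
      · simp
      · rintro ⟨rfl, rfl⟩; exact hab huv.symm
      · rintro ⟨rfl, rfl⟩; exact hab huv
    · simp only []
      rw [Finset.sum_add_distrib, h3, Finset.sum_sub_distrib]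
      have e : ∀ p q : V, ∑ v, (if a = p ∧ v = q then (1:K) else 0) = if a = p then 1 else 0 := by
        intro p q
        by_cases hp : a = p <;> simp [hp]
      rw [e, e]
      ring
  rw [hbot, Submodule.mem_bot] at hmem
  have := congrFun (congrFun hmem u) v
  simp only [and_self, if_true, Pi.zero_apply] at this
  rw [h2 u v (by simp), if_neg (by rintro ⟨h, -⟩; exact hne h)] at this
  simp at this

/-- the alternating form -/
def omg (p q : V → V) (t : V → K) : LinearMap.BilinForm K (V → V → K) :=
  LinearMap.mk₂ K (fun f g => ∑ v, t v * (f v (p v) * g v (q v) - f v (q v) * g v (p v)))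
    (by intros; simp only [Pi.add_apply, ← Finset.sum_add_distrib]; congr 1; ext; ring)
    (by intros; simp only [Pi.smul_apply, smul_eq_mul, Finset.mul_sum]; congr 1; ext; ring)
    (by intros; simp only [Pi.add_apply, ← Finset.sum_add_distrib]; congr 1; ext; ring)
    (by intros; simp only [Pi.smul_apply, smul_eq_mul, Finset.mul_sum]; congr 1; ext; ring)

theorem omg_apply (p q : V → V) (t : V → K) (f g : V → V → K) :
    omg p q t f g = ∑ v, t v * (f v (p v) * g v (q v) - f v (q v) * g v (p v)) := rfl

theorem omg_self (p q : V → V) (t : V → K) (f : V → V → K) : omg p q t f f = 0 := by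
  rw [omg_apply]
  exact Finset.sum_eq_zero fun v _ => by ring

theorem omg_anti (p q : V → V) (t : V → K) (f g : V → V → K) : omg p q t f g = - omg p q t g f := by
  rw [omg_apply, omg_apply, ← Finset.sum_neg_distrib]
  exact Finset.sum_congr rfl fun v _ => by ring

/-- the vertex-deletion -/
def rmv (H : SimpleGraph V) (S : Finset V) : SimpleGraph V where
  Adj u v := H.Adj u v ∧ u ∉ S ∧ v ∉ S
  symm := ⟨fun u v h => ⟨h.1.symm, h.2.2, h.2.1⟩⟩
  loopless := ⟨fun u h => H.loopless.irrefl u h.1⟩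

theorem cyc_deleteEdge {H : SimpleGraph V} {u v : V} {f : V → V → K} :
    f ∈ cyc K (H.deleteEdges {s(u, v)}) ↔ f ∈ cyc K H ∧ f u v = 0 := by
  constructor
  · intro h
    refine ⟨cyc_mono (deleteEdges_le _) h, h.2.1 u v (by simp)⟩
  · rintro ⟨h, h0⟩
    refine ⟨h.1, fun a b hab => ?_, h.2.2⟩
    by_cases hH : H.Adj a b
    · rw [deleteEdges_adj] at hab
      have : s(a, b) = s(u, v) := by
        by_contra hc
        exact hab ⟨hH, hc⟩
      rw [Sym2.eq_iff] at this
      rcases this with ⟨rfl, rfl⟩ | ⟨rfl, rfl⟩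
      · exact h0
      · rw [h.1, h0, neg_zero]
    · exact h.2.1 a b hH

structure Slots (G : SimpleGraph V) (p q r : V → V) : Prop where
  pq : ∀ v, p v ≠ q v
  pr : ∀ v, p v ≠ r v
  qr : ∀ v, q v ≠ r v
  adj : ∀ v w, G.Adj v w → w = p v ∨ w = q v ∨ w = r v

theorem Slots.sum {G : SimpleGraph V} {p q r : V → V} (s : Slots G p q r) {f : V → V → K}
    (hf : f ∈ cyc K G) (v : V) : f v (r v) = - f v (p v) - f v (q v) := by
  have h := hf.2.2 v
  rw [← Finset.sum_subset (Finset.subset_univ ({p v, q v, r v} : Finset V))] at h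
  · rw [Finset.sum_insert (by simp [s.pq v, s.pr v]), Finset.sum_insert (by simp [s.qr v]),
      Finset.sum_singleton] at h
    linear_combination h
  · intro x _ hx
    apply hf.2.1
    intro hadj
    simp only [Finset.mem_insert, Finset.mem_singleton] at hx
    exact hx (s.adj v x hadj)

theorem Slots.minor {G : SimpleGraph V} {p q r : V → V} (s : Slots G p q r) {f g : V → V → K}
    (hf : f ∈ cyc K G) (hg : g ∈ cyc K G) (v : V)
    (h : f v (p v) * g v (q v) - f v (q v) * g v (p v) = 0) (a b : V) :
    f v a * g v b = f v b * g v a := by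
  have h1 := s.sum hf v
  have h2 := s.sum hg v
  by_cases ha : G.Adj v a
  swap
  · rw [hf.2.1 v a ha, hg.2.1 v a ha]; ring
  by_cases hb : G.Adj v b
  swap
  · rw [hf.2.1 v b hb, hg.2.1 v b hb]; ring
  rcases s.adj v a ha with rfl | rfl | rfl <;> rcases s.adj v b hb with rfl | rfl | rfl <;>
    (try rw [h1]) <;> (try rw [h2]) <;>
    first | ring1 | linear_combination h | linear_combination -h

theorem cyc_rmv {G : SimpleGraph V} {p q r : V → V} (s : Slots G p q r) {H : SimpleGraph V}
    (hH : H ≤ G) (v : V) {f : V → V → K} : f ∈ cyc K (rmv H {v}) ↔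
    f ∈ cyc K H ∧ f v (p v) = 0 ∧ f v (q v) = 0 := by
  constructor
  · intro h
    exact ⟨cyc_mono (H := rmv H {v}) (fun _ _ h => And.left h) h, h.2.1 _ _ (by simp [rmv]), h.2.1 _ _ (by simp [rmv])⟩
  · rintro ⟨h, hp, hq⟩
    have hr := s.sum (cyc_mono hH h) v
    rw [hp, hq] at hr
    have hz : ∀ w, f v w = 0 := by
      intro w
      by_cases hw : H.Adj v w
      · rcases s.adj v w (hH hw) with rfl | rfl | rfl
        · exact hp
        · exact hq
        · rw [hr]; ring
      · exact h.2.1 _ _ hw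
    refine ⟨h.1, fun a b hab => ?_, h.2.2⟩
    by_cases hav : a = v
    · subst hav; exact hz b
    by_cases hbv : b = v
    · subst hbv; rw [h.1, hz, neg_zero]
    · exact h.2.1 a b fun hadj => hab ⟨hadj, by simpa using hav, by simpa using hbv⟩

end Cyc


section LemmaA
variable {V : Type} [Fintype V] [DecidableEq V] {K : Type} [Field K] [CharZero K]

theorem trace_arg (p q : V → V) (t : V → K) (W : Submodule K (V → V → K)) (hW : W ≠ ⊥)
    (hrad : radW (omg p q t) W = ⊥) : ∃ v, ∃ a ∈ W, ∃ b ∈ W, omg p q t a b ≠ 0 ∧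
    (∀ g ∈ W, omg p q t a g = g v (p v)) ∧ (∀ g ∈ W, omg p q t b g = g v (q v)) := by
  set B := omg p q t with hB
  let Φ : W →ₗ[K] (W →ₗ[K] K) := LinearMap.domRestrict₁₂ B W W
  have hΦ : ∀ f g : W, Φ f g = B f g := fun f g => rfl
  have hinj : Function.Injective Φ := by
    rw [← LinearMap.ker_eq_bot, eq_bot_iff]
    intro f hf
    rw [LinearMap.mem_ker] at hf
    have : (f : V → V → K) ∈ radW B W := ⟨f.2, fun g hg => by
      have := LinearMap.congr_fun hf ⟨g, hg⟩
      simpa [hΦ] using this⟩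
    rw [hrad, Submodule.mem_bot] at this
    rw [Submodule.mem_bot]
    exact Subtype.ext this
  have hsurj : Function.Surjective Φ :=
    (LinearMap.injective_iff_surjective_of_finrank_eq_finrank
      (Subspace.dual_finrank_eq (K := K) (V := W)).symm).mp hinj
  let ev (v w : V) : W →ₗ[K] K :=
    ((LinearMap.proj w).comp (LinearMap.proj (R := K) (φ := fun _ : V => V → K) v)).comp W.subtype
  have hev : ∀ v w (f : W), ev v w f = (f : V → V → K) v w := fun _ _ _ => rfl
  choose a ha using fun v => hsurj (ev v (p v))
  choose b hb using fun v => hsurj (ev v (q v))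
  have hid : (LinearMap.id : W →ₗ[K] W) =
      ∑ v, t v • ((ev v (p v)).smulRight (b v) + (-1 : K) • (ev v (q v)).smulRight (a v)) := by
    ext1 f
    apply hinj
    ext1 g
    simp only [LinearMap.id_apply, LinearMap.sum_apply, LinearMap.smul_apply, LinearMap.add_apply,
      LinearMap.smulRight_apply, map_sum, map_smul, map_add, ha, hb, hev, smul_eq_mul]
    rw [hΦ, hB, omg_apply]
    exact Finset.sum_congr rfl fun v _ => by ring
  have htr := congrArg (LinearMap.trace K W) hid
  rw [LinearMap.trace_id] at htr
  simp only [map_sum, map_smul] at htr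
  by_contra hcon
  push Not at hcon
  have hz : ∀ v, B (a v) (b v) = 0 := by
    intro v
    by_contra h
    obtain ⟨g, hg, hne⟩ := hcon v (a v) (a v).2 (b v) (b v).2 h (fun g hg => by
      have := LinearMap.congr_fun (ha v) ⟨g, hg⟩
      rw [hΦ] at this
      exact this)
    apply hne
    have := LinearMap.congr_fun (hb v) ⟨g, hg⟩
    rw [hΦ] at this
    exact this
  rw [Finset.sum_eq_zero] at htr
  · have : Module.finrank K W = 0 := by exact_mod_cast htr
    rw [Submodule.finrank_eq_zero] at this
    exact hW this
  · intro v _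
    rw [LinearMap.map_add, LinearMap.map_smul, LinearMap.trace_smulRight, LinearMap.trace_smulRight,
      ← ha, ← hb, hΦ, hΦ, hz, hB, omg_anti, ← hB, hz]
    simp

theorem radW_delete {p q : V → V} {t : V → K} {H : SimpleGraph V} {u v : V} {f : V → V → K}
    (hf : f ∈ radW (omg p q t) (cyc K H)) (hne : f u v ≠ 0) :
    radW (omg p q t) (cyc K (H.deleteEdges {s(u, v)})) ≤ radW (omg p q t) (cyc K H) := by
  intro x hx
  refine ⟨(cyc_deleteEdge.mp hx.1).1, fun g hg => ?_⟩
  have h1 := hx.2 (g - (g u v / f u v) • f) (cyc_deleteEdge.mpr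
    ⟨Submodule.sub_mem _ hg (Submodule.smul_mem _ _ hf.1), by simp [hne]⟩)
  have h2 : omg p q t x f = 0 := by
    rw [omg_anti, hf.2 x (cyc_deleteEdge.mp hx.1).1, neg_zero]
  simpa [h2] using h1

noncomputable def NN (p q : V → V) (t : V → K) (H : SimpleGraph V) : ℕ :=
  Module.finrank K (cyc K H) + Module.finrank K (radW (omg p q t) (cyc K H))

theorem NN_even (p q : V → V) (t : V → K) (H : SimpleGraph V) : Even (NN p q t H) :=
  even_finrank_add _ (omg_self p q t) (omg_anti p q t) _ _ rfl

theorem delEdge_lt {H : SimpleGraph V} {u v : V} (h : H.Adj u v) : H.deleteEdges {s(u, v)} < H := by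
  refine lt_of_le_of_ne (deleteEdges_le _) fun he => ?_
  rw [← he] at h
  simp at h

theorem lemmaA {G : SimpleGraph V} {p q r : V → V} (s : Slots G p q r) (t : V → K)
    (H : SimpleGraph V) (hH : H ≤ G) :
    ∃ S : Finset V, 2 * S.card ≤ NN p q t H ∧ (rmv H S).IsAcyclic := by
  induction H using WellFoundedLT.induction with
  | _ H ih =>
  by_cases hrad : radW (omg p q t) (cyc K H) = ⊥
  · by_cases hc : cyc K H = ⊥
    · refine ⟨∅, by simp, ?_⟩
      by_contra hcon
      exact exists_cyc_of_not_acyclic (K := K) (fun h => hcon (h.anti fun _ _ h => And.left h)) hc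
    · obtain ⟨v, a, ha, b, hb, hab, ha', hb'⟩ := trace_arg p q t _ hc hrad
      obtain ⟨h1, h2⟩ := split_finrank (omg p q t) (omg_self p q t) (omg_anti p q t) _ a b ha hb hab
      have hW : cyc K (rmv H {v}) = cyc K H ⊓ LinearMap.ker (omg p q t a) ⊓ LinearMap.ker (omg p q t b) := by
        ext f
        rw [cyc_rmv s hH]
        simp only [Submodule.mem_inf, LinearMap.mem_ker, and_assoc]
        constructor
        · rintro ⟨h, h1, h2⟩
          exact ⟨h, by rw [ha' f h, h1], by rw [hb' f h, h2]⟩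
        · rintro ⟨h, h1, h2⟩
          exact ⟨h, by rw [← ha' f h, h1], by rw [← hb' f h, h2]⟩
      have hle : rmv H {v} ≤ H := fun _ _ h => And.left h
      rw [← hW] at h1 h2
      have hlt : rmv H {v} < H := by
        refine lt_of_le_of_ne hle fun he => ?_
        rw [he] at h1
        omega
      obtain ⟨S, hS, hac⟩ := ih _ hlt (hle.trans hH)
      refine ⟨insert v S, ?_, hac.anti ?_⟩
      · have := Finset.card_insert_le v S
        unfold NN at hS ⊢
        rw [h2] at hS
        omega
      · rintro x y ⟨h, hx, hy⟩
        simp only [Finset.mem_insert, not_or] at hx hy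
        exact ⟨⟨h, by simpa using hx.1, by simpa using hy.1⟩, hx.2, hy.2⟩
  · obtain ⟨f, hf, hf0⟩ := Submodule.exists_mem_ne_zero_of_ne_bot hrad
    have : ∃ u v, f u v ≠ 0 := by
      by_contra hcon
      push Not at hcon
      exact hf0 (by ext u v; exact hcon u v)
    obtain ⟨u, v, huv⟩ := this
    have hadj : H.Adj u v := by
      by_contra hcon
      exact huv (hf.1.2.1 u v hcon)
    have hlt := delEdge_lt hadj
    obtain ⟨S, hS, hac⟩ := ih _ hlt (hlt.le.trans hH)
    have hnot : f ∉ cyc K (H.deleteEdges {s(u, v)}) := fun h => huv (cyc_deleteEdge.mp h).2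
    have h1 : Module.finrank K (cyc K (H.deleteEdges {s(u, v)})) < Module.finrank K (cyc K H) := by
      apply Submodule.finrank_lt_finrank_of_lt
      exact lt_of_le_of_ne (cyc_mono hlt.le) fun he => hnot (he ▸ hf.1)
    have h2 : Module.finrank K (radW (omg p q t) (cyc K (H.deleteEdges {s(u, v)}))) <
        Module.finrank K (radW (omg p q t) (cyc K H)) := by
      apply Submodule.finrank_lt_finrank_of_lt
      refine lt_of_le_of_ne (radW_delete hf huv) fun he => hnot ?_
      rw [← he] at hf
      exact hf.1
    refine ⟨insert u S, ?_, hac.anti ?_⟩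
    · have := Finset.card_insert_le u S
      unfold NN at hS ⊢
      omega
    · rintro x y ⟨h, hx, hy⟩
      simp only [Finset.mem_insert, not_or] at hx hy
      refine ⟨?_, hx.2, hy.2⟩
      rw [deleteEdges_adj]
      refine ⟨h, ?_⟩
      simp only [Set.mem_singleton_iff, Sym2.eq_iff, not_or, not_and]
      exact ⟨fun h => (hx.1 h).elim, fun _ h => hy.1 h⟩

theorem phi_le {G : SimpleGraph V} {S : Finset V} (h : (rmv G S).IsAcyclic) : phi G ≤ S.card := by
  apply Nat.sInf_le
  refine ⟨S, rfl, ?_⟩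
  refine h.comap (G := G.induce ((S : Set V)ᶜ)) ⟨Subtype.val, ?_⟩ Subtype.val_injective
  intro a b hab
  exact ⟨hab, fun h => a.2 h, fun h => b.2 h⟩

end LemmaA


section Deriv
variable {V : Type} [Fintype V] [DecidableEq V]

abbrev PV (V : Type) := MvPolynomial V ℚ
abbrev KV (V : Type) := FractionRing (MvPolynomial V ℚ)

noncomputable def tv (v : V) : KV V := algebraMap (PV V) (KV V) (MvPolynomial.X v)

noncomputable def liftF (F : V → V → PV V) : V → V → KV V := fun u v => algebraMap (PV V) (KV V) (F u v)

theorem alg_inj {a b : PV V} : algebraMap (PV V) (KV V) a = algebraMap (PV V) (KV V) b ↔ a = b :=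
  (IsFractionRing.injective (PV V) (KV V)).eq_iff

theorem alg_zero {a : PV V} : algebraMap (PV V) (KV V) a = 0 ↔ a = 0 := by
  rw [← map_zero (algebraMap (PV V) (KV V)), alg_inj]

theorem liftF_cyc {H : SimpleGraph V} {F : V → V → PV V} : liftF F ∈ cyc (KV V) H ↔
    (∀ u v, F u v = - F v u) ∧ (∀ u v, ¬ H.Adj u v → F u v = 0) ∧ ∀ u, ∑ v, F u v = 0 := by
  simp only [mem_cyc, liftF, alg_zero, ← map_neg, alg_inj, ← map_sum]

theorem pderiv_cyc {H : SimpleGraph V} {F : V → V → PV V} (hF : liftF F ∈ cyc (KV V) H) (x : V) :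
    liftF (fun u v => MvPolynomial.pderiv x (F u v)) ∈ cyc (KV V) H := by
  rw [liftF_cyc] at hF ⊢
  obtain ⟨h1, h2, h3⟩ := hF
  refine ⟨fun u v => ?_, fun u v h => ?_, fun u => ?_⟩
  · rw [h1 u v, map_neg]
  · rw [h2 u v h, map_zero]
  · rw [← map_sum, h3, map_zero]

theorem exists_liftF (f : V → V → KV V) : ∃ c : PV V, c ≠ 0 ∧ ∃ F, liftF F = algebraMap (PV V) (KV V) c • f := by
  obtain ⟨b, hb⟩ := IsLocalization.exist_integer_multiples_of_finite (nonZeroDivisors (PV V))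
    (fun x : V × V => f x.1 x.2)
  choose F hF using hb
  refine ⟨b, nonZeroDivisors.ne_zero b.2, fun u v => F (u, v), ?_⟩
  ext u v
  simp only [liftF, hF, Pi.smul_apply, smul_eq_mul, Algebra.smul_def]

theorem omg_lift (p q : V → V) (F G : V → V → PV V) : omg p q tv (liftF F) (liftF G) =
    algebraMap (PV V) (KV V) (∑ v, MvPolynomial.X v * (F v (p v) * G v (q v) - F v (q v) * G v (p v))) := by
  rw [omg_apply]
  simp only [map_sum, map_mul, map_sub, tv, liftF]

theorem der_fact (p q : V → V) (H : SimpleGraph V) {f g : V → V → KV V}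
    (hf : f ∈ radW (omg p q tv) (cyc (KV V) H)) (hg : g ∈ radW (omg p q tv) (cyc (KV V) H)) (v : V) :
    f v (p v) * g v (q v) - f v (q v) * g v (p v) = 0 := by
  obtain ⟨c, hc, F, hF⟩ := exists_liftF f
  obtain ⟨d, hd, G, hG⟩ := exists_liftF g
  have hf' := Submodule.smul_mem _ (algebraMap (PV V) (KV V) c) hf
  have hg' := Submodule.smul_mem _ (algebraMap (PV V) (KV V) d) hg
  rw [← hF] at hf'
  rw [← hG] at hg'
  have e1 := hf'.2 _ hg'.1
  have e2 := hf'.2 _ (pderiv_cyc hg'.1 v)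
  have e3 := hg'.2 _ (pderiv_cyc hf'.1 v)
  rw [omg_lift, alg_zero] at e1 e2 e3
  have e4 := congrArg (MvPolynomial.pderiv v) e1
  have key : F v (p v) * G v (q v) - F v (q v) * G v (p v) = 0 := by
    have e5 : ∑ w, (MvPolynomial.pderiv v (MvPolynomial.X w : PV V)) * (F w (p w) * G w (q w) - F w (q w) * G w (p w)) = 0 := by
      rw [map_zero, map_sum] at e4
      rw [← e4]
      have e6 : ∀ A B C D : PV V, B = 0 → C = 0 → A = D - B + C → A = D := by
        intro A B C D hB hC h; rw [h, hB, hC]; ring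
      refine e6 _ _ _ _ e2 e3 ?_
      rw [← Finset.sum_sub_distrib, ← Finset.sum_add_distrib]
      refine Finset.sum_congr rfl fun w _ => ?_
      simp only [Derivation.leibniz, map_sub, smul_eq_mul]
      ring
    rw [Finset.sum_eq_single v] at e5
    · simpa using e5
    · intro w _ hw
      rw [MvPolynomial.pderiv_X_of_ne hw, zero_mul]
    · simp
  have hc' : algebraMap (PV V) (KV V) c ≠ 0 := by rwa [Ne, alg_zero]
  have hd' : algebraMap (PV V) (KV V) d ≠ 0 := by rwa [Ne, alg_zero]
  have k2 := congrArg (algebraMap (PV V) (KV V)) key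
  have hFv : ∀ a b, algebraMap (PV V) (KV V) (F a b) = algebraMap (PV V) (KV V) c * f a b := fun a b => by
    have := congrFun (congrFun hF a) b
    simpa [liftF] using this
  have hGv : ∀ a b, algebraMap (PV V) (KV V) (G a b) = algebraMap (PV V) (KV V) d * g a b := fun a b => by
    have := congrFun (congrFun hG a) b
    simpa [liftF] using this
  rw [map_sub, map_mul, map_mul, map_zero, hFv, hFv, hGv, hGv] at k2
  have : algebraMap (PV V) (KV V) c * algebraMap (PV V) (KV V) d * (f v (p v) * g v (q v) - f v (q v) * g v (p v)) = 0 := by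
    linear_combination k2
  rcases mul_eq_zero.mp this with h | h
  · exact ((mul_ne_zero hc' hd') h).elim
  · exact h

end Deriv


section Dim
variable {V : Type} [Fintype V] [DecidableEq V] {K : Type} [Field K] [CharZero K]

def edgesIn (H : SimpleGraph V) (U : Finset V) : Set (Sym2 V) := {e | e ∈ H.edgeSet ∧ ∀ x ∈ e, x ∈ U}

noncomputable def eIn (H : SimpleGraph V) (U : Finset V) : ℕ := (edgesIn H U).ncard

theorem eIn_mono {H H' : SimpleGraph V} (h : H ≤ H') (U : Finset V) : eIn H U ≤ eIn H' U := by
  apply Set.ncard_le_ncard _ (Set.toFinite _)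
  rintro e ⟨h1, h2⟩
  exact ⟨edgeSet_mono h h1, h2⟩

theorem cyc_dim {H : SimpleGraph V} (C : Finset V) (hC : ∀ u v, H.Adj u v → u ∈ C)
    (hconn : (H.induce (C : Set V)).Connected) :
    Module.finrank K (cyc K H) + C.card ≤ eIn H C + 1 := by
  classical
  obtain ⟨T, hT, hTree⟩ := hconn.exists_isTree_le
  set T' : SimpleGraph V := T.map (Function.Embedding.subtype _) with hT'
  have hle : T' ≤ H := by
    rw [hT', SimpleGraph.map_le_iff_le_comap]
    exact hT
  have hcardT : T'.edgeSet.ncard + 1 = C.card := by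
    have h1 := hTree.card_edgeFinset
    have h2 := card_edgeFinset_map (Function.Embedding.subtype (· ∈ (C : Set V))) T
    rw [← Nat.card_eq_fintype_card] at h1
    have h3 : Nat.card (C : Set V) = C.card := by simp
    rw [h3] at h1
    rw [← h1, ← h2, hT', ← coe_edgeFinset, Set.ncard_coe_finset]
  have hE : edgesIn H C = H.edgeSet := by
    ext e
    induction e with | h u v => 
    simp only [edgesIn, Set.mem_ofPred_eq, mem_edgeSet, Sym2.mem_iff, and_iff_left_iff_imp]
    rintro h x (rfl | rfl)
    · exact hC _ _ h
    · exact hC _ _ h.symm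
  let D : Set (Sym2 V) := H.edgeSet \ T'.edgeSet
  let Φ : cyc K H →ₗ[K] (D → K) :=
    { toFun := fun f e => (f : V → V → K) e.1.out.1 e.1.out.2
      map_add' := fun _ _ => rfl
      map_smul' := fun _ _ => rfl }
  have hinj : Function.Injective Φ := by
    rw [← LinearMap.ker_eq_bot, eq_bot_iff]
    rintro ⟨f, hf⟩ hk
    rw [LinearMap.mem_ker] at hk
    have hz : ∀ u v, ¬ T'.Adj u v → f u v = 0 := by
      intro u v huv
      by_cases hH : H.Adj u v
      · have h1 := congrFun hk ⟨s(u, v), hH, huv⟩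
        change f (s(u, v)).out.1 (s(u, v)).out.2 = 0 at h1
        have h2 : s((s(u, v)).out.1, (s(u, v)).out.2) = s(u, v) := Quot.out_eq (s(u, v))
        rw [Sym2.eq_iff] at h2
        rcases h2 with ⟨e1, e2⟩ | ⟨e1, e2⟩
        · rwa [e1, e2] at h1
        · rw [e1, e2] at h1
          rw [hf.1, h1, neg_zero]
      · exact hf.2.1 u v hH
    have hout : ∀ u v, v ∉ C → f u v = 0 := fun u v hv =>
      hf.2.1 u v fun h => hv (hC _ _ h.symm)
    have hmem : (fun a b : (C : Set V) => f a b) ∈ cyc K T := by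
      refine ⟨fun a b => hf.1 _ _, fun a b hab => hz _ _ fun h => hab ?_, fun a => ?_⟩
      · rw [hT', map_adj] at h
        obtain ⟨x, y, hxy, hx, hy⟩ := h
        rwa [← Subtype.ext hx, ← Subtype.ext hy]
      · rw [← hf.2.2 a, ← Finset.sum_subset (Finset.subset_univ C) (fun v _ hv => hout _ v hv)]
        exact Finset.sum_coe_sort C (fun v => f a v)
    rw [cyc_acyclic hTree.isAcyclic, Submodule.mem_bot] at hmem
    rw [Submodule.mem_bot]
    refine Subtype.ext ?_
    ext u v
    by_cases hv : v ∈ C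
    · by_cases hu : u ∈ C
      · exact congrFun (congrFun hmem ⟨u, hu⟩) ⟨v, hv⟩
      · change f u v = 0
        rw [hf.1, hout v u hu, neg_zero]
    · exact hout u v hv
  have h1 := LinearMap.finrank_le_finrank_of_injective hinj
  rw [Module.finrank_fintype_fun_eq_card, ← Nat.card_eq_fintype_card, Nat.card_coe_set_eq] at h1
  have h2 := Set.ncard_sdiff_add_ncard_of_subset (edgeSet_mono hle) (Set.toFinite _)
  unfold eIn
  rw [hE]
  change _ ≤ (H.edgeSet \ T'.edgeSet).ncard at h1
  omega

end Dim


section ClaimB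
variable {V : Type} [Fintype V] [DecidableEq V]

noncomputable def kU (H : SimpleGraph V) (U : Finset V) : ℕ := (eIn H U + 2 - U.card) / 2

theorem kU_mono {H H' : SimpleGraph V} (h : H ≤ H') (U : Finset V) : kU H U ≤ kU H' U := by
  have := eIn_mono h U
  unfold kU
  omega

theorem induce_conn_mono {H H' : SimpleGraph V} (h : H ≤ H') (U : Set V)
    (hc : (H.induce U).Connected) : (H'.induce U).Connected :=
  hc.mono fun a b hab => h hab

/-- the graph restricted to edges within `C` -/
def restr (H : SimpleGraph V) (C : Finset V) : SimpleGraph V where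
  Adj u v := H.Adj u v ∧ u ∈ C ∧ v ∈ C
  symm := ⟨fun u v h => ⟨h.1.symm, h.2.2, h.2.1⟩⟩
  loopless := ⟨fun u h => H.loopless.irrefl u h.1⟩

theorem restr_le (H : SimpleGraph V) (C : Finset V) : restr H C ≤ H := fun _ _ h => And.left h

section K
variable {K : Type} [Field K] [CharZero K]

theorem cyc_restr {H : SimpleGraph V} {C : Finset V} (hcl : ∀ a b, H.Adj a b → (a ∈ C ↔ b ∈ C))
    {f : V → V → K} (hf : f ∈ cyc K H) : (fun a b => if a ∈ C then f a b else 0) ∈ cyc K (restr H C) := by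
  refine ⟨fun a b => ?_, fun a b hab => ?_, fun a => ?_⟩
  · by_cases h : H.Adj a b
    · simp only [hcl a b h]
      split_ifs
      · exact hf.1 _ _
      · simp
    · have h1 := hf.2.1 a b h
      have h2 := hf.2.1 b a fun h' => h h'.symm
      simp [h1, h2]
  · simp only [ite_eq_right_iff]
    intro ha
    apply hf.2.1
    intro h
    exact hab ⟨h, ha, (hcl a b h).mp ha⟩
  · by_cases h : a ∈ C
    · simp [h, hf.2.2]
    · simp [h]

theorem rad_restr {p q : V → V} {t : V → K} {H : SimpleGraph V} {C : Finset V}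
    (hcl : ∀ a b, H.Adj a b → (a ∈ C ↔ b ∈ C))
    {f : V → V → K} (hf : f ∈ radW (omg p q t) (cyc K H)) :
    (fun a b => if a ∈ C then f a b else 0) ∈ radW (omg p q t) (cyc K (restr H C)) := by
  refine ⟨cyc_restr hcl hf.1, fun g hg => ?_⟩
  rw [← hf.2 g (cyc_mono (restr_le H C) hg), omg_apply, omg_apply]
  refine Finset.sum_congr rfl fun v _ => ?_
  by_cases hv : v ∈ C
  · simp [hv]
  · have : ∀ b, g v b = 0 := fun b => hg.2.1 v b fun h => hv h.2.1
    simp [this]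

theorem NN_restr_add (p q : V → V) (t : V → K) {H : SimpleGraph V} {C : Finset V}
    (hcl : ∀ a b, H.Adj a b → (a ∈ C ↔ b ∈ C)) :
    NN p q t H ≤ NN p q t (restr H C) + NN p q t (restr H Cᶜ) := by
  have hcl' : ∀ a b, H.Adj a b → (a ∈ Cᶜ ↔ b ∈ Cᶜ) := by
    intro a b h
    simp [hcl a b h]
  have hdec : ∀ f : V → V → K, f = (fun a b => if a ∈ C then f a b else 0) +
      (fun a b => if a ∈ Cᶜ then f a b else 0) := by
    intro f
    ext a b
    by_cases h : a ∈ C <;> simp [h]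
  have h1 : cyc K H ≤ cyc K (restr H C) ⊔ cyc K (restr H Cᶜ) := by
    intro f hf
    rw [hdec f]
    exact Submodule.add_mem_sup (cyc_restr hcl hf) (cyc_restr hcl' hf)
  have h2 : radW (omg p q t) (cyc K H) ≤
      radW (omg p q t) (cyc K (restr H C)) ⊔ radW (omg p q t) (cyc K (restr H Cᶜ)) := by
    intro f hf
    rw [hdec f]
    exact Submodule.add_mem_sup (rad_restr hcl hf) (rad_restr hcl' hf)
  have h3 := (Submodule.finrank_mono h1).trans (Submodule.finrank_add_le_finrank_add_finrank _ _)
  have h4 := (Submodule.finrank_mono h2).trans (Submodule.finrank_add_le_finrank_add_finrank _ _)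
  unfold NN
  omega

theorem NN_delete (p q : V → V) (t : V → K) {H : SimpleGraph V} {u v : V}
    (h0 : ∀ f ∈ radW (omg p q t) (cyc K H), f u v = 0) :
    NN p q t H ≤ NN p q t (H.deleteEdges {s(u, v)}) := by
  have h1 : Module.finrank K (cyc K H) ≤ Module.finrank K (cyc K (H.deleteEdges {s(u, v)})) + 1 := by
    by_cases h : ∃ f ∈ cyc K H, f u v ≠ 0
    · obtain ⟨f, hf, hne⟩ := h
      have := finrank_inf_ker (cyc K H)
        ((LinearMap.proj v).comp (LinearMap.proj (R := K) (φ := fun _ : V => V → K) u)) f hf hne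
      rw [← this]
      apply Nat.add_le_add_right
      apply Submodule.finrank_mono
      rintro x ⟨hx, hx'⟩
      exact cyc_deleteEdge.mpr ⟨hx, hx'⟩
    · push Not at h
      apply Nat.le_succ_of_le
      apply Submodule.finrank_mono
      exact fun x hx => cyc_deleteEdge.mpr ⟨hx, h x hx⟩
  have h2 : Module.finrank K (radW (omg p q t) (cyc K H)) ≤
      Module.finrank K (radW (omg p q t) (cyc K (H.deleteEdges {s(u, v)}))) := by
    apply Submodule.finrank_mono
    intro x hx
    exact ⟨cyc_deleteEdge.mpr ⟨hx.1, h0 x hx⟩, fun g hg => hx.2 g (cyc_deleteEdge.mp hg).1⟩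
  have e1 := NN_even p q t H
  have e2 := NN_even p q t (H.deleteEdges {s(u, v)})
  rw [Nat.even_iff] at e1 e2
  unfold NN at *
  omega

end K

theorem claimB {G : SimpleGraph V} {p q r : V → V} (s : Slots G p q r)
    (H : SimpleGraph V) : H ≤ G → ∀ A : Finset V, (∀ u v, H.Adj u v → u ∈ A) →
    ∃ 𝒰 : Finset (Finset V), (∀ U ∈ 𝒰, ∀ U' ∈ 𝒰, U ≠ U' → Disjoint U U') ∧
      𝒰.biUnion id = A ∧ (∀ U ∈ 𝒰, (H.induce (U : Set V)).Connected) ∧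
      NN p q (tv : V → KV V) H ≤ ∑ U ∈ 𝒰, 2 * kU H U := by
  classical
  induction H using WellFoundedLT.induction with
  | _ H ih =>
  intro hH A hA
  by_cases hcase : ∃ u v, H.Adj u v ∧ ∀ f ∈ radW (omg p q (tv : V → KV V)) (cyc (KV V) H), f u v = 0
  · obtain ⟨u, v, huv, h0⟩ := hcase
    have hlt := delEdge_lt huv
    obtain ⟨𝒰, h1, h2, h3, h4⟩ := ih _ hlt (hlt.le.trans hH) A fun a b hab => hA a b (hlt.le hab)
    refine ⟨𝒰, h1, h2, fun U hU => induce_conn_mono hlt.le _ (h3 U hU), ?_⟩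
    refine (NN_delete p q tv h0).trans (h4.trans ?_)
    exact Finset.sum_le_sum fun U _ => Nat.mul_le_mul_left _ (kU_mono hlt.le U)
  push Not at hcase
  by_cases hne : ∃ u v, H.Adj u v
  swap
  · push Not at hne
    refine ⟨A.image fun a => {a}, ?_, ?_, ?_, ?_⟩
    · simp only [Finset.mem_image]
      rintro _ ⟨a, ha, rfl⟩ _ ⟨b, hb, rfl⟩ hab
      rw [Finset.disjoint_singleton]
      rintro rfl
      exact hab rfl
    · ext a
      simp
    · simp only [Finset.mem_image]
      rintro _ ⟨a, ha, rfl⟩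
      have : Subsingleton (({a} : Finset V) : Set V) := by simp
      have : Nonempty (({a} : Finset V) : Set V) := ⟨⟨a, by simp⟩⟩
      exact ⟨Preconnected.of_subsingleton⟩
    · have hc : cyc (KV V) H = ⊥ := by
        rw [eq_bot_iff]
        intro f hf
        rw [Submodule.mem_bot]
        ext u v
        exact hf.2.1 u v (hne u v)
      have hr : radW (omg p q (tv : V → KV V)) (cyc (KV V) H) = ⊥ := by
        rw [eq_bot_iff, ← hc]
        exact fun x hx => hx.1
      unfold NN
      rw [hr, hc]
      simp
  obtain ⟨u, v, huv⟩ := hne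
  let C : Finset V := Finset.univ.filter fun w => H.Reachable u w
  have hmemC : ∀ w, w ∈ C ↔ H.Reachable u w := fun w => by simp [C]
  have hcl : ∀ a b, H.Adj a b → (a ∈ C ↔ b ∈ C) := by
    intro a b hab
    rw [hmemC, hmemC]
    exact ⟨fun h => h.trans hab.reachable, fun h => h.trans hab.symm.reachable⟩
  have huC : u ∈ C := (hmemC u).mpr (Reachable.refl u)
  have hCA : C ⊆ A := by
    intro w hw
    rw [hmemC, reachable_iff_reflTransGen] at hw
    rcases Relation.ReflTransGen.cases_tail hw with h | ⟨x, _, hx⟩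
    · subst h
      exact hA _ _ huv
    · exact hA _ _ hx.symm
  -- the rest
  have hlt : restr H Cᶜ < H := by
    refine lt_of_le_of_ne (restr_le H Cᶜ) fun he => ?_
    rw [← he] at huv
    have := huv.2.1
    simp only [Finset.mem_compl] at this
    exact this huC
  obtain ⟨𝒰, h1, h2, h3, h4⟩ := ih _ hlt (hlt.le.trans hH) (A \ C) fun a b hab => by
    rw [Finset.mem_sdiff]
    exact ⟨hA a b hab.1, by simpa using hab.2.1⟩
  have hconn : ((restr H C).induce (C : Set V)).Connected := by
    rw [connected_iff_exists_forall_reachable]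
    refine ⟨⟨u, huC⟩, ?_⟩
    rintro ⟨w, hw⟩
    have hw' := (hmemC w).mp hw
    rw [reachable_iff_reflTransGen] at hw'
    induction hw' with
    | refl => exact Reachable.refl _
    | @tail b c hb hbc ihb =>
      have hbC : b ∈ C := (hcl b c hbc).mpr hw
      refine (ihb hbC).trans (Adj.reachable ?_)
      exact ⟨hbc, hbC, hw⟩
  have hrad : ∀ a b, (restr H C).Adj a b →
      ∃ f ∈ radW (omg p q (tv : V → KV V)) (cyc (KV V) (restr H C)), f a b ≠ 0 := by
    rintro a b ⟨hab, ha, hb⟩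
    obtain ⟨f, hf, hne⟩ := hcase a b hab
    exact ⟨_, rad_restr hcl hf, by simpa [ha] using hne⟩
  have hprop : ∀ g ∈ radW (omg p q (tv : V → KV V)) (cyc (KV V) (restr H C)), g u v = 0 → g = 0 := by
    intro g hg h0
    have step : ∀ w a b, (restr H C).Adj w a → g w a = 0 → g w b = 0 := by
      intro w a b hwa hz
      obtain ⟨f, hf, hne⟩ := hrad w a hwa
      have hm := s.minor (cyc_mono ((restr_le H C).trans hH) hf.1)
        (cyc_mono ((restr_le H C).trans hH) hg.1) w (der_fact p q _ hf hg w) a b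
      rw [hz, mul_zero] at hm
      exact (mul_eq_zero.mp hm).resolve_left hne
    have hall : ∀ w, H.Reachable u w → ∀ b, g w b = 0 := by
      intro w hw
      have hw' := hw
      rw [reachable_iff_reflTransGen] at hw'
      induction hw' with
      | refl =>
        intro b
        exact step u v b ⟨huv, huC, (hcl u v huv).mp huC⟩ h0
      | @tail x y hx hxy ihx =>
        intro b
        have hyC := (hmemC y).mpr hw
        have hxC := (hcl x y hxy).mpr hyC
        refine step y x b ⟨hxy.symm, hyC, hxC⟩ ?_
        rw [hg.1.1, ihx ((hmemC x).mp hxC), neg_zero]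
    ext a b
    by_cases ha : a ∈ C
    · exact hall a ((hmemC a).mp ha) b
    · exact hg.1.2.1 a b fun h => ha h.2.1
  have hdim : Module.finrank (KV V) (radW (omg p q (tv : V → KV V)) (cyc (KV V) (restr H C))) ≤ 1 := by
    obtain ⟨f, hf, hne⟩ := hrad u v ⟨huv, huC, (hcl u v huv).mp huC⟩
    refine finrank_le_one ⟨f, hf⟩ ?_
    rintro ⟨g, hg⟩
    refine ⟨g u v / f u v, ?_⟩
    have := hprop (g - (g u v / f u v) • f) (Submodule.sub_mem _ hg (Submodule.smul_mem _ _ hf))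
      (by simp [hne])
    rw [sub_eq_zero] at this
    exact Subtype.ext this.symm
  have hcd := cyc_dim (K := KV V) C (fun a b (h : (restr H C).Adj a b) => h.2.1) hconn
  have hev := NN_even p q (tv : V → KV V) (restr H C)
  have hmono := eIn_mono (restr_le H C) C
  have hsum := NN_restr_add p q (tv : V → KV V) hcl
  have hkC : NN p q (tv : V → KV V) (restr H C) ≤ 2 * kU H C := by
    rw [Nat.even_iff] at hev
    unfold kU NN at *
    omega
  have hdisj : ∀ U ∈ 𝒰, Disjoint C U := by
    intro U hU
    have : U ⊆ A \ C := by
      rw [← h2]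
      exact Finset.subset_biUnion_of_mem id hU
    exact Finset.disjoint_sdiff.mono_right this
  have hCnot : C ∉ 𝒰 := by
    intro hC
    have := hdisj C hC
    rw [disjoint_self] at this
    rw [this] at huC
    simp at huC
  refine ⟨insert C 𝒰, ?_, ?_, ?_, ?_⟩
  · intro U hU U' hU' hUU
    rw [Finset.mem_insert] at hU hU'
    rcases hU with rfl | hU <;> rcases hU' with rfl | hU'
    · exact (hUU rfl).elim
    · exact hdisj _ hU'
    · exact (hdisj _ hU).symm
    · exact h1 U hU U' hU' hUU
  · rw [Finset.biUnion_insert, h2]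
    simp only [id]
    exact Finset.union_sdiff_of_subset hCA
  · intro U hU
    rw [Finset.mem_insert] at hU
    rcases hU with rfl | hU
    · exact induce_conn_mono (restr_le H _) _ hconn
    · exact induce_conn_mono (restr_le H _) _ (h3 U hU)
  · rw [Finset.sum_insert hCnot]
    have : ∑ U ∈ 𝒰, 2 * kU (restr H Cᶜ) U ≤ ∑ U ∈ 𝒰, 2 * kU H U :=
      Finset.sum_le_sum fun U _ => Nat.mul_le_mul_left _ (kU_mono (restr_le H _) U)
    omega

/-- the min-max bound -/
theorem partII (G : SimpleGraph V) (hV : 3 ≤ Fintype.card V) (hsub : ∀ v : V, (G.neighborSet v).ncard ≤ 3) :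
    ∃ 𝒰 : Finset (Finset V), (∀ U ∈ 𝒰, ∀ U' ∈ 𝒰, U ≠ U' → Disjoint U U') ∧
      𝒰.biUnion id = Finset.univ ∧ (∀ U ∈ 𝒰, (G.induce (U : Set V)).Connected) ∧
      phi G ≤ ∑ U ∈ 𝒰, kU G U := by
  classical
  have hs : ∀ v, ∃ p q r : V, p ≠ q ∧ p ≠ r ∧ q ≠ r ∧ ∀ w, G.Adj v w → w = p ∨ w = q ∨ w = r := by
    intro v
    have h1 : (G.neighborFinset v).card ≤ 3 := by
      have := hsub v
      rwa [Set.ncard_eq_toFinset_card'] at this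
    obtain ⟨T, hT, hc⟩ := Finset.exists_superset_card_eq h1 hV
    rw [Finset.card_eq_three] at hc
    obtain ⟨p, q, r, h1, h2, h3, rfl⟩ := hc
    refine ⟨p, q, r, h1, h2, h3, fun w hw => ?_⟩
    have := hT ((G.mem_neighborFinset v w).mpr hw)
    simpa using this
  choose p q r h1 h2 h3 h4 using hs
  have s : Slots G p q r := ⟨h1, h2, h3, h4⟩
  obtain ⟨S, hS, hac⟩ := lemmaA s (tv : V → KV V) G le_rfl
  obtain ⟨𝒰, k1, k2, k3, k4⟩ := claimB s G le_rfl Finset.univ (fun _ _ _ => Finset.mem_univ _)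
  refine ⟨𝒰, k1, k2, k3, ?_⟩
  have := phi_le hac
  rw [← Finset.mul_sum] at k4
  omega

end ClaimB


/-- no triangles, no four-cycles -/
structure Nice {W : Type} (H : SimpleGraph W) : Prop where
  tri : ∀ a b c, H.Adj a b → H.Adj b c → H.Adj a c → False
  sq : ∀ a c b d, a ≠ c → H.Adj a b → H.Adj b c → H.Adj a d → H.Adj d c → b = d

theorem nice_of_girth {W : Type} {H : SimpleGraph W} (h : 5 ≤ H.egirth) : Nice H := by
  constructor
  · intro a b c hab hbc hac
    have hcy : (Walk.cons hab (Walk.cons hbc (Walk.cons hac.symm Walk.nil))).IsCycle := by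
      have h1 := H.ne_of_adj hab
      have h2 := H.ne_of_adj hbc
      have h3 := H.ne_of_adj hac
      rw [Walk.cons_isCycle_iff]
      simp [Walk.cons_isPath_iff, h1, h2, h3, h1.symm, h2.symm, h3.symm]
    have := h.trans (egirth_le_length hcy)
    simp at this
    exact absurd this (by decide)
  · intro a c b d hac hab hbc had hdc
    by_contra hbd
    have hcy : (Walk.cons hab (Walk.cons hbc (Walk.cons hdc.symm (Walk.cons had.symm Walk.nil)))).IsCycle := by
      have h1 := H.ne_of_adj hab
      have h2 := H.ne_of_adj hbc
      have h3 := H.ne_of_adj had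
      have h4 := H.ne_of_adj hdc
      rw [Walk.cons_isCycle_iff]
      simp [Walk.cons_isPath_iff, h1, h2, h3, h4, h1.symm, h2.symm, h3.symm, h4.symm, hac, hac.symm, hbd, Ne.symm hbd]
    have := h.trans (egirth_le_length hcy)
    simp at this
    exact absurd this (by decide)

section Moore
variable {W : Type} [Fintype W] [DecidableEq W] {H : SimpleGraph W} [DecidableRel H.Adj]

theorem moore_ball (hN : Nice H) (u : W) : ∑ v ∈ H.neighborFinset u, H.degree v + 1 ≤ Fintype.card W := by
  have hdisj : ∀ v ∈ H.neighborFinset u, ∀ v' ∈ H.neighborFinset u, v ≠ v' →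
      Disjoint (insert v ((H.neighborFinset v).erase u)) (insert v' ((H.neighborFinset v').erase u)) := by
    intro v hv v' hv' hne
    rw [mem_neighborFinset] at hv hv'
    rw [Finset.disjoint_left]
    intro x hx hx'
    simp only [Finset.mem_insert, Finset.mem_erase, mem_neighborFinset] at hx hx'
    rcases hx with rfl | ⟨hxu, hx⟩
    · rcases hx' with rfl | ⟨_, hx'⟩
      · exact hne rfl
      · exact hN.tri u x v' hv hx'.symm hv'
    · rcases hx' with rfl | ⟨_, hx'⟩
      · exact hN.tri u v x hv hx hv'
      · exact hne (hN.sq u x v v' (Ne.symm hxu) hv hx hv' hx')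
  have hcard : ∀ v ∈ H.neighborFinset u, (insert v ((H.neighborFinset v).erase u)).card = H.degree v := by
    intro v hv
    rw [mem_neighborFinset] at hv
    rw [Finset.card_insert_of_notMem (by simp), Finset.card_erase_of_mem (by simpa using hv.symm),
      card_neighborFinset_eq_degree]
    have : 0 < H.degree v := by
      rw [degree_pos_iff_exists_adj]
      exact ⟨u, hv.symm⟩
    omega
  rw [← Finset.sum_congr rfl hcard, ← Finset.card_biUnion hdisj]
  have hu : u ∉ (H.neighborFinset u).biUnion fun v => insert v ((H.neighborFinset v).erase u) := by
    simp only [Finset.mem_biUnion, Finset.mem_insert, Finset.mem_erase, not_exists, not_and, mem_neighborFinset]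
    rintro v hv (h | h)
    · exact H.ne_of_adj hv h
    · exact h.1 rfl
  rw [← Finset.card_insert_of_notMem hu]
  exact Finset.card_le_univ _

theorem sum_nbr_deg : ∑ u, ∑ v ∈ H.neighborFinset u, H.degree v = ∑ v, H.degree v ^ 2 := by
  have h1 : ∀ u, ∑ v ∈ H.neighborFinset u, H.degree v = ∑ v, if H.Adj u v then H.degree v else 0 := by
    intro u
    rw [← Finset.sum_filter]
    congr 1
    ext v
    simp
  simp only [h1]
  rw [Finset.sum_comm]
  refine Finset.sum_congr rfl fun v _ => ?_
  rw [← Finset.sum_filter, Finset.sum_const, smul_eq_mul, sq]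
  congr 1
  rw [← card_neighborFinset_eq_degree]
  congr 1
  ext x
  simp [H.adj_comm]

theorem moore_cauchy (hN : Nice H) :
    (∑ v, H.degree v) ^ 2 + Fintype.card W ^ 2 ≤ Fintype.card W ^ 3 := by
  have h1 : ∑ v, H.degree v ^ 2 + Fintype.card W ≤ Fintype.card W * Fintype.card W := by
    rw [← sum_nbr_deg]
    have := Finset.sum_le_sum fun u (_ : u ∈ Finset.univ) => moore_ball hN u
    rw [Finset.sum_add_distrib] at this
    simpa using this
  have h2 : (∑ v, H.degree v) ^ 2 ≤ Fintype.card W * ∑ v, H.degree v ^ 2 := sq_sum_le_card_mul_sum_sq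
  nlinarith

end Moore

theorem arith_star (n m : ℕ) (hn : 1 ≤ n) (h1 : n ≤ m + 1) (h2 : 2 * m ≤ 3 * n) (h3 : (2 * m) ^ 2 + n ^ 2 ≤ n ^ 3) :
    7 * ((m + 2 - n) / 2) + n ≤ 2 * m + 2 ∨ (n = 10 ∧ m = 14) ∨ (n = 12 ∧ m = 18) ∨ (n = 13 ∧ m = 19) ∨
      (n = 16 ∧ m = 24) := by
  by_cases hbig : 17 ≤ n
  · left; omega
  · have key : ∀ n : Fin 17, ∀ m : Fin 26, (1 ≤ n.1 ∧ n.1 ≤ m.1 + 1 ∧ 2 * m.1 ≤ 3 * n.1 ∧ (2 * m.1) ^ 2 + n.1 ^ 2 ≤ n.1 ^ 3) →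
      (7 * ((m.1 + 2 - n.1) / 2) + n.1 ≤ 2 * m.1 + 2 ∨ (n.1 = 10 ∧ m.1 = 14) ∨ (n.1 = 12 ∧ m.1 = 18) ∨
      (n.1 = 13 ∧ m.1 = 19) ∨ (n.1 = 16 ∧ m.1 = 24)) := by decide
    exact key ⟨n, by omega⟩ ⟨m, by omega⟩ ⟨hn, h1, h2, h3⟩

section Count
variable {V : Type} [Fintype V] [DecidableEq V]

theorem count_parts (G : SimpleGraph V) (hG : G.Connected) (𝒰 : Finset (Finset V))
    (h1 : ∀ U ∈ 𝒰, ∀ U' ∈ 𝒰, U ≠ U' → Disjoint U U') (h2 : 𝒰.biUnion id = Finset.univ)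
    (h3 : ∀ U ∈ 𝒰, U.Nonempty) : ∑ U ∈ 𝒰, eIn G U + 𝒰.card ≤ G.edgeSet.ncard + 1 := by
  classical
  have hex : ∀ v : V, ∃ U : 𝒰, v ∈ U.1 := by
    intro v
    have : v ∈ 𝒰.biUnion id := by rw [h2]; simp
    rw [Finset.mem_biUnion] at this
    obtain ⟨U, hU, hv⟩ := this
    exact ⟨⟨U, hU⟩, hv⟩
  choose c hc using hex
  have huniq : ∀ v (U : 𝒰), v ∈ U.1 → c v = U := by
    intro v U hv
    by_contra hne
    have := h1 (c v).1 (c v).2 U.1 U.2 (fun h => hne (Subtype.ext h))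
    exact Finset.disjoint_left.mp this (hc v) hv
  let Q : SimpleGraph 𝒰 := SimpleGraph.fromRel fun U U' => ∃ a b, G.Adj a b ∧ c a = U ∧ c b = U'
  have hstep : ∀ a b, G.Adj a b → Q.Reachable (c a) (c b) := by
    intro a b hab
    by_cases h : c a = c b
    · rw [h]
    · exact Adj.reachable ⟨h, Or.inl ⟨a, b, hab, rfl, rfl⟩⟩
  have hQ : Q.Connected := by
    obtain ⟨v0⟩ := hG.nonempty
    rw [connected_iff_exists_forall_reachable]
    refine ⟨c v0, fun U => ?_⟩
    obtain ⟨w, hw⟩ := h3 U.1 U.2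
    rw [← huniq w U hw]
    clear hw
    have := hG.preconnected v0 w
    rw [reachable_iff_reflTransGen] at this
    induction this with
    | refl => exact Reachable.refl _
    | @tail b d hb hbd ih =>
      exact ih.trans (hstep b d hbd)
  have hQc := hQ.card_vert_le_card_edgeSet_add_one
  have hcard : Nat.card 𝒰 = 𝒰.card := by simp
  rw [hcard] at hQc
  set I : Finset (Sym2 V) := 𝒰.biUnion fun U => (edgesIn G U).toFinset with hI
  have hIcard : I.card = ∑ U ∈ 𝒰, eIn G U := by
    rw [hI, Finset.card_biUnion]
    · refine Finset.sum_congr rfl fun U _ => ?_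
      rw [eIn, Set.ncard_eq_toFinset_card']
    · intro U hU U' hU' hne
      change Disjoint _ _
      rw [Finset.disjoint_left]
      intro e he he'
      rw [Set.mem_toFinset] at he he'
      induction e with | h a b =>
      exact Finset.disjoint_left.mp (h1 U hU U' hU' hne) (he.2 a (by simp)) (he'.2 a (by simp))
  have hIsub : I ⊆ G.edgeFinset := by
    intro e he
    rw [hI, Finset.mem_biUnion] at he
    obtain ⟨U, hU, he⟩ := he
    rw [Set.mem_toFinset] at he
    simpa using he.1
  have hQle : Nat.card Q.edgeSet ≤ (G.edgeFinset \ I).card := by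
    rw [Nat.card_coe_set_eq, Set.ncard_eq_toFinset_card']
    have hsub : Q.edgeSet.toFinset ⊆ (G.edgeFinset \ I).image (Sym2.map c) := by
      intro e he
      rw [Set.mem_toFinset] at he
      induction e with | h U U' =>
      rw [mem_edgeSet] at he
      obtain ⟨hne, h⟩ := he
      have hx : ∀ a b, G.Adj a b → c a ≠ c b → s(a, b) ∈ G.edgeFinset \ I := by
        intro a b hab hne
        rw [Finset.mem_sdiff]
        refine ⟨by simpa using hab, fun hmem => ?_⟩
        rw [hI, Finset.mem_biUnion] at hmem
        obtain ⟨U, hU, he⟩ := hmem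
        rw [Set.mem_toFinset] at he
        apply hne
        rw [huniq a ⟨U, hU⟩ (he.2 a (by simp)), huniq b ⟨U, hU⟩ (he.2 b (by simp))]
      rw [Finset.mem_image]
      rcases h with ⟨a, b, hab, ha, hb⟩ | ⟨a, b, hab, ha, hb⟩
      · exact ⟨s(a, b), hx a b hab (by rw [ha, hb]; exact hne), by simp [ha, hb]⟩
      · exact ⟨s(a, b), hx a b hab (by rw [ha, hb]; exact hne.symm), by simp [ha, hb, Sym2.eq_swap]⟩
    exact (Finset.card_le_card hsub).trans Finset.card_image_le
  have h5 := Finset.card_sdiff_add_card_eq_card hIsub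
  have h6 : G.edgeSet.ncard = G.edgeFinset.card := by
    rw [← coe_edgeFinset, Set.ncard_coe_finset]
  omega

theorem eIn_eq (G : SimpleGraph V) (U : Finset V) : eIn G U = (G.induce (U : Set V)).edgeSet.ncard := by
  unfold eIn
  have : edgesIn G U = Set.image (Sym2.map Subtype.val) (G.induce (U : Set V)).edgeSet := by
    ext e
    induction e with | h a b =>
    constructor
    · rintro ⟨h, hU⟩
      exact ⟨s(⟨a, hU a (by simp)⟩, ⟨b, hU b (by simp)⟩), h, by simp⟩
    · rintro ⟨e', he', heq⟩
      induction e' with | h x y =>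
      rw [Sym2.map_mk] at heq
      rw [← heq]
      refine ⟨he', ?_⟩
      intro z hz
      rw [Sym2.mem_iff] at hz
      rcases hz with rfl | rfl
      · exact x.2
      · exact y.2
  rw [this, Set.ncard_image_of_injective]
  exact Sym2.map.injective Subtype.val_injective

end Count


def Lstmt (n m i j : ℕ) : Prop := ∀ (W : Type) [Fintype W] [DecidableEq W] (H : SimpleGraph W)
  [DecidableRel H.Adj], Nice H → (∀ v, H.degree v ≤ 3) → Fintype.card W = n → ∑ v, H.degree v = 2 * m → IsInF i j H

theorem main_of (L10 : Lstmt 10 14 4 2) (L12 : Lstmt 12 18 3 3) (L13 : Lstmt 13 19 4 3) (L16 : Lstmt 16 24 4 4)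
    {V : Type} [Fintype V] (G : SimpleGraph V) (hconn : G.Connected)
    (hsub : ∀ v : V, (G.neighborSet v).ncard ≤ 3)
    (hgirth : 5 ≤ G.girth)
    (hF : ∀ (W : Type) (H : SimpleGraph W), InFamilyF H → ¬ ContainsInducedSubdivision G H)
    (hiso : ¬ ∃ (W : Type) (H : SimpleGraph W),
      (IsInF 3 3 H ∨ IsInF 4 4 H) ∧ Nonempty (G ≃g H)) :
    (phi G : ℝ) ≤ (2 * (G.edgeSet.ncard : ℝ) - (Nat.card V : ℝ) + 2) / 7 := by
  classical
  have hcyc : ¬ G.IsAcyclic := by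
    intro h
    rw [girth_eq_zero.mpr h] at hgirth
    omega
  have heg : 5 ≤ G.egirth := by
    have hne : G.egirth ≠ ⊤ := fun h => hcyc (egirth_eq_top.mp h)
    unfold girth at hgirth
    rw [← ENat.coe_toNat hne]
    exact_mod_cast hgirth
  have hV : 3 ≤ Fintype.card V := by
    unfold IsAcyclic at hcyc
    push Not at hcyc
    obtain ⟨v, w, hw⟩ := hcyc
    have h1 := hw.three_le_length
    have h2 : w.support.tail.length ≤ Fintype.card V := hw.support_nodup.length_le_card
    rw [List.length_tail, Walk.length_support] at h2
    omega
  obtain ⟨𝒰, h1, h2, h3, h4⟩ := partII G hV hsub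
  have hne : ∀ U ∈ 𝒰, U.Nonempty := by
    intro U hU
    obtain ⟨x⟩ := (h3 U hU).nonempty
    exact ⟨x.1, x.2⟩
  have hcount := count_parts G hconn 𝒰 h1 h2 hne
  have hcardV : ∑ U ∈ 𝒰, U.card = Fintype.card V := by
    rw [← Finset.card_univ, ← h2, Finset.card_biUnion]
    · rfl
    · exact fun U hU U' hU' h => h1 U hU U' hU' h
  have hdegG : ∀ v, G.degree v ≤ 3 := by
    intro v
    have := hsub v
    rwa [Set.ncard_eq_toFinset_card'] at this
  have hstar : ∀ U ∈ 𝒰, 7 * kU G U + U.card ≤ 2 * eIn G U + 2 := by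
    intro U hU
    have hc := h3 U hU
    set H := G.induce (U : Set V) with hH
    have hegH : 5 ≤ H.egirth := by
      rw [le_egirth]
      intro a w hw
      have hcm := hw.map (f := (Embedding.induce (U : Set V)).toHom) Subtype.val_injective
      have := heg.trans (egirth_le_length hcm)
      rwa [Walk.length_map] at this
    have hN := nice_of_girth hegH
    have hcardU : Fintype.card (U : Set V) = U.card := by simp
    have hemb : ∀ v : (U : Set V), (H.neighborFinset v).map (Function.Embedding.subtype _) ⊆ G.neighborFinset v := by
      intro v x hx
      rw [Finset.mem_map] at hx
      obtain ⟨y, hy, rfl⟩ := hx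
      rw [mem_neighborFinset] at hy ⊢
      exact hy
    have hdeg : ∀ v, H.degree v ≤ 3 := by
      intro v
      have := Finset.card_le_card (hemb v)
      rw [Finset.card_map, card_neighborFinset_eq_degree, card_neighborFinset_eq_degree] at this
      exact this.trans (hdegG v)
    have hE : eIn G U = H.edgeSet.ncard := eIn_eq G U
    have hE2 : H.edgeSet.ncard = H.edgeFinset.card := by
      rw [← coe_edgeFinset, Set.ncard_coe_finset]
    have hsum : ∑ v, H.degree v = 2 * eIn G U := by
      rw [hE, hE2, sum_degrees_eq_twice_card_edges]
    have hmc := moore_cauchy hN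
    rw [hsum, hcardU] at hmc
    have hb : 2 * eIn G U ≤ 3 * U.card := by
      rw [← hsum, ← hcardU, mul_comm]
      have := Finset.sum_le_card_nsmul Finset.univ (fun v => H.degree v) 3 (fun v _ => hdeg v)
      simpa using this
    have hlow : U.card ≤ eIn G U + 1 := by
      have := hc.card_vert_le_card_edgeSet_add_one
      rw [Nat.card_coe_set_eq, Nat.card_coe_set_eq, ← hE] at this
      simpa using this
    -- the exceptional cases
    have hgH : U.card ≤ eIn G U → 5 ≤ H.girth := by
      intro hle
      have hnac : ¬ H.IsAcyclic := by
        intro hac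
        have := (IsTree.mk hc hac).card_edgeFinset
        rw [hcardU] at this
        omega
      have hne : H.egirth ≠ ⊤ := fun h => hnac (egirth_eq_top.mp h)
      unfold girth
      rw [← ENat.coe_toNat hne] at hegH
      exact_mod_cast hegH
    have hcontF : InFamilyF H → False := fun h =>
      hF _ H h ⟨(U : Set V), _, H, IsSubdivisionOf.refl H, ⟨Iso.refl⟩⟩
    have hfull : 2 * eIn G U = 3 * U.card → Nonempty (G ≃g H) := by
      intro heq
      have hall : ∀ v, H.degree v = 3 := by
        intro v
        by_contra hlt
        have : ∑ v, H.degree v < ∑ v : (U : Set V), 3 :=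
          Finset.sum_lt_sum (fun i _ => hdeg i) ⟨v, Finset.mem_univ _, lt_of_le_of_ne (hdeg v) hlt⟩
        rw [hsum, Finset.sum_const, Finset.card_univ, hcardU, smul_eq_mul] at this
        omega
      have hclosed : ∀ a b, G.Adj a b → a ∈ U → b ∈ U := by
        intro a b hab ha
        have hsub := Finset.eq_of_subset_of_card_le (hemb ⟨a, ha⟩) (by
          rw [Finset.card_map, card_neighborFinset_eq_degree, card_neighborFinset_eq_degree, hall]
          exact hdegG a)
        have hb : b ∈ G.neighborFinset a := by simpa using hab
        rw [← hsub, Finset.mem_map] at hb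
        obtain ⟨y, _, rfl⟩ := hb
        exact y.2
      obtain ⟨u0, hu0⟩ := hne U hU
      have hallU : ∀ w, w ∈ U := by
        intro w
        have := hconn.preconnected u0 w
        rw [reachable_iff_reflTransGen] at this
        induction this with
        | refl => exact hu0
        | tail _ hbd ih => exact hclosed _ _ hbd ih
      refine ⟨⟨⟨fun v => ⟨v, hallU v⟩, fun v => v.1, fun v => rfl, fun v => rfl⟩, ?_⟩⟩
      intro a b
      rfl
    rcases arith_star U.card (eIn G U) (Finset.card_pos.mpr (hne U hU)) hlow hb hmc with h | ⟨hn, hm⟩ | ⟨hn, hm⟩ | ⟨hn, hm⟩ | ⟨hn, hm⟩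
    · unfold kU
      omega
    · exact (hcontF (Or.inl ⟨Or.inl (L10 _ H hN hdeg (by omega) (by omega)), hgH (by omega)⟩)).elim
    · exact (hiso ⟨_, H, Or.inl (L12 _ H hN hdeg (by omega) (by omega)), hfull (by omega)⟩).elim
    · exact (hcontF (Or.inl ⟨Or.inr (L13 _ H hN hdeg (by omega) (by omega)), hgH (by omega)⟩)).elim
    · exact (hiso ⟨_, H, Or.inr (L16 _ H hN hdeg (by omega) (by omega)), hfull (by omega)⟩).elim
  have hsum := Finset.sum_le_sum hstar
  rw [Finset.sum_add_distrib, Finset.sum_add_distrib, ← Finset.mul_sum, ← Finset.mul_sum, hcardV,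
    Finset.sum_const, smul_eq_mul] at hsum
  have hfin : 7 * phi G + Nat.card V ≤ 2 * G.edgeSet.ncard + 2 := by
    rw [Nat.card_eq_fintype_card]
    omega
  have hR : 7 * (phi G : ℝ) + (Nat.card V : ℝ) ≤ 2 * (G.edgeSet.ncard : ℝ) + 2 := by exact_mod_cast hfin
  linarith


theorem rev_sub {V W : Type} {G : SimpleGraph V} {H : SimpleGraph W} {i j : ℕ} (ι : W → V)
    (hι : Function.Injective ι) (x : V) (hr : ∀ v, v ≠ x ↔ ∃ a, ι a = v) (p q : W) (hpq : H.Adj p q)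
    (hG : ∀ a b, G.Adj (ι a) (ι b) ↔ H.Adj a b ∧ s(a, b) ≠ s(p, q))
    (hx : ∀ a, G.Adj x (ι a) ↔ a = p ∨ a = q) (hH : IsInF i j H) : IsInF (i + 1) j G := by
  refine IsInF.iso ?_ (IsInF.subdiv hpq hH)
  let f : Option W → V := fun o => o.elim x ι
  have hxι : ∀ a, ι a ≠ x := fun a => (hr _).mpr ⟨a, rfl⟩
  have hf : Function.Bijective f := by
    constructor
    · rintro (_ | a) (_ | b) h
      · rfl
      · exact (hxι b h.symm).elim
      · exact (hxι a h).elim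
      · exact congrArg some (hι h)
    · intro v
      by_cases hv : v = x
      · exact ⟨none, hv.symm⟩
      · obtain ⟨a, ha⟩ := (hr v).mp hv
        exact ⟨some a, ha⟩
  refine ⟨(RelIso.symm ⟨Equiv.ofBijective f hf, ?_⟩)⟩
  intro a b
  rw [Equiv.ofBijective_apply, Equiv.ofBijective_apply]
  rcases a with _ | a <;> rcases b with _ | b
  · simp
  · simp [subdivideEdge, f, hx]
  · rw [G.adj_comm]
    simp [subdivideEdge, f, hx]
  · simp only [subdivideEdge, f, fromRel_adj, Option.elim, hG]
    have := H.ne_of_adj (a := a) (b := b)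
    constructor
    · rintro ⟨h1, h2⟩
      refine ⟨by simpa using this h1, Or.inl (Or.inl ⟨a, b, rfl, rfl, h1, h2⟩)⟩
    · rintro ⟨-, (⟨p', q', h1, h2, h3, h4⟩ | h) | (⟨p', q', h1, h2, h3, h4⟩ | h)⟩
      · cases h1; cases h2; exact ⟨h3, h4⟩
      · simp at h
      · cases h1; cases h2; exact ⟨h3.symm, by rwa [Sym2.eq_swap]⟩
      · simp at h

theorem rev_op {V W : Type} {G : SimpleGraph V} {H : SimpleGraph W} {i j : ℕ} (ι : W → V)
    (hι : Function.Injective ι) (w x y : V) (hwx : w ≠ x) (hwy : w ≠ y) (hxy : x ≠ y)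
    (hr : ∀ v, (v ≠ x ∧ v ≠ y ∧ v ≠ w) ↔ ∃ a, ι a = v) (u₁ v₁ u₂ v₂ a : W)
    (h1 : H.Adj u₁ v₁) (h2 : H.Adj u₂ v₂) (h12 : s(u₁, v₁) ≠ s(u₂, v₂)) (ha : HasDegreeTwo H a)
    (hG : ∀ a b, G.Adj (ι a) (ι b) ↔ H.Adj a b ∧ s(a, b) ≠ s(u₁, v₁) ∧ s(a, b) ≠ s(u₂, v₂))
    (hx : ∀ b, G.Adj x (ι b) ↔ b = u₁ ∨ b = v₁) (hy : ∀ b, G.Adj y (ι b) ↔ b = u₂ ∨ b = v₂)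
    (hw : ∀ b, G.Adj w (ι b) ↔ b = a) (hwx' : G.Adj w x) (hwy' : G.Adj w y) (hxy' : ¬ G.Adj x y)
    (hH : IsInF i j H) : IsInF i (j + 1) G := by
  refine IsInF.iso ?_ (IsInF.op ha (Or.inl ⟨u₁, v₁, u₂, v₂, h1, h2, h12, rfl⟩) hH)
  let f : W ⊕ Fin 3 → V := Sum.elim ι ![x, y, w]
  have hxι : ∀ a, ι a ≠ x := fun a => ((hr _).mpr ⟨a, rfl⟩).1
  have hyι : ∀ a, ι a ≠ y := fun a => ((hr _).mpr ⟨a, rfl⟩).2.1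
  have hwι : ∀ a, ι a ≠ w := fun a => ((hr _).mpr ⟨a, rfl⟩).2.2
  have hf : Function.Bijective f := by
    constructor
    · refine Function.Injective.sumElim hι ?_ ?_
      · intro a b
        fin_cases a <;> fin_cases b <;> simp [hwx, hwy, hxy, hwx.symm, hwy.symm, hxy.symm]
      · intro a b
        fin_cases b <;> simp [hxι, hyι, hwι]
    · intro v
      by_cases hvx : v = x
      · exact ⟨Sum.inr 0, hvx.symm⟩
      by_cases hvy : v = y
      · exact ⟨Sum.inr 1, hvy.symm⟩
      by_cases hvw : v = w
      · exact ⟨Sum.inr 2, hvw.symm⟩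
      obtain ⟨a, ha⟩ := (hr v).mp ⟨hvx, hvy, hvw⟩
      exact ⟨Sum.inl a, ha⟩
  refine ⟨(RelIso.symm ⟨Equiv.ofBijective f hf, ?_⟩)⟩
  intro a b
  rw [Equiv.ofBijective_apply, Equiv.ofBijective_apply]
  rcases a with a | a <;> rcases b with b | b
  · simp only [circOpTwo, f, fromRel_adj, Sum.elim_inl, hG]
    have := H.ne_of_adj (a := a) (b := b)
    constructor
    · rintro ⟨h1, h2⟩
      refine ⟨by simpa using this h1, Or.inl (Or.inl ⟨a, b, rfl, rfl, h1, h2⟩)⟩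
    · rintro ⟨-, (⟨p', q', h1, h2, h3, h4⟩ | h) | (⟨p', q', h1, h2, h3, h4⟩ | h)⟩
      · cases h1; cases h2; exact ⟨h3, h4⟩
      · simp at h
      · cases h1; cases h2; exact ⟨h3.symm, by rwa [Sym2.eq_swap]⟩
      · simp at h
  · rw [G.adj_comm]
    fin_cases b <;> simp [circOpTwo, f, hx, hy, hw]
  · fin_cases a <;> simp [circOpTwo, f, hx, hy, hw]
  · have hxy'' : ¬ G.Adj y x := fun h => hxy' h.symm
    fin_cases a <;> fin_cases b <;> simp [circOpTwo, f, hwx', hwy', hwx'.symm, hwy'.symm, hxy', hxy'']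

/-- suppression of the vertices of `D` -/
def sp {V : Type} (G : SimpleGraph V) (D : Set V) : SimpleGraph V where
  Adj u v := u ≠ v ∧ (G.Adj u v ∨ ∃ d ∈ D, G.Adj u d ∧ G.Adj d v)
  symm := ⟨fun u v h => ⟨h.1.symm, h.2.imp (fun h => h.symm) fun ⟨d, hd, h1, h2⟩ => ⟨d, hd, h2.symm, h1.symm⟩⟩⟩
  loopless := ⟨fun u h => h.1 rfl⟩

theorem sp_adj {V : Type} {G : SimpleGraph V} {D : Set V} {u v : V} :
    (sp G D).Adj u v ↔ u ≠ v ∧ (G.Adj u v ∨ ∃ d ∈ D, G.Adj u d ∧ G.Adj d v) := Iff.rfl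

/-- set version of the reversed operation -/
theorem rev_op_set {V : Type} {G H : SimpleGraph V} {i j : ℕ} {U U' : Set V} {w x y a u₁ v₁ u₂ v₂ b c : V}
    (hU : ∀ v, v ∈ U' ↔ v ∈ U ∧ v ≠ x ∧ v ≠ y ∧ v ≠ w)
    (hwU : w ∈ U) (hxU : x ∈ U) (hyU : y ∈ U) (hxy : x ≠ y) (hxy' : ¬ G.Adj x y)
    (haU : a ∈ U') (hu₁ : u₁ ∈ U') (hv₁ : v₁ ∈ U') (hu₂ : u₂ ∈ U') (hv₂ : v₂ ∈ U') (hb : b ∈ U') (hc : c ∈ U')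
    (hne1 : u₁ ≠ v₁) (hne2 : u₂ ≠ v₂) (hbc : b ≠ c) (h12 : s(u₁, v₁) ≠ s(u₂, v₂))
    (hn1 : ¬ G.Adj u₁ v₁) (hn2 : ¬ G.Adj u₂ v₂)
    (hw : ∀ z ∈ U, G.Adj w z ↔ z = a ∨ z = x ∨ z = y)
    (hx : ∀ z ∈ U, G.Adj x z ↔ z = w ∨ z = u₁ ∨ z = v₁)
    (hy : ∀ z ∈ U, G.Adj y z ↔ z = w ∨ z = u₂ ∨ z = v₂)
    (hHa : ∀ z ∈ U', H.Adj a z ↔ z = b ∨ z = c)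
    (hHG : ∀ p ∈ U', ∀ q ∈ U', H.Adj p q ↔ (sp G {x, y}).Adj p q)
    (hH : IsInF i j (H.induce U')) : IsInF i (j + 1) (G.induce U) := by
  have hwx := G.ne_of_adj ((hw x hxU).mpr (by simp))
  have hwy := G.ne_of_adj ((hw y hyU).mpr (by simp))
  have hsub : U' ⊆ U := fun v hv => ((hU v).mp hv).1
  have hxz : ∀ z ∈ U', G.Adj x z ↔ z = u₁ ∨ z = v₁ := by
    intro z hz
    rw [hx z (hsub hz)]
    have := ((hU z).mp hz).2.2.2
    simp [this]
  have hyz : ∀ z ∈ U', G.Adj y z ↔ z = u₂ ∨ z = v₂ := by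
    intro z hz
    rw [hy z (hsub hz)]
    have := ((hU z).mp hz).2.2.2
    simp [this]
  have hadj : ∀ p ∈ U', ∀ q ∈ U', H.Adj p q ↔ (G.Adj p q ∨ s(p, q) = s(u₁, v₁) ∨ s(p, q) = s(u₂, v₂)) := by
    intro p hp q hq
    rw [hHG p hp q hq, sp_adj]
    simp only [Set.mem_insert_iff, Set.mem_singleton_iff, exists_eq_or_imp, exists_eq_left, Sym2.eq_iff]
    rw [G.adj_comm p x, G.adj_comm p y, hxz p hp, hxz q hq, hyz p hp, hyz q hq]
    constructor
    · rintro ⟨hpq, h | ⟨h1, h2⟩ | ⟨h1, h2⟩⟩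
      · exact Or.inl h
      · right; left
        rcases h1 with rfl | rfl <;> rcases h2 with rfl | rfl <;> simp_all
      · right; right
        rcases h1 with rfl | rfl <;> rcases h2 with rfl | rfl <;> simp_all
    · rintro (h | (⟨rfl, rfl⟩ | ⟨rfl, rfl⟩) | (⟨rfl, rfl⟩ | ⟨rfl, rfl⟩))
      · exact ⟨G.ne_of_adj h, Or.inl h⟩
      · exact ⟨hne1, by simp⟩
      · exact ⟨hne1.symm, by simp⟩
      · exact ⟨hne2, by simp⟩
      · exact ⟨hne2.symm, by simp⟩
  have hs : ∀ (p q r t : U'), s(p, q) = s(r, t) ↔ s(p.1, q.1) = s(r.1, t.1) := by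
    intro p q r t
    simp only [Sym2.eq_iff, Subtype.ext_iff]
  have hval : ∀ z : U', (⟨z.1, hsub z.2⟩ : U).1 = z.1 := fun _ => rfl
  refine rev_op (G := G.induce U) (H := H.induce U') (fun v => ⟨v.1, hsub v.2⟩) ?_ ⟨w, hwU⟩ ⟨x, hxU⟩ ⟨y, hyU⟩
    (by simpa using hwx) (by simpa using hwy) (by simpa using hxy) ?_ ⟨u₁, hu₁⟩ ⟨v₁, hv₁⟩ ⟨u₂, hu₂⟩ ⟨v₂, hv₂⟩ ⟨a, haU⟩
    ?_ ?_ ?_ ?_ ?_ ?_ ?_ ?_ ?_ ?_ ?_ hH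
  · intro p q h
    exact Subtype.ext (congrArg (fun z : U => z.1) h)
  · rintro ⟨v, hv⟩
    simp only [ne_eq, Subtype.mk.injEq, Subtype.exists, exists_prop, exists_eq_right]
    rw [hU]
    simp [hv]
  · exact (hadj _ hu₁ _ hv₁).mpr (by simp)
  · exact (hadj _ hu₂ _ hv₂).mpr (by simp)
  · rw [Ne, hs]; exact h12
  · refine ⟨⟨b, hb⟩, ⟨c, hc⟩, by simpa using hbc, (hHa b hb).mpr (by simp), (hHa c hc).mpr (by simp), ?_⟩
    rintro ⟨z, hz⟩ h
    simpa using (hHa z hz).mp h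
  · intro p q
    rw [Ne, Ne, hs, hs]
    change G.Adj p.1 q.1 ↔ H.Adj p.1 q.1 ∧ _
    rw [hadj _ p.2 _ q.2]
    constructor
    · intro h
      refine ⟨Or.inl h, ?_, ?_⟩
      · rw [Sym2.eq_iff]
        rintro (⟨e1, e2⟩ | ⟨e1, e2⟩) <;> simp only at e1 e2 <;> rw [e1, e2] at h
        · exact hn1 h
        · exact hn1 h.symm
      · rw [Sym2.eq_iff]
        rintro (⟨e1, e2⟩ | ⟨e1, e2⟩) <;> simp only at e1 e2 <;> rw [e1, e2] at h
        · exact hn2 h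
        · exact hn2 h.symm
    · rintro ⟨h | h | h, h1, h2⟩
      · exact h
      · exact (h1 h).elim
      · exact (h2 h).elim
  · intro z
    simpa [Subtype.ext_iff] using hxz z.1 z.2
  · intro z
    simpa [Subtype.ext_iff] using hyz z.1 z.2
  · intro z
    have := hw z.1 (hsub z.2)
    have h' := (hU z.1).mp z.2
    simpa [Subtype.ext_iff, h'.2.1, h'.2.2.1] using this
  · exact (hw x hxU).mpr (by simp)
  · exact (hw y hyU).mpr (by simp)
  · exact hxy'

/-- set version of the reversed subdivision -/
theorem rev_sub_set {V : Type} {G H : SimpleGraph V} {i j : ℕ} {U U' : Set V} {x p q : V}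
    (hU : ∀ v, v ∈ U' ↔ v ∈ U ∧ v ≠ x) (hxU : x ∈ U) (hp : p ∈ U') (hq : q ∈ U') (hpq : p ≠ q)
    (hn : ¬ G.Adj p q) (hx : ∀ z ∈ U, G.Adj x z ↔ z = p ∨ z = q)
    (hHG : ∀ a ∈ U', ∀ b ∈ U', H.Adj a b ↔ (sp G {x}).Adj a b)
    (hH : IsInF i j (H.induce U')) : IsInF (i + 1) j (G.induce U) := by
  have hsub : U' ⊆ U := fun v hv => ((hU v).mp hv).1
  have hadj : ∀ a ∈ U', ∀ b ∈ U', H.Adj a b ↔ (G.Adj a b ∨ s(a, b) = s(p, q)) := by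
    intro a ha b hb
    rw [hHG a ha b hb, sp_adj]
    simp only [Set.mem_singleton_iff, exists_eq_left, Sym2.eq_iff]
    rw [G.adj_comm a x, hx a (hsub ha), hx b (hsub hb)]
    constructor
    · rintro ⟨hpq, h | ⟨h1, h2⟩⟩
      · exact Or.inl h
      · right
        rcases h1 with rfl | rfl <;> rcases h2 with rfl | rfl <;> simp_all
    · rintro (h | (⟨rfl, rfl⟩ | ⟨rfl, rfl⟩))
      · exact ⟨G.ne_of_adj h, Or.inl h⟩
      · exact ⟨hpq, by simp⟩
      · exact ⟨hpq.symm, by simp⟩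
  have hs : ∀ (p q r t : U'), s(p, q) = s(r, t) ↔ s(p.1, q.1) = s(r.1, t.1) := by
    intro p q r t
    simp only [Sym2.eq_iff, Subtype.ext_iff]
  refine rev_sub (G := G.induce U) (H := H.induce U') (fun v => ⟨v.1, hsub v.2⟩) ?_ ⟨x, hxU⟩ ?_
    ⟨p, hp⟩ ⟨q, hq⟩ ?_ ?_ ?_ hH
  · intro p q h
    exact Subtype.ext (congrArg (fun z : U => z.1) h)
  · rintro ⟨v, hv⟩
    simp only [ne_eq, Subtype.mk.injEq, Subtype.exists, exists_prop, exists_eq_right]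
    rw [hU]
    simp [hv]
  · exact (hadj _ hp _ hq).mpr (by simp)
  · intro a b
    rw [Ne, hs]
    change G.Adj a.1 b.1 ↔ H.Adj a.1 b.1 ∧ _
    rw [hadj _ a.2 _ b.2]
    constructor
    · intro h
      refine ⟨Or.inl h, ?_⟩
      rw [Sym2.eq_iff]
      rintro (⟨e1, e2⟩ | ⟨e1, e2⟩) <;> simp only at e1 e2 <;> rw [e1, e2] at h
      · exact hn h
      · exact hn h.symm
    · rintro ⟨h | h, h1⟩
      · exact h
      · exact (h1 h).elim
  · intro z
    simpa [Subtype.ext_iff] using hx z.1 (hsub z.2)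


/-- matrix lookup -/
def mx (l : List (List Bool)) (i j : ℕ) : Bool := (l.getD i []).getD j false

/-- adjacency after suppressing `x` and `y` -/
def spB (A : ℕ → ℕ → Bool) (x y p q : ℕ) : Bool := A p q || (A p x && A x q) || (A p y && A y q)

def ran8 : List ℕ := [0, 1, 2, 3, 4, 5, 6, 7]

/-- the neighbours other than `w` are not adjacent -/
def indB (A : ℕ → ℕ → Bool) (w x : ℕ) : Bool :=
  ran8.all fun p => p == w || !A x p || ran8.all fun q => q == w || !A x q || !A p q

/-- no common neighbourhood -/
def difB (A : ℕ → ℕ → Bool) (x y : ℕ) : Bool := ran8.any fun p => A x p && !A y p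

/-- search for a way of reducing an eight vertex cubic graph to `K₄` -/
def chk (A : ℕ → ℕ → Bool) : Bool :=
  ran8.any fun w => ran8.any fun x => A w x && indB A w x && ran8.any fun y =>
    A w y && Nat.blt x y && !A x y && indB A w y && difB A x y && ran8.any fun a =>
    A w a && a != x && a != y && ran8.any fun b => 
    b != w && b != x && b != y && spB A x y a b && ran8.any fun c =>
    Nat.blt b c && c != w && c != x && c != y && spB A x y a c && !spB A x y b c && ran8.any fun e =>
    e != w && e != x && e != y && e != a && !spB A x y a e && spB A x y b e && spB A x y c e && ran8.any fun f =>
    Nat.blt e f && f != w && f != x && f != y && f != a && !spB A x y a f && spB A x y b f && spB A x y c f && spB A x y e f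

/-- number of true bits -/
def cb : List Bool → ℕ
  | [] => 0
  | b :: l => b.toNat + cb l

set_option synthInstance.maxSize 4000 in
set_option synthInstance.maxHeartbeats 0 in
set_option maxHeartbeats 0 in
set_option maxRecDepth 100000 in
theorem search8 : ∀ e13 e14 e15 e16 e17 : Bool, cb [e13, e14, e15, e16, e17] = 2 →
    ∀ e23 e24 e25 e26 e27 : Bool, cb [e23, e24, e25, e26, e27] = 2 →
    ∀ e34 e35 e36 e37 : Bool, cb [e13, e23, e34, e35, e36, e37] = 2 →
    ∀ e45 e46 e47 : Bool, cb [e14, e24, e34, e45, e46, e47] = 3 →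
    ∀ e56 e57 : Bool, cb [e15, e25, e35, e45, e56, e57] = 3 →
    ∀ e67 : Bool, cb [e16, e26, e36, e46, e56, e67] = 3 → cb [e17, e27, e37, e47, e57, e67] = 3 →
    chk (mx [[false, true, true, true, false, false, false, false],
      [true, false, false, e13, e14, e15, e16, e17],
      [true, false, false, e23, e24, e25, e26, e27],
      [true, e13, e23, false, e34, e35, e36, e37],
      [false, e14, e24, e34, false, e45, e46, e47],
      [false, e15, e25, e35, e45, false, e56, e57],
      [false, e16, e26, e36, e46, e56, false, e67],
      [false, e17, e27, e37, e47, e57, e67, false]]) = true := by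
  decide +kernel


theorem chk_of {A : ℕ → ℕ → Bool} (hs : ∀ i j, A i j = A j i) (hi : ∀ i, A i i = false)
    (hd : ∀ i < 8, cb [A i 0, A i 1, A i 2, A i 3, A i 4, A i 5, A i 6, A i 7] = 3)
    (h01 : A 0 1 = true) (h02 : A 0 2 = true) (h03 : A 0 3 = true) (h12 : A 1 2 = false) :
    ∃ B : ℕ → ℕ → Bool, (∀ i < 8, ∀ j < 8, B i j = A i j) ∧ chk B = true := by
  have h0 := hd 0 (by norm_num)
  have h1 := hd 1 (by norm_num)
  have h2 := hd 2 (by norm_num)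
  have h3 := hd 3 (by norm_num)
  have h4 := hd 4 (by norm_num)
  have h5 := hd 5 (by norm_num)
  have h6 := hd 6 (by norm_num)
  have h7 := hd 7 (by norm_num)
  rw [hi, h01, h02, h03] at h0
  have hz : ∀ b : Bool, b.toNat = 0 → b = false := by decide
  simp only [cb, Bool.toNat_true, Bool.toNat_false] at h0
  have h04 := hz (A 0 4) (by omega)
  have h05 := hz (A 0 5) (by omega)
  have h06 := hz (A 0 6) (by omega)
  have h07 := hz (A 0 7) (by omega)
  rw [hs 1 0, h01, hi, h12] at h1
  rw [hs 2 0, hs 2 1, h02, hi, h12] at h2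
  rw [hs 3 0, hs 3 1, hs 3 2, h03, hi] at h3
  rw [hs 4 0, hs 4 1, hs 4 2, hs 4 3, h04, hi] at h4
  rw [hs 5 0, hs 5 1, hs 5 2, hs 5 3, hs 5 4, h05, hi] at h5
  rw [hs 6 0, hs 6 1, hs 6 2, hs 6 3, hs 6 4, hs 6 5, h06, hi] at h6
  rw [hs 7 0, hs 7 1, hs 7 2, hs 7 3, hs 7 4, hs 7 5, hs 7 6, h07, hi] at h7
  simp only [cb, Bool.toNat_true, Bool.toNat_false] at h1 h2 h3 h4 h5 h6 h7
  refine ⟨_, ?_, search8 (A 1 3) (A 1 4) (A 1 5) (A 1 6) (A 1 7) (by simp only [cb]; omega)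
    (A 2 3) (A 2 4) (A 2 5) (A 2 6) (A 2 7) (by simp only [cb]; omega)
    (A 3 4) (A 3 5) (A 3 6) (A 3 7) (by simp only [cb]; omega)
    (A 4 5) (A 4 6) (A 4 7) (by simp only [cb]; omega)
    (A 5 6) (A 5 7) (by simp only [cb]; omega) (A 6 7) (by simp only [cb]; omega) (by simp only [cb]; omega)⟩
  intro i hi' j hj'
  interval_cases i <;> interval_cases j <;> simp [mx, *]

theorem L8wit {W : Type} [Fintype W] [DecidableEq W] (H : SimpleGraph W) [DecidableRel H.Adj]
    (hc : Fintype.card W = 8) (hd : ∀ v, H.degree v = 3) {v0 b c : W} (hb : H.Adj v0 b) (hcc : H.Adj v0 c)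
    (hbc : b ≠ c) (hn : ¬ H.Adj b c) : ∃ (g : ℕ → W), (∀ i < 8, ∀ j < 8, g i = g j → i = j) ∧ (∀ v, ∃ i < 8, g i = v) ∧
      ∃ B : ℕ → ℕ → Bool, (∀ i < 8, ∀ j < 8, B i j = true ↔ H.Adj (g i) (g j)) ∧ chk B = true := by
  have h3 := hd v0
  have hbN : b ∈ H.neighborFinset v0 := by simpa
  have hcN : c ∈ (H.neighborFinset v0).erase b := by simp [hbc.symm, hcc]
  have hcard : (((H.neighborFinset v0).erase b).erase c).card = 1 := by
    rw [Finset.card_erase_of_mem hcN, Finset.card_erase_of_mem hbN, card_neighborFinset_eq_degree, h3]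
  obtain ⟨d, hd'⟩ := Finset.card_eq_one.mp hcard
  have hdm : d ∈ ((H.neighborFinset v0).erase b).erase c := by rw [hd']; simp
  simp only [Finset.mem_erase, mem_neighborFinset] at hdm
  obtain ⟨hdc, hdb, hvd⟩ := hdm
  obtain ⟨ε, hε⟩ := Finset.exists_equiv_extend_of_card_eq (α := Fin 8) (t := (Finset.univ : Finset W)) (by simp [hc])
    (s := {0, 1, 2, 3}) (f := ![v0, b, c, d, d, d, d, d]) (by simp) (by
      have e1 := H.ne_of_adj hb
      have e2 := H.ne_of_adj hcc
      have e3 := H.ne_of_adj hvd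
      intro i hi j hj h
      fin_cases i <;> simp at hi <;> fin_cases j <;> simp at hj <;>
        simp [e1, e2, e3, e1.symm, e2.symm, e3.symm, hbc, hbc.symm, hdc, hdb, Ne.symm hdc, Ne.symm hdb] at h ⊢)
  let g : ℕ → W := fun i => (ε (Fin.ofNat 8 i)).1
  have hg : ∀ i : Fin 8, g i = (ε i).1 := by
    intro i
    simp [g]
  refine ⟨g, ?_, ?_, ?_⟩
  · intro i hi j hj h
    have := ε.injective (Subtype.ext h)
    simpa [Fin.ext_iff, Nat.mod_eq_of_lt hi, Nat.mod_eq_of_lt hj] using this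
  · intro v
    refine ⟨(ε.symm ⟨v, by simp⟩ : Fin 8), Fin.isLt _, ?_⟩
    rw [hg]; simp
  · let A : ℕ → ℕ → Bool := fun i j => decide (H.Adj (g i) (g j))
    obtain ⟨B, hB, hB'⟩ := chk_of (A := A) (fun i j => by simp [A, H.adj_comm]) (fun i => by simp [A]) (by
        intro i hi
        have := hd (g i)
        rw [← card_neighborFinset_eq_degree, neighborFinset_eq_filter, Finset.card_filter,
          ← Equiv.sum_comp (ε.trans (Equiv.subtypeUnivEquiv (by simp)))] at this
        simp only [Equiv.trans_apply, Equiv.subtypeUnivEquiv_apply, ← hg, Fin.sum_univ_eight] at this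
        simp only [cb, A, Bool.toNat, Bool.cond_decide]
        simp only [show ((0 : Fin 8) : ℕ) = 0 from rfl, show ((1 : Fin 8) : ℕ) = 1 from rfl, show ((2 : Fin 8) : ℕ) = 2 from rfl,
          show ((3 : Fin 8) : ℕ) = 3 from rfl, show ((4 : Fin 8) : ℕ) = 4 from rfl, show ((5 : Fin 8) : ℕ) = 5 from rfl,
          show ((6 : Fin 8) : ℕ) = 6 from rfl, show ((7 : Fin 8) : ℕ) = 7 from rfl] at this
        omega)
      (by have e0 := hε 0 (by simp); have e1 := hε 1 (by simp)
          simp only [A, decide_eq_true_eq]; change H.Adj (ε 0).1 (ε 1).1; rw [e0, e1]; exact hb)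
      (by have e0 := hε 0 (by simp); have e1 := hε 2 (by simp)
          simp only [A, decide_eq_true_eq]; change H.Adj (ε 0).1 (ε 2).1; rw [e0, e1]; exact hcc)
      (by have e0 := hε 0 (by simp); have e1 := hε 3 (by simp)
          simp only [A, decide_eq_true_eq]; change H.Adj (ε 0).1 (ε 3).1; rw [e0, e1]; exact hvd)
      (by have e0 := hε 1 (by simp); have e1 := hε 2 (by simp)
          simp only [A, decide_eq_false_iff_not]; change ¬ H.Adj (ε 1).1 (ε 2).1; rw [e0, e1]; exact hn)
    refine ⟨B, ?_, hB'⟩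
    intro i hi j hj
    rw [hB i hi j hj]
    simp [A]


theorem k4_in {V : Type} (K : SimpleGraph V) {b c e f : V} (h1 : K.Adj b c) (h2 : K.Adj b e) (h3 : K.Adj b f)
    (h4 : K.Adj c e) (h5 : K.Adj c f) (h6 : K.Adj e f) (U : Set V)
    (hU : ∀ v, v ∈ U ↔ v = b ∨ v = c ∨ v = e ∨ v = f) : IsInF 1 1 (K.induce U) := by
  refine IsInF.iso ?_ IsInF.k4
  have hm : ∀ i : Fin 4, ![b, c, e, f] i ∈ U := by
    intro i
    rw [hU]
    fin_cases i <;> simp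
  let F : Fin 4 → U := fun i => ⟨![b, c, e, f] i, hm i⟩
  have n1 := h1.ne
  have n2 := h2.ne
  have n3 := h3.ne
  have n4 := h4.ne
  have n5 := h5.ne
  have n6 := h6.ne
  have hF : Function.Bijective F := by
    constructor
    · intro i j h
      have h' := congrArg Subtype.val h
      fin_cases i <;> fin_cases j <;>
        simp [F, n1, n2, n3, n4, n5, n6, n1.symm, n2.symm, n3.symm, n4.symm, n5.symm, n6.symm] at h' ⊢
    · rintro ⟨v, hv⟩
      rcases (hU v).mp hv with rfl | rfl | rfl | rfl
      · exact ⟨0, rfl⟩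
      · exact ⟨1, rfl⟩
      · exact ⟨2, rfl⟩
      · exact ⟨3, rfl⟩
  refine ⟨(RelIso.symm ⟨Equiv.ofBijective F hF, ?_⟩)⟩
  intro i j
  rw [Equiv.ofBijective_apply, Equiv.ofBijective_apply]
  fin_cases i <;> fin_cases j <;>
        simp [F, h1, h2, h3, h4, h5, h6, h1.symm, h2.symm, h3.symm, h4.symm, h5.symm, h6.symm]

theorem deg3_others {W : Type} [Fintype W] [DecidableEq W] (H : SimpleGraph W) [DecidableRel H.Adj] {x w : W}
    (h : H.degree x = 3) (hw : H.Adj x w) : ∃ u v, u ≠ v ∧ u ≠ w ∧ v ≠ w ∧ ∀ z, H.Adj x z ↔ z = w ∨ z = u ∨ z = v := by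
  have hwN : w ∈ H.neighborFinset x := by simpa
  have hcard : ((H.neighborFinset x).erase w).card = 2 := by
    rw [Finset.card_erase_of_mem hwN, card_neighborFinset_eq_degree, h]
  obtain ⟨u, v, huv, he⟩ := Finset.card_eq_two.mp hcard
  have hm : ∀ z, (z ≠ w ∧ H.Adj x z) ↔ z = u ∨ z = v := by
    intro z
    have := congrArg (fun s => z ∈ s) he
    simpa using this
  refine ⟨u, v, huv, ((hm u).mpr (by simp)).1, ((hm v).mpr (by simp)).1, ?_⟩
  intro z
  rw [← hm]
  by_cases hz : z = w
  · subst hz; simp [hw]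
  · simp [hz]

theorem isInF_of_univ {V : Type} {G : SimpleGraph V} {i j : ℕ} {U : Set V} (hU : ∀ v, v ∈ U)
    (h : IsInF i j (G.induce U)) : IsInF i j G := by
  refine IsInF.iso ⟨RelIso.symm ⟨Equiv.subtypeUnivEquiv hU, ?_⟩⟩ h
  intro a b
  simp

theorem L8core {W : Type} [Fintype W] [DecidableEq W] (H : SimpleGraph W) [DecidableRel H.Adj]
    (hd : ∀ v, H.degree v = 3) {w x y a b c e f : W}
    (hcov : ∀ v, v = w ∨ v = x ∨ v = y ∨ v = a ∨ v = b ∨ v = c ∨ v = e ∨ v = f)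
    (hnd : [w, x, y, a, b, c, e, f].Nodup)
    (hwx : H.Adj w x) (hwy : H.Adj w y) (hwa : H.Adj w a) (hxy : ¬ H.Adj x y)
    (hx : ∀ p q, p ≠ w → q ≠ w → H.Adj x p → H.Adj x q → ¬ H.Adj p q)
    (hy : ∀ p q, p ≠ w → q ≠ w → H.Adj y p → H.Adj y q → ¬ H.Adj p q)
    (hdif : ∃ p, H.Adj x p ∧ ¬ H.Adj y p)
    (rab : (sp H {x, y}).Adj a b) (rac : (sp H {x, y}).Adj a c) (rae : ¬ (sp H {x, y}).Adj a e)
    (raf : ¬ (sp H {x, y}).Adj a f) (rbc : ¬ (sp H {x, y}).Adj b c) (rbe : (sp H {x, y}).Adj b e)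
    (rbf : (sp H {x, y}).Adj b f) (rce : (sp H {x, y}).Adj c e) (rcf : (sp H {x, y}).Adj c f)
    (ref : (sp H {x, y}).Adj e f) : IsInF 2 2 H := by
  simp only [List.nodup_cons, List.mem_cons, List.not_mem_nil, or_false, not_or, List.nodup_nil, and_true,
    not_false_eq_true] at hnd
  obtain ⟨⟨nwx, nwy, nwa, nwb, nwc, nwe, nwf⟩, ⟨nxy, nxa, nxb, nxc, nxe, nxf⟩, ⟨nya, nyb, nyc, nye, nyf⟩,
    ⟨nab, nac, nae, naf⟩, ⟨nbc, nbe, nbf⟩, ⟨nce, ncf⟩, nef⟩ := hnd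
  obtain ⟨u1, v1, huv1, hu1, hv1, hx'⟩ := deg3_others H (hd x) hwx.symm
  obtain ⟨u2, v2, huv2, hu2, hv2, hy'⟩ := deg3_others H (hd y) hwy.symm
  obtain ⟨u0, v0, huv0, hu0, hv0, hw'⟩ := deg3_others H (hd w) hwa
  have hw : ∀ z, H.Adj w z ↔ z = a ∨ z = x ∨ z = y := by
    have e1 := (hw' x).mp hwx
    have e2 := (hw' y).mp hwy
    intro z
    rw [hw']
    rcases e1 with rfl | rfl | rfl
    · exact (nxa rfl).elim
    · rcases e2 with rfl | rfl | rfl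
      · exact (nya rfl).elim
      · exact (nxy rfl).elim
      · rfl
    · rcases e2 with rfl | rfl | rfl
      · exact (nya rfl).elim
      · tauto
      · exact (nxy rfl).elim
  have ax1 : H.Adj x u1 := (hx' u1).mpr (by simp)
  have ax2 : H.Adj x v1 := (hx' v1).mpr (by simp)
  have ay1 : H.Adj y u2 := (hy' u2).mpr (by simp)
  have ay2 : H.Adj y v2 := (hy' v2).mpr (by simp)
  have hyx : ¬ H.Adj y x := fun h => hxy h.symm
  have mem : ∀ v, v ∈ ({v | v ≠ x ∧ v ≠ y ∧ v ≠ w} : Set W) ↔ v = a ∨ v = b ∨ v = c ∨ v = e ∨ v = f := by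
    intro v
    simp only [Set.mem_ofPred_eq]
    constructor
    · intro h
      have := hcov v
      tauto
    · rintro (rfl | rfl | rfl | rfl | rfl) <;> simp [*, Ne.symm, eq_comm]
  have key : IsInF 2 1 ((sp H {x, y}).induce {v | v ≠ x ∧ v ≠ y ∧ v ≠ w}) := by
    refine rev_sub_set (U' := {v | v = b ∨ v = c ∨ v = e ∨ v = f}) (x := a) (p := b) (q := c)
      (H := sp (sp H {x, y}) {a}) ?_ ((mem a).mpr (by simp)) (by simp) (by simp) nbc rbc ?_ (fun _ _ _ _ => Iff.rfl) ?_
    · intro v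
      rw [mem]
      simp only [Set.mem_ofPred_eq]
      constructor
      · rintro (rfl | rfl | rfl | rfl) <;> simp [Ne.symm nab, Ne.symm nac, Ne.symm nae, Ne.symm naf]
      · rintro ⟨h, h'⟩
        tauto
    · intro z hz
      rcases (mem z).mp hz with rfl | rfl | rfl | rfl | rfl
      · simp [nab, nac]
      · simp [rab]
      · simp [rac]
      · simp [rae, Ne.symm nbe, Ne.symm nce]
      · simp [raf, Ne.symm nbf, Ne.symm ncf]
    · refine k4_in _ (b := b) (c := c) (e := e) (f := f) ?_ ?_ ?_ ?_ ?_ ?_ _ (fun v => Iff.rfl)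
      · exact ⟨nbc, Or.inr ⟨a, rfl, rab.symm, rac⟩⟩
      · exact ⟨nbe, Or.inl rbe⟩
      · exact ⟨nbf, Or.inl rbf⟩
      · exact ⟨nce, Or.inl rce⟩
      · exact ⟨ncf, Or.inl rcf⟩
      · exact ⟨nef, Or.inl ref⟩
  refine isInF_of_univ (U := Set.univ) (fun v => Set.mem_univ v) ?_
  refine rev_op_set (U' := {v | v ≠ x ∧ v ≠ y ∧ v ≠ w}) (H := sp H {x, y}) (w := w) (x := x) (y := y) (a := a)
    (u₁ := u1) (v₁ := v1) (u₂ := u2) (v₂ := v2) (b := b) (c := c) (by simp) (by simp) (by simp) (by simp) nxy hxy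
    ((mem a).mpr (by simp)) ⟨ax1.ne', ?_, hu1⟩ ⟨ax2.ne', ?_, hv1⟩ ⟨?_, ay1.ne', hu2⟩ ⟨?_, ay2.ne', hv2⟩
    ((mem b).mpr (by simp)) ((mem c).mpr (by simp)) huv1 huv2 nbc ?_ (hx _ _ hu1 hv1 ax1 ax2) (hy _ _ hu2 hv2 ay1 ay2)
    (fun z _ => hw z) (fun z _ => hx' z) (fun z _ => hy' z) ?_ (fun _ _ _ _ => Iff.rfl) key
  · rintro rfl; exact hxy ax1
  · rintro rfl; exact hxy ax2
  · rintro rfl; exact hyx ay1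
  · rintro rfl; exact hyx ay2
  · intro h
    obtain ⟨p, hp1, hp2⟩ := hdif
    rw [hx'] at hp1
    rw [hy'] at hp2
    rw [Sym2.eq_iff] at h
    rcases h with ⟨rfl, rfl⟩ | ⟨rfl, rfl⟩ <;> tauto
  · intro z hz
    rcases (mem z).mp hz with rfl | rfl | rfl | rfl | rfl
    · simp [nab, nac]
    · simp [rab]
    · simp [rac]
    · simp [rae, Ne.symm nbe, Ne.symm nce]
    · simp [raf, Ne.symm nbf, Ne.symm ncf]

set_option maxHeartbeats 1000000 in
theorem L8 {W : Type} [Fintype W] [DecidableEq W] (H : SimpleGraph W) [DecidableRel H.Adj]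
    (hc : Fintype.card W = 8) (hd : ∀ v, H.degree v = 3) {v0 b c : W} (hb : H.Adj v0 b) (hcc : H.Adj v0 c)
    (hbc : b ≠ c) (hn : ¬ H.Adj b c) : IsInF 2 2 H := by
  obtain ⟨g, ginj, gsurj, B, hB, hchk⟩ := L8wit H hc hd hb hcc hbc hn
  have m8 : ∀ i, i ∈ ran8 ↔ i < 8 := by
    intro i
    simp only [ran8, List.mem_cons, List.not_mem_nil, or_false]
    omega
  simp only [chk, List.any_eq_true, Bool.and_eq_true, Nat.blt_eq, bne_iff_ne, ne_eq, m8, Bool.not_eq_true',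
    Bool.not_eq_eq_eq_not, Bool.not_true] at hchk
  obtain ⟨w, w8, x, x8, ⟨bwx, indx⟩, y, y8, ⟨⟨⟨⟨bwy, lxy⟩, bxy⟩, indy⟩, dif⟩, a, a8, ⟨⟨bwa, nax⟩, nay⟩, b', b8,
    ⟨⟨⟨nbw, nbx⟩, nby⟩, rab⟩, c', c8, ⟨⟨⟨⟨⟨lbc, ncw⟩, ncx⟩, ncy⟩, rac⟩, rbc⟩, e, e8,
    ⟨⟨⟨⟨⟨⟨new, nex⟩, ney⟩, nea⟩, rae⟩, rbe⟩, rce⟩, f, f8, ⟨⟨⟨⟨⟨⟨⟨lef, nfw⟩, nfx⟩, nfy⟩, nfa⟩, raf⟩, rbf⟩, rcf⟩, ref⟩ := hchk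
  have hBf : ∀ i < 8, ∀ j < 8, B i j = false ↔ ¬ H.Adj (g i) (g j) := by
    intro i hi j hj
    rw [← hB i hi j hj]
    simp
  have gne : ∀ i < 8, ∀ j < 8, i ≠ j → g i ≠ g j := fun i hi j hj h h' => h (ginj i hi j hj h')
  have adjne : ∀ i < 8, ∀ j < 8, B i j = true → i ≠ j := by
    rintro i hi j hj h rfl
    exact ((hB i hi i hj).mp h).ne rfl
  have hBs : ∀ i < 8, ∀ j < 8, B i j = B j i := by
    intro i hi j hj
    rw [Bool.eq_iff_iff, hB i hi j hj, hB j hj i hi, H.adj_comm]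
  have hind : ∀ z < 8, indB B w z = true → ∀ p q, p ≠ g w → q ≠ g w → H.Adj (g z) p → H.Adj (g z) q → ¬ H.Adj p q := by
    intro z hz h p q hp hq h1 h2 h3
    obtain ⟨i, hi, rfl⟩ := gsurj p
    obtain ⟨j, hj, rfl⟩ := gsurj q
    simp only [indB, List.all_eq_true, m8] at h
    have h' := h i hi
    have hiw : i ≠ w := fun h => hp (h ▸ rfl)
    have hjw : j ≠ w := fun h => hq (h ▸ rfl)
    rw [(hB z hz i hi).mpr h1] at h'
    have hiw' : (i == w) = false := by simpa using hiw
    have hjw' : (j == w) = false := by simpa using hjw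
    rw [hiw'] at h'
    simp only [Bool.not_true, Bool.false_or, List.all_eq_true, m8] at h'
    have h'' := h' j hj
    rw [hjw', (hB z hz j hj).mpr h2, (hB i hi j hj).mpr h3] at h''
    simp at h''
  have spc : ∀ p < 8, ∀ q < 8, spB B x y p q = true → spB B x y q p = true := by
    intro p hp q hq
    intro h
    rw [← h]
    simp only [spB]
    rw [hBs q hq p hp, hBs q hq x x8, hBs x x8 p hp, hBs q hq y y8, hBs y y8 p hp, Bool.and_comm (B x q) (B p x),
      Bool.and_comm (B y q) (B p y)]
  have spt : ∀ p < 8, ∀ q < 8, p ≠ q → (spB B x y p q = true ↔ (sp H {g x, g y}).Adj (g p) (g q)) := by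
    intro p hp q hq hpq
    rw [sp_adj]
    simp only [spB, Bool.or_eq_true, Bool.and_eq_true, hB _ hp _ hq, hB _ hp _ x8, hB _ hp _ y8,
      hB _ x8 _ hq, hB _ y8 _ hq]
    have := gne p hp q hq hpq
    simp [this, or_assoc]
  have spf : ∀ p < 8, ∀ q < 8, p ≠ q → spB B x y p q = false → ¬ (sp H {g x, g y}).Adj (g p) (g q) := by
    intro p hp q hq hpq h
    rw [← spt p hp q hq hpq, h]
    simp
  have nba : b' ≠ a := by rintro rfl; rw [rbc] at rac; simp at rac
  have nca : c' ≠ a := by rintro rfl; rw [spc _ a8 _ b8 rab] at rbc; simp at rbc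
  have nbe : b' ≠ e := by rintro rfl; rw [rab] at rae; simp at rae
  have nce : c' ≠ e := by rintro rfl; rw [rac] at rae; simp at rae
  have nbf : b' ≠ f := by rintro rfl; rw [rab] at raf; simp at raf
  have ncf : c' ≠ f := by rintro rfl; rw [rac] at raf; simp at raf
  have nwx := adjne w w8 x x8 bwx
  have nwy := adjne w w8 y y8 bwy
  have nwa := adjne w w8 a a8 bwa
  have nxy : x ≠ y := lxy.ne
  have nbc : b' ≠ c' := lbc.ne
  have nef : e ≠ f := lef.ne
  have hnd : [w, x, y, a, b', c', e, f].Nodup := by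
    simp only [List.nodup_cons, List.mem_cons, List.not_mem_nil, or_false, not_or, List.nodup_nil, and_true,
      not_false_eq_true]
    refine ⟨⟨?_, ?_, ?_, ?_, ?_, ?_, ?_⟩, ⟨?_, ?_, ?_, ?_, ?_, ?_⟩, ⟨?_, ?_, ?_, ?_, ?_⟩, ⟨?_, ?_, ?_, ?_⟩, ⟨?_, ?_, ?_⟩,
      ⟨?_, ?_⟩, ?_⟩ <;> first | assumption | (apply Ne.symm; assumption)
  have hset : [w, x, y, a, b', c', e, f].toFinset = Finset.range 8 := by
    apply Finset.eq_of_subset_of_card_le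
    · intro i hi
      simp only [List.mem_toFinset] at hi
      rw [Finset.mem_range]
      simp only [List.mem_cons, List.not_mem_nil, or_false] at hi
      rcases hi with rfl | rfl | rfl | rfl | rfl | rfl | rfl | rfl <;> assumption
    · rw [List.toFinset_card_of_nodup hnd]; rfl
  refine L8core H hd (w := g w) (x := g x) (y := g y) (a := g a) (b := g b') (c := g c') (e := g e) (f := g f)
    ?_ ?_ ((hB _ w8 _ x8).mp bwx) ((hB _ w8 _ y8).mp bwy) ((hB _ w8 _ a8).mp bwa) ((hBf _ x8 _ y8).mp bxy) ?_ ?_ ?_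
    ((spt _ a8 _ b8 nba.symm).mp rab) ((spt _ a8 _ c8 nca.symm).mp rac) (spf _ a8 _ e8 (Ne.symm nea) rae)
    (spf _ a8 _ f8 (Ne.symm nfa) raf) (spf _ b8 _ c8 nbc rbc) ((spt _ b8 _ e8 nbe).mp rbe) ((spt _ b8 _ f8 nbf).mp rbf)
    ((spt _ c8 _ e8 nce).mp rce) ((spt _ c8 _ f8 ncf).mp rcf) ((spt _ e8 _ f8 nef).mp ref)
  · intro v
    obtain ⟨i, hi, rfl⟩ := gsurj v
    have : i ∈ Finset.range 8 := by simpa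
    rw [← hset, List.mem_toFinset] at this
    simp only [List.mem_cons, List.not_mem_nil, or_false] at this
    rcases this with rfl | rfl | rfl | rfl | rfl | rfl | rfl | rfl <;> simp
  · change (List.map g [w, x, y, a, b', c', e, f]).Nodup
    refine List.Nodup.map_on ?_ hnd
    have h8 : ∀ i ∈ [w, x, y, a, b', c', e, f], i < 8 := by
      intro i hi
      simp only [List.mem_cons, List.not_mem_nil, or_false] at hi
      rcases hi with rfl | rfl | rfl | rfl | rfl | rfl | rfl | rfl <;> assumption
    intro i hi j hj h
    exact ginj i (h8 i hi) j (h8 j hj) h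
  · exact hind x x8 indx
  · exact hind y y8 indy
  · simp only [difB, List.any_eq_true, m8, Bool.and_eq_true, Bool.not_eq_eq_eq_not, Bool.not_true] at dif
    obtain ⟨p, p8, h1, h2⟩ := dif
    exact ⟨g p, (hB _ x8 _ p8).mp h1, (hBf _ y8 _ p8).mp h2⟩


/-- suppressible configuration -/
structure Good {V : Type} [Fintype V] [DecidableEq V] (G : SimpleGraph V) [DecidableRel G.Adj] (U D : Finset V) : Prop where
  nice : Nice G
  sub : D ⊆ U
  card : (U \ D).card = 8
  three : ∀ v ∈ U \ D, (G.neighborFinset v ∩ U).card = 3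
  two : ∀ d ∈ D, ∃ p q, p ≠ q ∧ p ∈ U \ D ∧ q ∈ U \ D ∧ ∀ z ∈ U, G.Adj d z ↔ z = p ∨ z = q
  few : D.card ≤ 7

section
variable {V : Type} [Fintype V] [DecidableEq V] {G : SimpleGraph V} [DecidableRel G.Adj] {U D : Finset V}

theorem Good.other (h : Good G U D) {v d : V} (hv : v ∈ U \ D) (hd : d ∈ D) (hvd : G.Adj v d) :
    ∃ t, t ≠ v ∧ t ∈ U \ D ∧ ∀ z ∈ U, G.Adj d z ↔ z = v ∨ z = t := by
  obtain ⟨p, q, hpq, hp, hq, h'⟩ := h.two d hd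
  rcases (h' v (Finset.mem_sdiff.mp hv).1).mp hvd.symm with rfl | rfl
  · exact ⟨q, hpq.symm, hq, h'⟩
  · refine ⟨p, hpq, hp, fun z hz => ?_⟩
    rw [h' z hz, or_comm]

theorem Good.deg (h : Good G U D) {v : V} (hv : v ∈ U \ D) [DecidableRel (sp G (D : Set V)).Adj] :
    ((U \ D).filter (fun t => (sp G (D : Set V)).Adj v t)).card = 3 := by
  rw [← h.three v hv]
  symm
  have hex : ∀ z ∈ G.neighborFinset v ∩ U, ∃ t, t ≠ v ∧ t ∈ U \ D ∧ G.Adj v z ∧ z ∈ U ∧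
      ((z ∉ D ∧ z = t) ∨ (z ∈ D ∧ G.Adj z t ∧ ∀ t' ∈ U, G.Adj z t' → t' = v ∨ t' = t)) := by
    intro z hz
    rw [Finset.mem_inter, mem_neighborFinset] at hz
    by_cases hzD : z ∈ D
    · obtain ⟨t, h1, h2, h3⟩ := h.other hv hzD hz.1
      exact ⟨t, h1, h2, hz.1, hz.2, Or.inr ⟨hzD, (h3 t (Finset.mem_sdiff.mp h2).1).mpr (by simp), fun t' ht' h' => (h3 t' ht').mp h'⟩⟩
    · exact ⟨z, hz.1.ne', by simp [hz.2, hzD], hz.1, hz.2, Or.inl ⟨hzD, rfl⟩⟩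
  choose f f1 f2 f3 f4 f5 using hex
  refine Finset.card_bij f ?_ ?_ ?_
  · intro z hz
    rw [Finset.mem_filter]
    refine ⟨f2 z hz, (f1 z hz).symm, ?_⟩
    rcases f5 z hz with ⟨h1, h2⟩ | ⟨h1, h2, h3⟩
    · left; rw [← h2]; exact f3 z hz
    · right; exact ⟨z, h1, f3 z hz, h2⟩
  · intro z hz z' hz' he
    have h6 := f5 z hz
    have h6' := f5 z' hz'
    have e3 := f3 z hz
    have e3' := f3 z' hz'
    have e1 := f1 z hz
    rw [← he] at h6'
    rcases h6 with ⟨h1, h2⟩ | ⟨h1, h2, h3⟩ <;> rcases h6' with ⟨h1', h2'⟩ | ⟨h1', h2', h3'⟩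
    · rw [h2, h2']
    · rw [h2] at e3
      exact (h.nice.tri v z' _ e3' h2' e3).elim
    · rw [h2'] at e3'
      exact (h.nice.tri v z _ e3 h2 e3').elim
    · exact h.nice.sq v _ z z' e1.symm e3 h2 e3' h2'
  · intro t ht
    rw [Finset.mem_filter, sp_adj] at ht
    obtain ⟨ht, hne, h1⟩ := ht
    rw [Finset.mem_sdiff] at ht
    rcases h1 with h1 | ⟨d, hd, h1, h2⟩
    · have hm : t ∈ G.neighborFinset v ∩ U := by simp [h1, ht.1]
      refine ⟨t, hm, ?_⟩
      rcases f5 t hm with ⟨h1, h2⟩ | ⟨h1, h2, h3⟩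
      · exact h2.symm
      · exact (ht.2 h1).elim
    · have hd' : d ∈ D := hd
      have hm : d ∈ G.neighborFinset v ∩ U := by simp [h1, h.sub hd']
      refine ⟨d, hm, ?_⟩
      rcases f5 d hm with ⟨h1, h2⟩ | ⟨h1, h2', h3⟩
      · exact (h1 hd').elim
      · rcases h3 t ht.1 h2 with h4 | h4
        · exact (hne h4.symm).elim
        · exact h4.symm

theorem Good.exists_few (h : Good G U D) : ∃ v ∈ U \ D, (G.neighborFinset v ∩ D).card ≤ 1 := by
  by_contra hcon
  push Not at hcon
  have h1 := Finset.sum_card_bipartiteAbove_eq_sum_card_bipartiteBelow (s := U \ D) (t := D) G.Adj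
  have h2 : ∑ b ∈ D, ((U \ D).bipartiteBelow G.Adj b).card ≤ ∑ b ∈ D, 2 := by
    refine Finset.sum_le_sum fun d hd => ?_
    obtain ⟨p, q, hpq, hp, hq, h'⟩ := h.two d hd
    refine (Finset.card_le_card (t := {p, q}) ?_).trans Finset.card_le_two
    intro z hz
    rw [Finset.mem_bipartiteBelow, Finset.mem_sdiff] at hz
    have := (h' z hz.1.1).mp hz.2.symm
    simpa using this
  have h3 : ∑ v ∈ U \ D, 2 ≤ ∑ v ∈ U \ D, (D.bipartiteAbove G.Adj v).card := by
    refine Finset.sum_le_sum fun v hv => ?_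
    refine (hcon v hv).trans_le' (le_refl _) |>.trans_eq ?_
    congr 1
    ext z
    simp [Finset.mem_bipartiteAbove, and_comm]
  have := h.few
  have := h.card
  simp only [Finset.sum_const, smul_eq_mul] at h2 h3
  omega

theorem Good.base (h : Good G U D) : IsInF 2 2 ((sp G (D : Set V)).induce ((U \ D : Finset V) : Set V)) := by
  classical
  obtain ⟨v0, hv0, hf⟩ := h.exists_few
  have h3 := h.three v0 hv0
  have hcard : 1 < (G.neighborFinset v0 ∩ (U \ D)).card := by
    have : G.neighborFinset v0 ∩ U = (G.neighborFinset v0 ∩ (U \ D)) ∪ (G.neighborFinset v0 ∩ D) := by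
      ext z
      have := @h.sub z
      simp only [Finset.mem_inter, Finset.mem_union, Finset.mem_sdiff]
      tauto
    rw [this] at h3
    have := Finset.card_union_le (G.neighborFinset v0 ∩ (U \ D)) (G.neighborFinset v0 ∩ D)
    omega
  obtain ⟨b, hb, c, hc, hbc⟩ := Finset.one_lt_card.mp hcard
  rw [Finset.mem_inter, mem_neighborFinset] at hb hc
  refine L8 _ ?_ ?_ (v0 := ⟨v0, hv0⟩) (b := ⟨b, hb.2⟩) (c := ⟨c, hc.2⟩) ?_ ?_ ?_ ?_
  · rw [← h.card, ← Set.ncard_coe_finset, ← Nat.card_coe_set_eq, Nat.card_eq_fintype_card]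
  · rintro ⟨v, hv⟩
    rw [← h.deg hv, ← card_neighborFinset_eq_degree]
    refine Finset.card_bij (fun t _ => t.1) ?_ ?_ ?_
    · rintro ⟨t, ht⟩ h
      rw [mem_neighborFinset] at h
      rw [Finset.mem_filter]
      exact ⟨ht, h⟩
    · rintro t _ t' _ h
      exact Subtype.ext h
    · intro t ht
      rw [Finset.mem_filter] at ht
      exact ⟨⟨t, ht.1⟩, by rw [mem_neighborFinset]; exact ht.2, rfl⟩
  · exact ⟨hb.1.ne, Or.inl hb.1⟩
  · exact ⟨hc.1.ne, Or.inl hc.1⟩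
  · simpa using hbc
  · rintro ⟨_, h1 | ⟨d, hd, h1, h2⟩⟩
    · exact h.nice.tri v0 b c hb.1 h1 hc.1
    · have := h.nice.sq b c v0 d hbc hb.1.symm hc.1 h1 h2
      subst this
      exact (Finset.mem_sdiff.mp hv0).2 hd

theorem Good.main (h : Good G U D) : ∀ (k : ℕ) (D' : Finset V), D' ⊆ D → (D \ D').card = k →
    IsInF (2 + k) 2 ((sp G (D' : Set V)).induce ((U \ D' : Finset V) : Set V)) := by
  intro k
  induction k with
  | zero =>
    intro D' hD' h0
    have : D = D' := (Finset.sdiff_eq_empty_iff_subset.mp (Finset.card_eq_zero.mp h0)).antisymm hD'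
    subst this
    exact h.base
  | succ k ih =>
    intro D' hD' hk
    obtain ⟨d, hd⟩ := Finset.card_pos.mp (by omega : 0 < (D \ D').card)
    have hd' := Finset.mem_sdiff.mp hd
    have hins : insert d D' ⊆ D := by
      intro z hz
      rcases Finset.mem_insert.mp hz with rfl | hz
      · exact hd'.1
      · exact hD' hz
    have hk' : (D \ insert d D').card = k := by
      have : D \ insert d D' = (D \ D').erase d := by
        ext z; simp; tauto
      rw [this, Finset.card_erase_of_mem hd, hk]; rfl
    have ih' := ih _ hins hk'
    obtain ⟨p, q, hpq, hp, hq, h'⟩ := h.two d hd'.1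
    have hp' := Finset.mem_sdiff.mp hp
    have hq' := Finset.mem_sdiff.mp hq
    have hdp : G.Adj d p := (h' p hp'.1).mpr (by simp)
    have hdq : G.Adj d q := (h' q hq'.1).mpr (by simp)
    have hindep : ∀ d' ∈ D, ¬ G.Adj d d' := by
      intro d' hd1 h1
      rcases (h' d' (h.sub hd1)).mp h1 with rfl | rfl
      · exact hp'.2 hd1
      · exact hq'.2 hd1
    have hsd : ∀ z, (sp G (D' : Set V)).Adj d z ↔ G.Adj d z := by
      intro z
      rw [sp_adj]
      constructor
      · rintro ⟨_, h1 | ⟨d', h1, h2, _⟩⟩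
        · exact h1
        · exact (hindep d' (hD' h1) h2).elim
      · intro h1
        exact ⟨h1.ne, Or.inl h1⟩
    refine rev_sub_set (x := d) (p := p) (q := q) (U' := ((U \ insert d D' : Finset V) : Set V)) ?_ ?_ ?_ ?_ hpq ?_ ?_ ?_ ih'
    · intro v
      simp only [Finset.coe_sdiff, Finset.coe_insert, Set.mem_sdiff, Finset.mem_coe, Set.mem_insert_iff]
      tauto
    · simp [h.sub hd'.1, hd'.2]
    · have : p ≠ d := by rintro rfl; exact hp'.2 hd'.1
      have h2 : p ∉ D' := fun h1 => hp'.2 (hD' h1)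
      simp [hp'.1, this, h2]
    · have : q ≠ d := by rintro rfl; exact hq'.2 hd'.1
      have h2 : q ∉ D' := fun h1 => hq'.2 (hD' h1)
      simp [hq'.1, this, h2]
    · rintro ⟨_, h1 | ⟨d', h1, h2, h3⟩⟩
      · exact h.nice.tri d p q hdp h1 hdq
      · have := h.nice.sq p q d d' hpq hdp.symm hdq h2 h3
        subst this
        exact hd'.2 h1
    · intro z hz
      rw [hsd, h' z]
      simp at hz
      exact hz.1
    · intro a ha b hb
      rw [sp_adj, sp_adj]
      simp only [Set.mem_singleton_iff, exists_eq_left]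
      rw [(sp G (D' : Set V)).adj_comm a d, hsd, hsd, G.adj_comm d a, sp_adj]
      simp only [Finset.coe_insert, Set.mem_insert_iff, exists_eq_or_imp]
      generalize (∃ a_1 ∈ (D' : Set V), G.Adj a a_1 ∧ G.Adj a_1 b) = P
      generalize (G.Adj a d ∧ G.Adj d b) = Q
      by_cases hab : a = b
      · simp [hab]
      · simp only [ne_eq, hab, not_false_eq_true, true_and]
        tauto

end

theorem sp_empty {V : Type} {G : SimpleGraph V} : sp G ∅ = G := by
  ext u v
  simp only [sp_adj, Set.mem_empty_iff_false, false_and, exists_false, or_false]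
  exact ⟨fun h => h.2, fun h => ⟨h.ne, h⟩⟩


section
variable {W : Type} [Fintype W] [DecidableEq W] {H : SimpleGraph W} [DecidableRel H.Adj]

theorem ball_card (hN : Nice H) (u : W) : ∃ B : Finset W, B.card = ∑ v ∈ H.neighborFinset u, H.degree v + 1 ∧
    ∀ z, z ∈ B ↔ z = u ∨ H.Adj u z ∨ ∃ t, H.Adj u t ∧ H.Adj t z := by
  have hdisj : ∀ v ∈ H.neighborFinset u, ∀ v' ∈ H.neighborFinset u, v ≠ v' →
      Disjoint (insert v ((H.neighborFinset v).erase u)) (insert v' ((H.neighborFinset v').erase u)) := by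
    intro v hv v' hv' hne
    rw [mem_neighborFinset] at hv hv'
    rw [Finset.disjoint_left]
    intro x hx hx'
    simp only [Finset.mem_insert, Finset.mem_erase, mem_neighborFinset] at hx hx'
    rcases hx with rfl | ⟨hxu, hx⟩
    · rcases hx' with rfl | ⟨_, hx'⟩
      · exact hne rfl
      · exact hN.tri u x v' hv hx'.symm hv'
    · rcases hx' with rfl | ⟨_, hx'⟩
      · exact hN.tri u v x hv hx hv'
      · exact hne (hN.sq u x v v' (Ne.symm hxu) hv hx hv' hx')
  have hcard : ∀ v ∈ H.neighborFinset u, (insert v ((H.neighborFinset v).erase u)).card = H.degree v := by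
    intro v hv
    rw [mem_neighborFinset] at hv
    rw [Finset.card_insert_of_notMem (by simp), Finset.card_erase_of_mem (by simpa using hv.symm),
      card_neighborFinset_eq_degree]
    have : 0 < H.degree v := by
      rw [degree_pos_iff_exists_adj]
      exact ⟨u, hv.symm⟩
    omega
  rw [← Finset.sum_congr rfl hcard, ← Finset.card_biUnion hdisj]
  have hu : u ∉ (H.neighborFinset u).biUnion fun v => insert v ((H.neighborFinset v).erase u) := by
    simp only [Finset.mem_biUnion, Finset.mem_insert, Finset.mem_erase, not_exists, not_and, mem_neighborFinset]
    rintro v hv (h | h)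
    · exact H.ne_of_adj hv h
    · exact h.1 rfl
  refine ⟨_, Finset.card_insert_of_notMem hu, ?_⟩
  intro z
  simp only [Finset.mem_biUnion, Finset.mem_insert, Finset.mem_erase, mem_neighborFinset]
  constructor
  · rintro (h | ⟨v, hv, rfl | h⟩)
    · exact Or.inl h
    · exact Or.inr (Or.inl hv)
    · exact Or.inr (Or.inr ⟨v, hv, h.2⟩)
  · rintro (h | h | ⟨t, h1, h2⟩)
    · exact Or.inl h
    · exact Or.inr ⟨z, h, Or.inl rfl⟩
    · by_cases hz : z = u
      · exact Or.inl hz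
      · exact Or.inr ⟨t, h1, Or.inr ⟨hz, h2⟩⟩

theorem deg2_nbrs {x : W} (h : H.degree x = 2) : ∃ u v, u ≠ v ∧ ∀ z, H.Adj x z ↔ z = u ∨ z = v := by
  rw [← card_neighborFinset_eq_degree] at h
  obtain ⟨u, v, huv, he⟩ := Finset.card_eq_two.mp h
  refine ⟨u, v, huv, fun z => ?_⟩
  have := congrArg (fun s => z ∈ s) he
  simpa using this

theorem deg3_nbrs {x : W} (h : H.degree x = 3) : ∃ t u v, u ≠ v ∧ u ≠ t ∧ v ≠ t ∧ ∀ z, H.Adj x z ↔ z = t ∨ z = u ∨ z = v := by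
  have hp : 0 < H.degree x := by omega
  obtain ⟨t, ht⟩ := (degree_pos_iff_exists_adj _ _).mp hp
  exact ⟨t, deg3_others H h ht⟩

theorem exists_far (hN : Nice H) (h3 : ∀ v, H.degree v ≤ 3) {z : W} (hz : H.degree z ≤ 2) (hc : 8 ≤ Fintype.card W) :
    ∃ w, w ≠ z ∧ ¬ H.Adj z w ∧ ∀ t, H.Adj z t → ¬ H.Adj t w := by
  obtain ⟨B, hB, hm⟩ := ball_card hN z
  have : ∑ v ∈ H.neighborFinset z, H.degree v ≤ (H.neighborFinset z).card • 3 := Finset.sum_le_card_nsmul _ _ _ (fun v _ => h3 v)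
  rw [card_neighborFinset_eq_degree, smul_eq_mul] at this
  have hlt : B.card < Fintype.card W := by omega
  obtain ⟨w, hw⟩ : ∃ w, w ∉ B := by
    by_contra hcon
    push Not at hcon
    have := Finset.card_eq_iff_eq_univ B |>.mpr (Finset.eq_univ_iff_forall.mpr hcon)
    omega
  rw [hm] at hw
  push Not at hw
  exact ⟨w, hw.1, hw.2.1, hw.2.2⟩

theorem op_step (hN : Nice H) {i j : ℕ} {w x y a : W} (hax : a ≠ x) (hay : a ≠ y) (hxy : x ≠ y)
    (hw : ∀ z, H.Adj w z ↔ z = a ∨ z = x ∨ z = y) (ha3 : H.degree a = 3) (hx3 : H.degree x = 3) (hy3 : H.degree y = 3)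
    (h : IsInF i j ((sp H {x, y}).induce {v | v ≠ x ∧ v ≠ y ∧ v ≠ w})) : IsInF i (j + 1) H := by
  have awx : H.Adj w x := (hw x).mpr (by simp)
  have awy : H.Adj w y := (hw y).mpr (by simp)
  have awa : H.Adj w a := (hw a).mpr (by simp)
  obtain ⟨u1, v1, huv1, hu1, hv1, hx'⟩ := deg3_others H hx3 awx.symm
  obtain ⟨u2, v2, huv2, hu2, hv2, hy'⟩ := deg3_others H hy3 awy.symm
  obtain ⟨b, c, hbc, hb, hc, ha'⟩ := deg3_others H ha3 awa.symm
  have ax1 : H.Adj x u1 := (hx' u1).mpr (by simp)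
  have ax2 : H.Adj x v1 := (hx' v1).mpr (by simp)
  have ay1 : H.Adj y u2 := (hy' u2).mpr (by simp)
  have ay2 : H.Adj y v2 := (hy' v2).mpr (by simp)
  have ab : H.Adj a b := (ha' b).mpr (by simp)
  have ac : H.Adj a c := (ha' c).mpr (by simp)
  have nxy : ¬ H.Adj x y := fun h => hN.tri w x y awx h awy
  have nax : ¬ H.Adj a x := fun h => hN.tri w a x awa h awx
  have nay : ¬ H.Adj a y := fun h => hN.tri w a y awa h awy
  have nyx : ¬ H.Adj y x := fun h => nxy h.symm
  refine isInF_of_univ (U := Set.univ) (fun v => Set.mem_univ v) ?_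
  refine rev_op_set (U' := {v | v ≠ x ∧ v ≠ y ∧ v ≠ w}) (H := sp H {x, y}) (w := w) (x := x) (y := y) (a := a)
    (u₁ := u1) (v₁ := v1) (u₂ := u2) (v₂ := v2) (b := b) (c := c) (by simp) (by simp) (by simp) (by simp) hxy nxy
    ⟨hax, hay, awa.ne'⟩ ⟨ax1.ne', ?_, hu1⟩ ⟨ax2.ne', ?_, hv1⟩ ⟨?_, ay1.ne', hu2⟩ ⟨?_, ay2.ne', hv2⟩
    ⟨?_, ?_, hb⟩ ⟨?_, ?_, hc⟩ huv1 huv2 hbc ?_ (fun h => hN.tri x _ _ ax1 h ax2) (fun h => hN.tri y _ _ ay1 h ay2)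
    (fun z _ => hw z) (fun z _ => hx' z) (fun z _ => hy' z) ?_ (fun _ _ _ _ => Iff.rfl) h
  · rintro rfl; exact nxy ax1
  · rintro rfl; exact nxy ax2
  · rintro rfl; exact nyx ay1
  · rintro rfl; exact nyx ay2
  · rintro rfl; exact nax ab
  · rintro rfl; exact nay ab
  · rintro rfl; exact nax ac
  · rintro rfl; exact nay ac
  · intro h
    rw [Sym2.eq_iff] at h
    rcases h with ⟨rfl, rfl⟩ | ⟨rfl, rfl⟩
    · exact hu1 (hN.sq x y u1 w hxy ax1 ay1.symm awx.symm awy)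
    · exact hu1 (hN.sq x y u1 w hxy ax1 ay2.symm awx.symm awy)
  · intro z hz
    rw [sp_adj]
    simp only [Set.mem_insert_iff, Set.mem_singleton_iff, exists_eq_or_imp, exists_eq_left, nax, nay, false_and, or_false]
    rw [ha']
    have := hz.2.2
    constructor
    · rintro ⟨_, h⟩; tauto
    · intro h
      refine ⟨?_, by tauto⟩
      rcases h with rfl | rfl
      · exact ab.ne
      · exact ac.ne

theorem step12 (hN : Nice H) {Z : Finset W} (h3 : ∀ v ∉ Z, H.degree v = 3) (h2 : ∀ v ∈ Z, H.degree v = 2)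
    (hc : Fintype.card W = 12 + Z.card) (hZ : Z.card ≤ 1) {w : W} (hwZ : w ∉ Z) (hnZ : ∀ z ∈ Z, ¬ H.Adj w z)
    (hfZ : ∀ z ∈ Z, ∀ t, H.Adj z t → ¬ H.Adj t w) : IsInF (3 + Z.card) 3 H := by
  obtain ⟨a, x, y, hxy, hxa, hya, hw⟩ := deg3_nbrs (h3 w hwZ)
  have hnot : ∀ v, H.Adj w v → v ∉ Z := fun v h h' => hnZ v h' h
  have awx : H.Adj w x := (hw x).mpr (by simp)
  have awy : H.Adj w y := (hw y).mpr (by simp)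
  have awa : H.Adj w a := (hw a).mpr (by simp)
  have hDc : ({a, x, y} ∪ Z : Finset W).card = 3 + Z.card := by
    rw [Finset.card_union_of_disjoint, Finset.card_eq_three.mpr ⟨a, x, y, hxa.symm, hya.symm, hxy, rfl⟩]
    rw [Finset.disjoint_left]
    intro v hv
    apply hnot
    rw [hw]
    simpa using hv
  have memD : ∀ v, v ∈ ({a, x, y} ∪ Z : Finset W) ↔ H.Adj w v ∨ v ∈ Z := by
    intro v
    rw [hw]
    simp [or_assoc]
  have hsub : ({a, x, y} ∪ Z : Finset W) ⊆ Finset.univ.erase w := by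
    intro v hv
    rw [memD] at hv
    simp only [Finset.mem_erase, Finset.mem_univ, and_true]
    rintro rfl
    rcases hv with h | h
    · exact h.ne rfl
    · exact hwZ h
  have hg : Good H (Finset.univ.erase w) ({a, x, y} ∪ Z) := by
    refine ⟨hN, hsub, ?_, ?_, ?_, by omega⟩
    · rw [Finset.card_sdiff_of_subset hsub, hDc, Finset.card_erase_of_mem (Finset.mem_univ w), Finset.card_univ, hc]
      omega
    · intro v hv
      simp only [Finset.mem_sdiff, Finset.mem_erase, Finset.mem_univ, and_true, memD, not_or] at hv
      rw [← h3 v hv.2.2, ← card_neighborFinset_eq_degree]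
      congr 1
      rw [Finset.inter_eq_left]
      intro t ht
      rw [mem_neighborFinset] at ht
      simp only [Finset.mem_erase, Finset.mem_univ, and_true]
      rintro rfl
      exact hv.2.1 ht.symm
    · intro d hd
      rw [memD] at hd
      simp only [Finset.mem_sdiff, Finset.mem_erase, Finset.mem_univ, and_true, memD, not_or]
      rcases hd with hd | hd
      · obtain ⟨p, q, hpq, hp, hq, h⟩ := deg3_others H (h3 d (hnot d hd)) hd.symm
        have adp : H.Adj d p := (h p).mpr (by simp)
        have adq : H.Adj d q := (h q).mpr (by simp)
        refine ⟨p, q, hpq, ⟨hp, fun h' => hN.tri w d p hd adp h', fun h' => hfZ p h' d adp.symm hd.symm⟩,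
          ⟨hq, fun h' => hN.tri w d q hd adq h', fun h' => hfZ q h' d adq.symm hd.symm⟩, fun z hz => ?_⟩
        rw [h]; tauto
      · obtain ⟨p, q, hpq, h⟩ := deg2_nbrs (h2 d hd)
        have adp : H.Adj d p := (h p).mpr (by simp)
        have adq : H.Adj d q := (h q).mpr (by simp)
        have hone : ∀ z ∈ Z, ¬ H.Adj d z := by
          intro z hz h'
          rw [Finset.card_le_one.mp hZ z hz d hd] at h'
          exact h'.ne rfl
        refine ⟨p, q, hpq, ⟨?_, fun h' => hfZ d hd p adp h'.symm, fun h' => hone p h' adp⟩,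
          ⟨?_, fun h' => hfZ d hd q adq h'.symm, fun h' => hone q h' adq⟩, fun z hz => h z⟩
        · rintro rfl; exact hnZ d hd adp.symm
        · rintro rfl; exact hnZ d hd adq.symm
  refine op_step hN hxa.symm hya.symm hxy hw (h3 a (hnot a awa)) (h3 x (hnot x awx)) (h3 y (hnot y awy)) ?_
  have hsub2 : ({x, y} : Finset W) ⊆ {a, x, y} ∪ Z := by
    intro v hv
    rw [memD, hw]
    simp at hv
    tauto
  have := hg.main (1 + Z.card) {x, y} hsub2 (by
    rw [Finset.card_sdiff_of_subset hsub2, hDc, Finset.card_pair hxy]; omega)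
  rw [← Nat.add_assoc] at this
  have hs : ((Finset.univ.erase w \ {x, y} : Finset W) : Set W) = {v | v ≠ x ∧ v ≠ y ∧ v ≠ w} := by
    ext v
    simp only [Set.mem_ofPred_eq, Finset.mem_coe, Finset.mem_sdiff, Finset.mem_erase, Finset.mem_univ, and_true,
      Finset.mem_insert, Finset.mem_singleton, not_or]
    tauto
  rw [hs, Finset.coe_pair] at this
  exact this

end

theorem L12 : Lstmt 12 18 3 3 := by
  intro W _ _ H _ hN h3 hc hs
  have hall : ∀ v, H.degree v = 3 := by
    by_contra hcon
    push Not at hcon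
    obtain ⟨v, hv⟩ := hcon
    have : ∑ v, H.degree v < ∑ v : W, 3 := Finset.sum_lt_sum (fun v _ => h3 v) ⟨v, Finset.mem_univ v, lt_of_le_of_ne (h3 v) hv⟩
    simp [hc] at this
    omega
  have : Nonempty W := Fintype.card_pos_iff.mp (by omega)
  obtain ⟨w⟩ := this
  simpa using step12 (Z := ∅) hN (fun v _ => hall v) (by simp) (by simpa using hc) (by simp) (w := w) (by simp) (by simp) (by simp)

theorem L13 : Lstmt 13 19 4 3 := by
  intro W _ _ H _ hN h3 hc hs
  have hdef : ∑ v, (3 - H.degree v) = 1 := by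
    have : ∑ v, (3 - H.degree v) + ∑ v, H.degree v = 39 := by
      rw [← Finset.sum_add_distrib, Finset.sum_congr rfl (fun v _ => Nat.sub_add_cancel (h3 v))]
      simp [hc]
    omega
  obtain ⟨z, -, hz⟩ := Finset.exists_ne_zero_of_sum_ne_zero (by rw [hdef]; norm_num : ∑ v, (3 - H.degree v) ≠ 0)
  have h1 := Finset.add_sum_erase Finset.univ (fun v => 3 - H.degree v) (Finset.mem_univ z)
  simp only [hdef] at h1
  have hrest : ∀ v ∉ ({z} : Finset W), H.degree v = 3 := by
    intro v hv
    have : 3 - H.degree v = 0 := Finset.sum_eq_zero_iff.mp (by omega : ∑ v ∈ Finset.univ.erase z, (3 - H.degree v) = 0) v (by simpa using hv)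
    have := h3 v
    omega
  have hz2 : H.degree z = 2 := by have := h3 z; omega
  obtain ⟨w, hw1, hw2, hw3⟩ := exists_far hN h3 hz2.le (by omega)
  simpa using step12 (Z := {z}) hN hrest (by simpa using hz2) (by simpa using hc) (by simp) (w := w) (by simpa using hw1)
    (by simpa [H.adj_comm] using hw2) (by simpa using hw3)

theorem L10 : Lstmt 10 14 4 2 := by
  intro W _ _ H _ hN h3 hc hs
  have hdef : ∑ v, (3 - H.degree v) = 2 := by
    have : ∑ v, (3 - H.degree v) + ∑ v, H.degree v = 30 := by
      rw [← Finset.sum_add_distrib, Finset.sum_congr rfl (fun v _ => Nat.sub_add_cancel (h3 v))]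
      simp [hc]
    omega
  obtain ⟨z, -, hz⟩ := Finset.exists_ne_zero_of_sum_ne_zero (by rw [hdef]; norm_num : ∑ v, (3 - H.degree v) ≠ 0)
  have hz' : ∃ z', z' ≠ z ∧ H.degree z' ≤ 2 ∧ ¬ H.Adj z z' := by
    by_contra hcon
    push Not at hcon
    obtain ⟨w, hw1, hw2, hw3⟩ := exists_far hN h3 (by omega : H.degree z ≤ 2) (by omega)
    have hd : ∀ v, v ≠ z → ¬ H.Adj z v → H.degree v = 3 := by
      intro v h1 h2
      have h5 := hcon v h1
      have := h3 v
      by_contra h4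
      exact h2 (h5 (by omega))
    obtain ⟨B, hB, hm⟩ := ball_card hN w
    have h9 : ∑ v ∈ H.neighborFinset w, H.degree v = ∑ v ∈ H.neighborFinset w, 3 := by
      refine Finset.sum_congr rfl fun v hv => ?_
      rw [mem_neighborFinset] at hv
      refine hd v ?_ ?_
      · rintro rfl; exact hw2 hv.symm
      · intro h; exact hw3 v h hv.symm
    rw [Finset.sum_const, card_neighborFinset_eq_degree, hd w hw1 hw2, smul_eq_mul] at h9
    have hB' : B = Finset.univ := (Finset.card_eq_iff_eq_univ B).mp (by omega)
    have hzB : z ∈ B := by rw [hB']; simp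
    rw [hm] at hzB
    rcases hzB with h | h | ⟨t, h1, h2⟩
    · exact hw1 h.symm
    · exact hw2 h.symm
    · exact hw3 t h2.symm h1.symm
  obtain ⟨z', hne, hz'2, hnadj⟩ := hz'
  have h1 := Finset.add_sum_erase Finset.univ (fun v => 3 - H.degree v) (Finset.mem_univ z)
  have h2 := Finset.add_sum_erase (Finset.univ.erase z) (fun v => 3 - H.degree v) (a := z') (by simpa using hne)
  simp only [hdef] at h1 h2
  have hrest : ∀ v, v ≠ z → v ≠ z' → H.degree v = 3 := by
    intro v hv hv'
    have : 3 - H.degree v = 0 := Finset.sum_eq_zero_iff.mp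
      (by omega : ∑ v ∈ (Finset.univ.erase z).erase z', (3 - H.degree v) = 0) v (by simp [hv, hv'])
    have := h3 v
    omega
  have hzd : H.degree z = 2 := by have := h3 z; omega
  have hzd' : H.degree z' = 2 := by omega
  have hg : Good H Finset.univ {z, z'} := by
    refine ⟨hN, Finset.subset_univ _, ?_, ?_, ?_, ?_⟩
    · rw [Finset.card_sdiff_of_subset (Finset.subset_univ _), Finset.card_pair hne.symm, Finset.card_univ, hc]
    · intro v hv
      simp at hv
      rw [Finset.inter_univ, card_neighborFinset_eq_degree]
      exact hrest v hv.1 hv.2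
    · intro d hd
      simp only [Finset.mem_insert, Finset.mem_singleton] at hd
      have hd2 : H.degree d = 2 := by rcases hd with rfl | rfl <;> assumption
      have hi : ∀ p, H.Adj d p → p ∈ Finset.univ \ ({z, z'} : Finset W) := by
        intro p hp
        simp only [Finset.mem_sdiff, Finset.mem_univ, Finset.mem_insert, Finset.mem_singleton, true_and, not_or]
        rcases hd with rfl | rfl
        · exact ⟨hp.ne', by rintro rfl; exact hnadj hp⟩
        · exact ⟨by rintro rfl; exact hnadj hp.symm, hp.ne'⟩
      obtain ⟨p, q, hpq, h⟩ := deg2_nbrs hd2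
      exact ⟨p, q, hpq, hi p ((h p).mpr (by simp)), hi q ((h q).mpr (by simp)), fun z _ => h z⟩
    · rw [Finset.card_pair hne.symm]; norm_num
  have := hg.main 2 ∅ (by simp) (by simp [Finset.card_pair hne.symm])
  rw [Finset.coe_empty, sp_empty] at this
  exact isInF_of_univ (by simp) this


section
variable {W : Type} [Fintype W] [DecidableEq W] {H : SimpleGraph W} [DecidableRel H.Adj]

theorem deg3_third {x w v : W} (h : H.degree x = 3) (hw : H.Adj x w) (hv : H.Adj x v) (hne : w ≠ v) :
    ∃ u, u ≠ w ∧ u ≠ v ∧ ∀ z, H.Adj x z ↔ z = u ∨ z = w ∨ z = v := by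
  obtain ⟨p, q, hpq, hp, hq, h'⟩ := deg3_others H h hw
  rcases (h' v).mp hv with h1 | h1 | h1
  · exact (hne h1.symm).elim
  · subst h1
    exact ⟨q, hq, hpq.symm, fun z => by rw [h' z]; tauto⟩
  · subst h1
    exact ⟨p, hp, hpq, fun z => by rw [h' z]; tauto⟩

set_option maxHeartbeats 1600000 in
theorem step16 (hN : Nice H) (h3 : ∀ v, H.degree v = 3) (hc : Fintype.card W = 16) {w1 x w2 : W} (hne : w1 ≠ w2)
    (h1x : H.Adj w1 x) (h2x : H.Adj w2 x) (h5 : ∀ p q, H.Adj w1 p → H.Adj p q → H.Adj q w2 → False) : IsInF 4 4 H := by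
  obtain ⟨p, hpw1, hpw2, hx⟩ := deg3_third (h3 x) h1x.symm h2x.symm hne
  obtain ⟨y, a, hya, hyx, hax, hw1⟩ := deg3_others H (h3 w1) h1x
  obtain ⟨u, v, huv, hux, hvx, hw2⟩ := deg3_others H (h3 w2) h2x
  have axp : H.Adj x p := (hx p).mpr (by simp)
  have awy : H.Adj w1 y := (hw1 y).mpr (by simp)
  have awa : H.Adj w1 a := (hw1 a).mpr (by simp)
  have awu : H.Adj w2 u := (hw2 u).mpr (by simp)
  have awv : H.Adj w2 v := (hw2 v).mpr (by simp)
  have n12 : ¬ H.Adj w1 w2 := fun h => hN.tri w1 w2 x h h2x h1x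
  have memX : ∀ t, t ∈ ({w1, x, w2} : Finset W) ↔ t = w1 ∨ t = x ∨ t = w2 := by simp
  have F1' : ∀ t, ¬ (H.Adj w1 t ∧ H.Adj x t) := fun t h => hN.tri w1 x t h1x h.2 h.1
  have F1b : ∀ t, ¬ (H.Adj w2 t ∧ H.Adj x t) := fun t h => hN.tri w2 x t h2x h.2 h.1
  have F1c : ∀ t, H.Adj w1 t → H.Adj w2 t → t = x := fun t h h' => hN.sq w1 w2 t x hne h h'.symm h1x h2x.symm
  have memD : ∀ d, d ∈ ({p, y, a, u, v} : Finset W) ↔ d = p ∨ d = y ∨ d = a ∨ d = u ∨ d = v := by simp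
  have hDX : ∀ d ∈ ({p, y, a, u, v} : Finset W), d ∉ ({w1, x, w2} : Finset W) := by
    intro d hd
    rw [memX]
    rw [memD] at hd
    rcases hd with rfl | rfl | rfl | rfl | rfl
    · rintro (h | h | h)
      · exact hpw1 h
      · exact axp.ne' h
      · exact hpw2 h
    · rintro (h | h | h)
      · exact awy.ne' h
      · exact hyx h
      · exact n12 (h ▸ awy)
    · rintro (h | h | h)
      · exact awa.ne' h
      · exact hax h
      · exact n12 (h ▸ awa)
    · rintro (h | h | h)
      · exact n12 (h ▸ awu).symm
      · exact hux h
      · exact awu.ne' h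
    · rintro (h | h | h)
      · exact n12 (h ▸ awv).symm
      · exact hvx h
      · exact awv.ne' h
  have hpar : ∀ d ∈ ({p, y, a, u, v} : Finset W), ∃ t ∈ ({w1, x, w2} : Finset W), H.Adj t d := by
    intro d hd
    rw [memD] at hd
    rcases hd with rfl | rfl | rfl | rfl | rfl
    · exact ⟨x, by simp, axp⟩
    · exact ⟨w1, by simp, awy⟩
    · exact ⟨w1, by simp, awa⟩
    · exact ⟨w2, by simp, awu⟩
    · exact ⟨w2, by simp, awv⟩
  have hchild : ∀ t ∈ ({w1, x, w2} : Finset W), ∀ d, H.Adj t d → d ∉ ({w1, x, w2} : Finset W) → d ∈ ({p, y, a, u, v} : Finset W) := by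
    intro t ht d htd hd
    rw [memX] at ht hd
    rw [memD]
    rcases ht with rfl | rfl | rfl
    · have := (hw1 d).mp htd; tauto
    · have := (hx d).mp htd; tauto
    · have := (hw2 d).mp htd; tauto
  have F1 : ∀ d ∉ ({w1, x, w2} : Finset W), ∀ t ∈ ({w1, x, w2} : Finset W), ∀ t' ∈ ({w1, x, w2} : Finset W),
      H.Adj t d → H.Adj t' d → t = t' := by
    intro d hd t ht t' ht' h h'
    rw [memX] at ht ht' hd
    rcases ht with rfl | rfl | rfl <;> rcases ht' with rfl | rfl | rfl
    · rfl
    · exact (F1' d ⟨h, h'⟩).elim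
    · have := F1c d h h'; tauto
    · exact (F1' d ⟨h', h⟩).elim
    · rfl
    · exact (F1b d ⟨h', h⟩).elim
    · have := F1c d h' h; tauto
    · exact (F1b d ⟨h, h'⟩).elim
    · rfl
  have F2 : ∀ d ∈ ({p, y, a, u, v} : Finset W), ∀ d' ∈ ({p, y, a, u, v} : Finset W), ¬ H.Adj d d' := by
    intro d hd d' hd' hdd
    obtain ⟨t, ht, htd⟩ := hpar d hd
    obtain ⟨t', ht', htd'⟩ := hpar d' hd'
    have hX := hDX d hd
    have hX' := hDX d' hd'
    rw [memX] at ht ht' hX hX'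
    push Not at hX hX'
    rcases ht with rfl | rfl | rfl <;> rcases ht' with rfl | rfl | rfl
    · exact hN.tri _ _ _ htd hdd htd'
    · exact hX.2.1 (hN.sq t d' d t' hX'.1.symm htd hdd h1x htd')
    · exact h5 d d' htd hdd htd'.symm
    · exact hX.1 (hN.sq t d' d t' hX'.2.1.symm htd hdd h1x.symm htd')
    · exact hN.tri _ _ _ htd hdd htd'
    · exact hX.2.2 (hN.sq t d' d t' hX'.2.1.symm htd hdd h2x.symm htd')
    · exact h5 d' d htd' hdd.symm htd.symm
    · exact hX.2.1 (hN.sq t d' d t' hX'.2.2.symm htd hdd h2x htd')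
    · exact hN.tri _ _ _ htd hdd htd'
  have hnbr : ∀ d ∈ ({p, y, a, u, v} : Finset W), ∀ t ∈ ({w1, x, w2} : Finset W), H.Adj t d → ∃ b c, b ≠ c ∧
      (b ∉ ({w1, x, w2} : Finset W) ∧ b ∉ ({p, y, a, u, v} : Finset W)) ∧
      (c ∉ ({w1, x, w2} : Finset W) ∧ c ∉ ({p, y, a, u, v} : Finset W)) ∧ ∀ z, H.Adj d z ↔ z = t ∨ z = b ∨ z = c := by
    intro d hd t ht htd
    obtain ⟨b, c, hbc, hb, hc, h⟩ := deg3_others H (h3 d) htd.symm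
    have adb : H.Adj d b := (h b).mpr (by simp)
    have adc : H.Adj d c := (h c).mpr (by simp)
    refine ⟨b, c, hbc, ⟨fun h' => hb ?_, fun h' => F2 d hd b h' adb⟩, ⟨fun h' => hc ?_, fun h' => F2 d hd c h' adc⟩, h⟩
    · exact F1 d (hDX d hd) b h' t ht adb.symm htd
    · exact F1 d (hDX d hd) c h' t ht adc.symm htd
  have nyu : y ≠ u := fun h => hyx (F1c y awy (h ▸ awu))
  have nyv : y ≠ v := fun h => hyx (F1c y awy (h ▸ awv))
  have nau : a ≠ u := fun h => hax (F1c a awa (h ▸ awu))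
  have nav : a ≠ v := fun h => hax (F1c a awa (h ▸ awv))
  have npy : p ≠ y := fun h => F1' p ⟨h ▸ awy, axp⟩
  have npa : p ≠ a := fun h => F1' p ⟨h ▸ awa, axp⟩
  have npu : p ≠ u := fun h => F1b p ⟨h ▸ awu, axp⟩
  have npv : p ≠ v := fun h => F1b p ⟨h ▸ awv, axp⟩
  have hDc : ({p, y, a, u, v} : Finset W).card = 5 := by
    rw [Finset.card_insert_of_notMem (by simp [npy, npa, npu, npv]), Finset.card_insert_of_notMem (by simp [hya, nyu, nyv]),
      Finset.card_insert_of_notMem (by simp [nau, nav]), Finset.card_pair huv]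
  have hXc : ({w1, x, w2} : Finset W).card = 3 := Finset.card_eq_three.mpr ⟨w1, x, w2, h1x.ne, hne, h2x.ne', rfl⟩
  have hsub : ({p, y, a, u, v} : Finset W) ⊆ Finset.univ \ {w1, x, w2} := by
    intro d hd
    rw [Finset.mem_sdiff]
    exact ⟨Finset.mem_univ _, hDX d hd⟩
  have hg : Good H (Finset.univ \ {w1, x, w2}) {p, y, a, u, v} := by
    refine ⟨hN, hsub, ?_, ?_, ?_, by omega⟩
    · rw [Finset.card_sdiff_of_subset hsub, hDc, Finset.card_sdiff_of_subset (Finset.subset_univ _), hXc, Finset.card_univ, hc]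
    · intro t ht
      rw [Finset.mem_sdiff, Finset.mem_sdiff] at ht
      rw [← h3 t, ← card_neighborFinset_eq_degree]
      congr 1
      rw [Finset.inter_eq_left]
      intro s hs
      rw [mem_neighborFinset] at hs
      rw [Finset.mem_sdiff]
      exact ⟨Finset.mem_univ _, fun h => ht.2 (hchild s h t hs.symm ht.1.2)⟩
    · intro d hd
      obtain ⟨t, ht, htd⟩ := hpar d hd
      obtain ⟨b, c, hbc, hb, hc, h⟩ := hnbr d hd t ht htd
      refine ⟨b, c, hbc, ?_, ?_, ?_⟩
      · simp only [Finset.mem_sdiff, Finset.mem_univ, true_and]; exact hb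
      · simp only [Finset.mem_sdiff, Finset.mem_univ, true_and]; exact hc
      · intro z hz
        rw [Finset.mem_sdiff] at hz
        have : z ≠ t := by rintro rfl; exact hz.2 ht
        rw [h]; tauto
  have hsub2 : ({y, u, v} : Finset W) ⊆ {p, y, a, u, v} := by
    intro d hd
    rw [memD]
    simp only [Finset.mem_insert, Finset.mem_singleton] at hd
    tauto
  have key := hg.main 2 {y, u, v} hsub2 (by
    rw [Finset.card_sdiff_of_subset hsub2, hDc, Finset.card_eq_three.mpr ⟨y, u, v, nyu, nyv, huv, rfl⟩])
  have pD : p ∈ ({p, y, a, u, v} : Finset W) := by simp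
  have yD : y ∈ ({p, y, a, u, v} : Finset W) := by simp
  have uD : u ∈ ({p, y, a, u, v} : Finset W) := by simp
  have vD : v ∈ ({p, y, a, u, v} : Finset W) := by simp
  have xX : x ∈ ({w1, x, w2} : Finset W) := by simp
  have w1X : w1 ∈ ({w1, x, w2} : Finset W) := by simp
  have w2X : w2 ∈ ({w1, x, w2} : Finset W) := by simp
  have hU' : ∀ z, z ∈ (((Finset.univ \ {w1, x, w2}) \ {y, u, v} : Finset W) : Set W) ↔
      z ∉ ({w1, x, w2} : Finset W) ∧ z ≠ y ∧ z ≠ u ∧ z ≠ v := by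
    intro z
    rw [Finset.mem_coe, Finset.mem_sdiff, Finset.mem_sdiff]
    simp only [Finset.mem_univ, true_and, Finset.mem_insert, Finset.mem_singleton, not_or]
  have hout : ∀ z, z ∉ ({w1, x, w2} : Finset W) ∧ z ∉ ({p, y, a, u, v} : Finset W) →
      z ∈ (((Finset.univ \ {w1, x, w2}) \ {y, u, v} : Finset W) : Set W) := by
    intro z hz
    rw [hU']
    refine ⟨hz.1, ?_, ?_, ?_⟩ <;> rintro rfl
    · exact hz.2 yD
    · exact hz.2 uD
    · exact hz.2 vD
  obtain ⟨b, c, hbc, hb, hc', hp'⟩ := hnbr p pD x xX axp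
  obtain ⟨u1, v1, huv1, hu1, hv1, hu'⟩ := hnbr u uD w2 w2X awu
  obtain ⟨u2, v2, huv2, hu2, hv2, hv'⟩ := hnbr v vD w2 w2X awv
  have auu1 : H.Adj u u1 := (hu' u1).mpr (by simp)
  have auv1 : H.Adj u v1 := (hu' v1).mpr (by simp)
  have avu2 : H.Adj v u2 := (hv' u2).mpr (by simp)
  have avv2 : H.Adj v v2 := (hv' v2).mpr (by simp)
  have nux : ¬ H.Adj u x := fun h => F1b u ⟨awu, h.symm⟩
  have nvx : ¬ H.Adj v x := fun h => F1b v ⟨awv, h.symm⟩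
  have hnox : ∀ z, z ∉ ({w1, x, w2} : Finset W) ∧ z ∉ ({p, y, a, u, v} : Finset W) → ¬ H.Adj z x :=
    fun z hz h => hz.2 (hchild x xX z h.symm hz.1)
  have H1 : ∀ s t, (sp H {x, y}).Adj s t ↔ s ≠ t ∧ (H.Adj s t ∨ (H.Adj s x ∧ H.Adj x t) ∨ (H.Adj s y ∧ H.Adj y t)) := by
    intro s t
    rw [sp_adj]
    simp only [Set.mem_insert_iff, Set.mem_singleton_iff, exists_eq_or_imp, exists_eq_left]
  have H1u : ∀ t, (sp H {x, y}).Adj u t ↔ H.Adj u t := by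
    intro t
    have := F2 u uD y yD
    rw [H1]
    simp only [nux, this, false_and, or_false]
    exact ⟨fun h => h.2, fun h => ⟨h.ne, h⟩⟩
  have H1v : ∀ t, (sp H {x, y}).Adj v t ↔ H.Adj v t := by
    intro t
    have := F2 v vD y yD
    rw [H1]
    simp only [nvx, this, false_and, or_false]
    exact ⟨fun h => h.2, fun h => ⟨h.ne, h⟩⟩
  have pU' : p ∈ (((Finset.univ \ {w1, x, w2}) \ {y, u, v} : Finset W) : Set W) := by
    rw [hU']
    exact ⟨hDX p pD, npy, npu, npv⟩
  refine op_step hN (w := w1) (x := x) (y := y) (a := a) hax hya.symm hyx.symm (fun z => by rw [hw1]; clear * -; tauto) (h3 a) (h3 x) (h3 y) ?_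
  have hnadj : ∀ d ∈ ({p, y, a, u, v} : Finset W), d ≠ y → ∀ s t, s ≠ t → H.Adj d s → H.Adj d t → 
      (s ∉ ({w1, x, w2} : Finset W) ∧ s ∉ ({p, y, a, u, v} : Finset W)) → ¬ (sp H {x, y}).Adj s t := by
    intro d hd hdy s t hst hs ht hsX h
    rw [H1] at h
    rcases h.2 with h | h | h
    · exact hN.tri d s t hs h ht
    · exact hnox s hsX h.1
    · exact hdy (hN.sq s t d y hst hs.symm ht h.1 h.2)
  refine rev_op_set (G := sp H {x, y}) (H := sp H (({y, u, v} : Finset W) : Set W)) (U := {v | v ≠ x ∧ v ≠ y ∧ v ≠ w1})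
    (w := w2) (x := u) (y := v) (a := p) (u₁ := u1) (v₁ := v1) (u₂ := u2) (v₂ := v2) (b := b) (c := c)
    ?_ ?_ ?_ ?_ huv ?_ pU' (hout _ hu1) (hout _ hv1) (hout _ hu2) (hout _ hv2) (hout _ hb) (hout _ hc') huv1 huv2 hbc
    ?_ (hnadj u uD nyu.symm _ _ huv1 auu1 auv1 hu1) (hnadj v vD nyv.symm _ _ huv2 avu2 avv2 hu2) ?_ ?_ ?_ ?_ ?_ key
  · intro z
    rw [hU', memX]
    simp only [Set.mem_ofPred_eq]
    clear * -
    tauto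
  · exact ⟨h2x.ne, fun h => n12 (h ▸ awy), hne.symm⟩
  · have := hDX u uD
    rw [memX] at this
    exact ⟨hux, nyu.symm, by clear * - this; tauto⟩
  · have := hDX v vD
    rw [memX] at this
    exact ⟨hvx, nyv.symm, by clear * - this; tauto⟩
  · rw [H1u]; exact F2 u uD v vD
  · intro h
    have h1 : H.Adj v u1 := by
      rw [Sym2.eq_iff] at h
      rcases h with ⟨rfl, rfl⟩ | ⟨rfl, rfl⟩ <;> assumption
    have := hN.sq u v u1 w2 huv auu1 h1.symm awu.symm awv
    exact hu1.1 (this ▸ w2X)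
  · rintro z ⟨hzx, hzy, hz1⟩
    have ny : ¬ H.Adj w2 y := fun h => hyx (F1c y awy h)
    rw [H1]
    simp only [ny, false_and, or_false, h2x, true_and]
    rw [hw2, hx]
    constructor
    · rintro ⟨h1, h2⟩; replace h1 := h1.symm; clear * - h1 h2 hzx hz1; tauto
    · rintro (rfl | rfl | rfl)
      · exact ⟨hpw2.symm, by simp⟩
      · exact ⟨awu.ne, by simp⟩
      · exact ⟨awv.ne, by simp⟩
  · intro z _
    rw [H1u, hu']
  · intro z _
    rw [H1v, hv']
  · intro z hz
    rw [hU', memX] at hz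
    rw [sp_adj]
    have e1 := F2 p pD y yD
    have e2 := F2 p pD u uD
    have e3 := F2 p pD v vD
    simp only [Finset.coe_insert, Finset.coe_singleton, Set.mem_insert_iff, Set.mem_singleton_iff, exists_eq_or_imp, exists_eq_left,
      e1, e2, e3, false_and, or_false]
    constructor
    · rintro ⟨_, h⟩
      rw [hp'] at h
      clear * - h hz
      tauto
    · intro h
      have : H.Adj p z := by rw [hp']; clear * - h; tauto
      exact ⟨this.ne, this⟩
  · intro s hs t ht
    rw [hU'] at hs ht
    rw [sp_adj, sp_adj]
    simp only [Finset.coe_insert, Finset.coe_singleton, Set.mem_insert_iff, Set.mem_singleton_iff, exists_eq_or_imp, exists_eq_left]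
    rw [(sp H {x, y}).adj_comm s u, (sp H {x, y}).adj_comm s v, H1u, H1u, H1v, H1v, H1]
    have hno : s ≠ t → ¬ (H.Adj s x ∧ H.Adj x t) := by
      rintro hst ⟨h1, h2⟩
      have e1 := (hx s).mp h1.symm
      have e2 := (hx t).mp h2
      have e3 := hs.1
      have e4 := ht.1
      rw [memX] at e3 e4
      apply hst
      rw [show s = p by clear * - e1 e3; tauto, show t = p by clear * - e2 e4; tauto]
    rw [H.adj_comm s u, H.adj_comm s v]
    generalize (H.Adj s x ∧ H.Adj x t) = P at *
    generalize (H.Adj s y ∧ H.Adj y t) = Q at *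
    generalize (H.Adj u s ∧ H.Adj u t) = R at *
    generalize (H.Adj v s ∧ H.Adj v t) = S at *
    by_cases hst : s = t
    · simp [hst]
    · have := hno hst
      simp only [ne_eq, hst, not_false_eq_true, true_and, this, false_or]
      clear * -
      tauto

end


section
variable {W : Type} [Fintype W] [DecidableEq W] {H : SimpleGraph W} [DecidableRel H.Adj]

theorem six_sum (hN : Nice H) (R : Finset W) (hR : R.card = 6) :
    ∑ r ∈ R, (H.neighborFinset r ∩ R).card ≤ 12 := by
  classical
  set K := H.induce (R : Set W) with hK
  have hNK : Nice K := ⟨fun a b c h1 h2 h3 => hN.tri a.1 b.1 c.1 h1 h2 h3,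
    fun a c b d hne h1 h2 h3 h4 => Subtype.ext (hN.sq a.1 c.1 b.1 d.1 (fun h => hne (Subtype.ext h)) h1 h2 h3 h4)⟩
  have hmc := moore_cauchy hNK
  have hcard : Fintype.card (R : Set W) = 6 := by simpa using hR
  have hdeg : ∀ r : (R : Set W), K.degree r = (H.neighborFinset r.1 ∩ R).card := by
    intro r
    rw [← card_neighborFinset_eq_degree, ← Finset.card_map (Function.Embedding.subtype _)]
    congr 1
    ext z
    simp only [Finset.mem_map, mem_neighborFinset, Finset.mem_inter]
    constructor
    · rintro ⟨y, hy, rfl⟩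
      exact ⟨hy, y.2⟩
    · rintro ⟨h1, h2⟩
      exact ⟨⟨z, h2⟩, h1, rfl⟩
  have hsum : ∑ r : (R : Set W), K.degree r = ∑ r ∈ R, (H.neighborFinset r ∩ R).card := by
    rw [Finset.sum_congr rfl (fun r _ => hdeg r)]
    exact Finset.sum_coe_sort R (fun r => (H.neighborFinset r ∩ R).card)
  have heven := sum_degrees_eq_twice_card_edges K
  rw [hcard] at hmc
  rw [← hsum]
  generalize ∑ v, K.degree v = s at *
  generalize K.edgeFinset.card = e at *
  have : s < 14 := by nlinarith
  omega

theorem pair_count (hN : Nice H) (h3 : ∀ v, H.degree v = 3) (hc : Fintype.card W = 16) (x : W) :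
    ∃ N2 : Finset W, (∀ z, z ∈ N2 ↔ z ≠ x ∧ ¬ H.Adj x z ∧ ∃ t, H.Adj x t ∧ H.Adj t z) ∧
      ∑ p ∈ N2, (H.neighborFinset p ∩ N2).card ≤ 6 := by
  obtain ⟨B, hB, hBm⟩ := ball_card hN x
  have hB10 : B.card = 10 := by
    rw [hB, Finset.sum_congr rfl (fun v _ => h3 v)]
    simp [h3]
  have hN1 : (insert x (H.neighborFinset x)).card = 4 := by
    rw [Finset.card_insert_of_notMem (by simp), card_neighborFinset_eq_degree, h3]
  have hsub : insert x (H.neighborFinset x) ⊆ B := by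
    intro z hz
    rw [Finset.mem_insert, mem_neighborFinset] at hz
    rw [hBm]
    exact hz.imp_right Or.inl
  obtain ⟨N2, hN2⟩ : ∃ N2, N2 = B \ insert x (H.neighborFinset x) := ⟨_, rfl⟩
  obtain ⟨R, hRdef⟩ : ∃ R, R = Finset.univ \ B := ⟨_, rfl⟩
  have hN2c : N2.card = 6 := by
    rw [hN2, Finset.card_sdiff_of_subset hsub, hB10, hN1]
  have hRc : R.card = 6 := by
    rw [hRdef, Finset.card_sdiff_of_subset (Finset.subset_univ _), hB10, Finset.card_univ, hc]
  have hN2m : ∀ z, z ∈ N2 ↔ z ≠ x ∧ ¬ H.Adj x z ∧ ∃ t, H.Adj x t ∧ H.Adj t z := by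
    intro z
    rw [hN2, Finset.mem_sdiff, hBm, Finset.mem_insert, mem_neighborFinset]
    tauto
  have hRm : ∀ z, z ∈ R ↔ z ∉ B := by intro z; simp [hRdef]
  have hdisj : Disjoint N2 R := by
    rw [Finset.disjoint_left]
    intro z h1 h2
    rw [hRm] at h2
    rw [hN2, Finset.mem_sdiff] at h1
    exact h2 h1.1
  refine ⟨N2, hN2m, ?_⟩
  have key1 : ∀ p ∈ N2, (H.neighborFinset p ∩ N2).card + (H.neighborFinset p ∩ R).card ≤ 2 := by
    intro p hp
    obtain ⟨-, -, t, hxt, htp⟩ := (hN2m p).mp hp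
    rw [← Finset.card_union_of_disjoint (hdisj.mono Finset.inter_subset_right Finset.inter_subset_right)]
    have : H.neighborFinset p ∩ N2 ∪ H.neighborFinset p ∩ R ⊆ (H.neighborFinset p).erase t := by
      intro z hz
      rw [Finset.mem_union, Finset.mem_inter, Finset.mem_inter] at hz
      rw [Finset.mem_erase]
      refine ⟨?_, hz.elim (fun h => h.1) (fun h => h.1)⟩
      rintro rfl
      rcases hz with h | h
      · exact ((hN2m z).mp h.2).2.1 hxt
      · exact (hRm z).mp h.2 ((hBm z).mpr (Or.inr (Or.inl hxt)))
    have := Finset.card_le_card this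
    rw [Finset.card_erase_of_mem (by simpa using htp.symm), card_neighborFinset_eq_degree, h3] at this
    exact this
  have key2 : ∀ r ∈ R, 3 ≤ (H.neighborFinset r ∩ N2).card + (H.neighborFinset r ∩ R).card := by
    intro r hr
    rw [← h3 r, ← card_neighborFinset_eq_degree]
    refine le_trans (Finset.card_le_card ?_) (Finset.card_union_le _ _)
    intro z hz
    rw [Finset.mem_union, Finset.mem_inter, Finset.mem_inter]
    rw [hRm, hBm] at hr
    push Not at hr
    by_cases hzB : z ∈ B
    · left
      refine ⟨hz, ?_⟩
      rw [mem_neighborFinset] at hz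
      rw [hN2, Finset.mem_sdiff, Finset.mem_insert, mem_neighborFinset]
      refine ⟨hzB, ?_⟩
      rintro (h | h)
      · exact hr.2.1 (h ▸ hz.symm)
      · exact hr.2.2 z h hz.symm
    · exact Or.inr ⟨hz, (hRm z).mpr hzB⟩
  have key3 : ∑ p ∈ N2, (H.neighborFinset p ∩ R).card = ∑ r ∈ R, (H.neighborFinset r ∩ N2).card := by
    have := Finset.sum_card_bipartiteAbove_eq_sum_card_bipartiteBelow (s := N2) (t := R) H.Adj
    convert this using 3 with p hp p hp
    · ext z; simp [Finset.bipartiteAbove]; tauto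
    · ext z; simp [Finset.bipartiteBelow, H.adj_comm p]; tauto
  have s1 := Finset.sum_le_sum key1
  have s2 := Finset.sum_le_sum key2
  rw [Finset.sum_add_distrib] at s1 s2
  simp only [Finset.sum_const, hN2c, hRc, smul_eq_mul] at s1 s2
  have s3 := six_sum hN R hRc
  omega

abbrev Tup (W : Type) := W × W × W × W × W

def IsFive (H : SimpleGraph W) (t : Tup W) : Prop :=
  H.Adj t.1 t.2.1 ∧ H.Adj t.2.1 t.2.2.1 ∧ H.Adj t.2.2.1 t.2.2.2.1 ∧ H.Adj t.2.2.2.1 t.2.2.2.2 ∧ H.Adj t.2.2.2.2 t.1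

instance (t : Tup W) : Decidable (IsFive H t) := by unfold IsFive; infer_instance

theorem five_upper (hN : Nice H) (h3 : ∀ v, H.degree v = 3) (hc : Fintype.card W = 16) (x : W) :
    ((Finset.univ.filter (fun t : Tup W => IsFive H t)).filter (fun t => t.1 = x)).card ≤ 6 := by
  obtain ⟨N2, hm, hle⟩ := pair_count hN h3 hc x
  refine le_trans ?_ hle
  rw [← Finset.card_sigma]
  have hin : ∀ a p q b, IsFive H (x, a, p, q, b) → p ∈ N2 ∧ q ∈ N2 := by
    rintro a p q b ⟨h1, h2, h3, h4, h5⟩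
    simp only at h1 h2 h3 h4 h5
    have hpx : p ≠ x := by rintro rfl; exact hN.tri q b p h4 h5 h3.symm
    have hqx : q ≠ x := by rintro rfl; exact hN.tri q a p h1 h2 h3.symm
    rw [hm, hm]
    exact ⟨⟨hpx, fun h => hN.tri x a p h1 h2 h, a, h1, h2⟩, ⟨hqx, fun h => hN.tri x b q h5.symm h4.symm h, b, h5.symm, h4.symm⟩⟩
  refine Finset.card_le_card_of_injOn (fun t : Tup W => (⟨t.2.2.1, t.2.2.2.1⟩ : Σ _ : W, W)) ?_ ?_
  · rintro ⟨x', a, p, q, b⟩ ht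
    simp only [Finset.coe_filter, Finset.mem_filter, Finset.mem_univ, true_and, Set.mem_ofPred_eq] at ht
    obtain ⟨ht, rfl⟩ := ht
    obtain ⟨h1, h2⟩ := hin a p q b ht
    simp only [Finset.coe_sigma, Set.mem_sigma_iff, Finset.mem_coe, Finset.mem_inter, mem_neighborFinset]
    exact ⟨h1, ht.2.2.1, h2⟩
  · rintro ⟨x', a, p, q, b⟩ ht ⟨x'', a', p', q', b'⟩ ht' heq
    simp only [Finset.coe_filter, Finset.mem_filter, Finset.mem_univ, true_and, Set.mem_ofPred_eq] at ht ht'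
    obtain ⟨ht, rfl⟩ := ht
    obtain ⟨ht', rfl⟩ := ht'
    simp only [Sigma.mk.injEq, heq_eq_eq] at heq
    obtain ⟨rfl, rfl⟩ := heq
    obtain ⟨hp, hq⟩ := hin a p q b ht
    have e1 : a = a' := hN.sq _ p a a' ((hm p).mp hp).1.symm ht.1 ht.2.1 ht'.1 ht'.2.1
    have e2 : b = b' := hN.sq _ q b b' ((hm q).mp hq).1.symm ht.2.2.2.2.symm ht.2.2.2.1.symm ht'.2.2.2.2.symm ht'.2.2.2.1.symm
    rw [e1, e2]

theorem five_lower (h3 : ∀ v, H.degree v = 3)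
    (hall : ∀ x w1 w2, w1 ≠ w2 → H.Adj w1 x → H.Adj w2 x → ∃ p q, H.Adj w1 p ∧ H.Adj p q ∧ H.Adj q w2) (x : W) :
    6 ≤ ((Finset.univ.filter (fun t : Tup W => IsFive H t)).filter (fun t => t.1 = x)).card := by
  have hoff : (H.neighborFinset x).offDiag.card = 6 := by
    rw [Finset.offDiag_card, card_neighborFinset_eq_degree, h3]
  rw [← hoff]
  have : ∀ w : W × W, ∃ p q, w ∈ (H.neighborFinset x).offDiag → H.Adj w.1 p ∧ H.Adj p q ∧ H.Adj q w.2 := by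
    intro w
    by_cases hw : w ∈ (H.neighborFinset x).offDiag
    · have := hw
      rw [Finset.mem_offDiag, mem_neighborFinset, mem_neighborFinset] at this
      obtain ⟨p, q, h⟩ := hall x w.1 w.2 this.2.2 this.1.symm this.2.1.symm
      exact ⟨p, q, fun _ => h⟩
    · exact ⟨x, x, fun h => (hw h).elim⟩
  choose p q hpq using this
  refine Finset.card_le_card_of_injOn (fun w => ((x, w.1, p w, q w, w.2) : Tup W)) ?_ ?_
  · intro w hw
    have h := hpq w hw
    rw [Finset.mem_coe, Finset.mem_offDiag, mem_neighborFinset, mem_neighborFinset] at hw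
    simp only [Finset.coe_filter, Finset.mem_filter, Finset.mem_univ, true_and, Set.mem_ofPred_eq, and_true]
    exact ⟨hw.1, h.1, h.2.1, h.2.2, hw.2.1.symm⟩
  · rintro w _ w' _ h
    simp only [Prod.mk.injEq, true_and] at h
    exact Prod.ext h.1 h.2.2.2

theorem five_dvd : 5 ∣ (Finset.univ.filter (fun t : Tup W => IsFive H t)).card := by
  rw [← Fintype.card_subtype]
  by_contra hnd
  let σ : Equiv.Perm {t : Tup W // IsFive H t} :=
    { toFun := fun t => ⟨(t.1.2.1, t.1.2.2.1, t.1.2.2.2.1, t.1.2.2.2.2, t.1.1),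
        t.2.2.1, t.2.2.2.1, t.2.2.2.2.1, t.2.2.2.2.2, t.2.1⟩
      invFun := fun t => ⟨(t.1.2.2.2.2, t.1.1, t.1.2.1, t.1.2.2.1, t.1.2.2.2.1),
        t.2.2.2.2.2, t.2.1, t.2.2.1, t.2.2.2.1, t.2.2.2.2.1⟩
      left_inv := fun t => rfl
      right_inv := fun t => rfl }
  have : Fact (Nat.Prime 5) := ⟨by norm_num⟩
  obtain ⟨t, ht⟩ := Equiv.Perm.exists_fixed_point_of_prime (p := 5) (n := 1) hnd (σ := σ) (by
    ext t <;> rfl)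
  have h := congrArg (fun s : {t : Tup W // IsFive H t} => s.1.1) ht
  have h' : t.1.2.1 = t.1.1 := h
  exact t.2.1.ne h'.symm

theorem L16 : Lstmt 16 24 4 4 := by
  intro W _ _ H _ hN h3 hc hs
  have hall : ∀ v, H.degree v = 3 := by
    by_contra hcon
    push Not at hcon
    obtain ⟨v, hv⟩ := hcon
    have : ∑ v, H.degree v < ∑ v : W, 3 := Finset.sum_lt_sum (fun v _ => h3 v) ⟨v, Finset.mem_univ v, lt_of_le_of_ne (h3 v) hv⟩
    simp [hc] at this
    omega
  by_contra hcon
  have hP : ∀ x w1 w2, w1 ≠ w2 → H.Adj w1 x → H.Adj w2 x → ∃ p q, H.Adj w1 p ∧ H.Adj p q ∧ H.Adj q w2 := by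
    intro x w1 w2 hne h1 h2
    by_contra h
    exact hcon (step16 hN hall hc hne h1 h2 fun p q e1 e2 e3 => h ⟨p, q, e1, e2, e3⟩)
  have h5 := five_dvd (H := H)
  have hcard := Finset.card_eq_sum_card_fiberwise (s := Finset.univ.filter (fun t : Tup W => IsFive H t)) (t := Finset.univ)
    (f := fun t => t.1) (fun _ _ => Finset.mem_coe.mpr (Finset.mem_univ _))
  rw [Finset.sum_congr rfl (fun x _ => le_antisymm (five_upper hN hall hc x) (five_lower hall hP x))] at hcard
  rw [hcard] at h5
  simp [hc] at h5

end

/-- If `G` is a finite connected subcubic simple graph on `n` vertices and `m`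
edges with girth at least five, no induced subdivision of any member of `𝓕`, and `G` is not
isomorphic to any member of `F_{3,3} ∪ F_{4,4}`, then `φ(G) ≤ (2m − n + 2)/7`. -/
theorem statement_15 {V : Type} [Fintype V] (G : SimpleGraph V) (hconn : G.Connected)
    (hsub : ∀ v : V, (G.neighborSet v).ncard ≤ 3)
    (hgirth : 5 ≤ G.girth)
    (hF : ∀ (W : Type) (H : SimpleGraph W), InFamilyF H → ¬ ContainsInducedSubdivision G H)
    (hiso : ¬ ∃ (W : Type) (H : SimpleGraph W),
      (IsInF 3 3 H ∨ IsInF 4 4 H) ∧ Nonempty (G ≃g H)) :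
    (phi G : ℝ) ≤ (2 * (G.edgeSet.ncard : ℝ) - (Nat.card V : ℝ) + 2) / 7 := by
  exact main_of L10 L12 L13 L16 G hconn hsub hgirth hF hiso
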